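/- arXiv:2105.11557 — 2 statements merged into one kernel-verified Lean document; each statement's English description precedes it below -/
import Mathlib

section
/- Let n ≥ 1 and d = 2n. Let Q be a Borel graph on a standard Borel space X such that Q is d-regular (every vertex has exactly d neighbors) and acyclic (so every connected component of Q is a d-regular tree), and let μ be a Borel probability measure on X. Then α_μ(Q) ≥ α_β(G_n): for every β-measurable G_n-independent set J ⊆ Free(2^{F_n}) and every ε > 0, there exists a μ-measurable Q-independent set A ⊆ X with μ(A) ≥ β(J) − ε. -/
open MeasureTheory

/-- The Bernoulli shift action of a group `Γ` on `2^Γ = (Γ → Bool)`,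
given by `(γ · x) δ = x (δ * γ)`. -/
def bernoulliShift {Γ : Type*} [Group Γ] (γ : Γ) (x : Γ → Bool) : Γ → Bool :=
  fun δ => x (δ * γ)

/-- The free part `Free(2^Γ)` of the Bernoulli shift: points with trivial stabilizer. -/
def freePart (Γ : Type*) [Group Γ] : Set (Γ → Bool) :=
  {x | ∀ γ : Γ, γ ≠ 1 → bernoulliShift γ x ≠ x}

/-- `β` is the product of countably many copies of the uniform measure on `{0,1}`:
it gives each cylinder determined by finitely many coordinates its natural measure. -/
def IsBernoulliMeasure {Γ : Type*} [Group Γ] (β : Measure (Γ → Bool)) : Prop :=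
  ∀ (D : Finset Γ) (φ : Γ → Bool),
    β {x | ∀ δ ∈ D, x δ = φ δ} = (1 / 2 : ENNReal) ^ D.card

/-- Adjacency in the Schreier graph of the free part of the Bernoulli shift with
respect to a finite set `F`: distinct free points `x, y` with `y = σ · x` for some
`σ ∈ F ∪ F⁻¹`. -/
def schreierAdj {Γ : Type*} [Group Γ] (F : Finset Γ) (x y : Γ → Bool) : Prop :=
  x ∈ freePart Γ ∧ y ∈ freePart Γ ∧ x ≠ y ∧
    ∃ σ : Γ, (σ ∈ F ∨ σ⁻¹ ∈ F) ∧ y = bernoulliShift σ x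

/-- A set of vertices is independent w.r.t. an adjacency relation if no two of its
elements are adjacent. -/
def IndepIn {V : Type*} (Adj : V → V → Prop) (I : Set V) : Prop :=
  ∀ x ∈ I, ∀ y ∈ I, ¬ Adj x y

/-- Adjacency in the Schreier graph `G_n` of the free part of the Bernoulli shift of the
free group `F_n` w.r.t. its standard generating set. -/
def freeGroupSchreierAdj (n : ℕ) (x y : FreeGroup (Fin n) → Bool) : Prop :=
  x ∈ freePart (FreeGroup (Fin n)) ∧ y ∈ freePart (FreeGroup (Fin n)) ∧ x ≠ y ∧
    ∃ i : Fin n, y = bernoulliShift (FreeGroup.of i) x ∨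
      y = bernoulliShift (FreeGroup.of i)⁻¹ x

lemma avg_lemma {Y : Type*} [MeasurableSpace Y] (ν : Measure Y) {Ω : Type*} [Fintype Ω] [Nonempty Ω]
    (D : Ω → Set Y) (hD : ∀ ω, MeasurableSet (D ω)) (G : Set Y) (hG : MeasurableSet G)
    (p : ENNReal)
    (h : ∀ y ∈ G, (Nat.card {ω // y ∈ D ω} : ENNReal) ≤ p * Fintype.card Ω) :
    ∃ ω, ν (D ω) ≤ ν Gᶜ + p * ν Set.univ := by
  classical
  have key : ∑ ω, ν (D ω) ≤ ∑ ω : Ω, (ν Gᶜ + p * ν Set.univ) := by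
    have h1 : ∀ ω, ν (D ω) ≤ ν Gᶜ + ν (D ω ∩ G) := fun ω => by
      calc ν (D ω) ≤ ν (Gᶜ ∪ (D ω ∩ G)) := measure_mono (by
            intro y hy; by_cases hg : y ∈ G
            · exact Or.inr ⟨hy, hg⟩
            · exact Or.inl hg)
        _ ≤ _ := measure_union_le _ _
    have h2 : ∑ ω, ν (D ω ∩ G) ≤ p * Fintype.card Ω * ν Set.univ := by
      have : ∀ ω, ν (D ω ∩ G) = ∫⁻ y, (D ω ∩ G).indicator 1 y ∂ν := fun ω => by
        rw [lintegral_indicator_one ((hD ω).inter hG)]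
      simp_rw [this]
      rw [← lintegral_finsetSum]
      · rw [← lintegral_const]
        apply lintegral_mono
        intro y
        by_cases hg : y ∈ G
        · refine le_trans (le_of_eq ?_) (h y hg)
          simp only [Set.indicator_apply, Set.mem_inter_iff, hg, and_true, Pi.one_apply]
          rw [Finset.sum_boole, Nat.card_eq_fintype_card, Fintype.card_subtype]
        · simp [hg]
      · intro ω _
        exact measurable_one.indicator ((hD ω).inter hG)
    calc ∑ ω, ν (D ω) ≤ ∑ ω, (ν Gᶜ + ν (D ω ∩ G)) := Finset.sum_le_sum fun ω _ => h1 ω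
      _ = Fintype.card Ω * ν Gᶜ + ∑ ω, ν (D ω ∩ G) := by
          rw [Finset.sum_add_distrib]; simp
      _ ≤ Fintype.card Ω * ν Gᶜ + p * Fintype.card Ω * ν Set.univ := by gcongr
      _ = _ := by simp; ring
  by_contra! hcon
  exact absurd key (not_le.2 (ENNReal.sum_lt_sum_of_nonempty Finset.univ_nonempty
    fun ω _ => hcon ω))

lemma sep_lemma {Y Z : Type*} [MeasurableSpace Y] [MeasurableSpace Z] [StandardBorelSpace Z]
    (ν : Measure Y) [IsFiniteMeasure ν] {ι : Type*} [Finite ι] (u : ι → Y → Z)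
    (hu : ∀ i, Measurable (u i)) (δ : ENNReal) (hδ : δ ≠ 0) :
    ∃ (k : ℕ) (c : Z → (Fin k → Bool)), Measurable c ∧
      MeasurableSet {y | ∃ i j, u i y ≠ u j y ∧ c (u i y) = c (u j y)} ∧
      ν {y | ∃ i j, u i y ≠ u j y ∧ c (u i y) = c (u j y)} ≤ δ := by
  obtain ⟨g, hg, hinj⟩ := MeasurableSpace.measurable_injection_nat_bool_of_countablySeparated Z
  let c : (k : ℕ) → Z → (Fin k → Bool) := fun k z i => g z i
  have hc : ∀ k, Measurable (c k) := fun k =>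
    measurable_pi_lambda _ fun i => (measurable_pi_apply _).comp hg
  let B : ℕ → Set Y := fun k => {y | ∃ i j, u i y ≠ u j y ∧ c k (u i y) = c k (u j y)}
  have hB : ∀ k, MeasurableSet (B k) := by
    intro k
    have : B k = ⋃ i, ⋃ j, ({y | u i y = u j y}ᶜ ∩ {y | c k (u i y) = c k (u j y)}) := by
      ext y; simp [B]
    rw [this]
    exact MeasurableSet.iUnion fun i => MeasurableSet.iUnion fun j =>
      (measurableSet_eq_fun (hu i) (hu j)).compl.inter
        (measurableSet_eq_fun ((hc k).comp (hu i)) ((hc k).comp (hu j)))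
  have hanti : Antitone B := by
    rintro k l hkl y ⟨i, j, h1, h2⟩
    exact ⟨i, j, h1, funext fun m => congrFun h2 (Fin.castLE hkl m)⟩
  have hemp : ⋂ k, B k = ∅ := by
    rw [Set.eq_empty_iff_forall_notMem]
    intro y hy
    rw [Set.mem_iInter] at hy
    have : ∀ p : ι × ι, ∃ k, u p.1 y = u p.2 y ∨ g (u p.1 y) k ≠ g (u p.2 y) k := by
      intro p
      by_cases h : u p.1 y = u p.2 y
      · exact ⟨0, Or.inl h⟩
      · obtain ⟨k, hk⟩ := Function.ne_iff.1 (fun h' => h (hinj h'))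
        exact ⟨k, Or.inr hk⟩
    choose K hK using this
    obtain ⟨N, hN⟩ := (Set.finite_range K).bddAbove
    obtain ⟨i, j, h1, h2⟩ := hy (N + 1)
    rcases hK (i, j) with h | h
    · exact h1 h
    · exact h (congrFun h2 ⟨K (i, j), Nat.lt_succ_of_le (hN ⟨_, rfl⟩)⟩)
  have ht := tendsto_measure_iInter_atTop (μ := ν) (fun k => (hB k).nullMeasurableSet) hanti
    ⟨0, measure_ne_top _ _⟩
  rw [hemp, measure_empty] at ht
  obtain ⟨k, hk⟩ := (ht.eventually_le_const (pos_iff_ne_zero.2 hδ)).exists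
  exact ⟨k, c k, hc k, hB k, hk⟩

lemma count_max {C K : Type*} [Fintype C] [DecidableEq C] [Fintype K] (v : C → ℕ)
    (hv : Function.Injective v) (u : K → C) (hu : Function.Injective u) (κ₀ : K) :
    Nat.card {p : Equiv.Perm C // ∀ κ, v (p (u κ)) ≤ v (p (u κ₀))} * Fintype.card K
      ≤ Fintype.card (Equiv.Perm C) := by
  classical
  let A : K → Finset (Equiv.Perm C) := fun κ₁ =>
    Finset.univ.filter fun p => ∀ κ, v (p (u κ)) ≤ v (p (u κ₁))
  have hA : ∀ κ₁, (A κ₀).card ≤ (A κ₁).card := by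
    intro κ₁
    apply Finset.card_le_card_of_injOn (fun p => p * Equiv.swap (u κ₀) (u κ₁))
    · intro p hp
      simp only [A, Finset.coe_filter, Finset.mem_univ, true_and, Set.mem_ofPred_eq] at hp ⊢
      intro κ
      simp only [Equiv.Perm.coe_mul, Function.comp_apply, Equiv.swap_apply_right]
      by_cases h0 : κ = κ₀
      · subst h0; rw [Equiv.swap_apply_left]; exact hp _
      by_cases h1 : κ = κ₁
      · subst h1; rw [Equiv.swap_apply_right]
      · rw [Equiv.swap_apply_of_ne_of_ne (fun h => h0 (hu h)) (fun h => h1 (hu h))]; exact hp _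
    · intro p _ q _ h
      exact mul_right_cancel h
  have hdisj : Set.PairwiseDisjoint (Finset.univ : Finset K) A := by
    intro κ₁ _ κ₂ _ hne
    rw [Function.onFun, Finset.disjoint_left]
    intro p h1 h2
    simp only [A, Finset.mem_filter, Finset.mem_univ, true_and] at h1 h2
    exact hne (hu (p.injective (hv (le_antisymm (h2 κ₁) (h1 κ₂)))))
  have hcard : Nat.card {p : Equiv.Perm C // ∀ κ, v (p (u κ)) ≤ v (p (u κ₀))} = (A κ₀).card := by
    rw [Nat.card_eq_fintype_card, Fintype.card_subtype]
  rw [hcard]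
  calc (A κ₀).card * Fintype.card K = ∑ κ : K, (A κ₀).card := by simp [mul_comm]
    _ ≤ ∑ κ : K, (A κ).card := Finset.sum_le_sum fun κ _ => hA κ
    _ = (Finset.univ.biUnion A).card := (Finset.card_biUnion hdisj).symm
    _ ≤ _ := Finset.card_le_univ _

section prim
variable {Y : Type*} (a b : Equiv.Perm Y) 

lemma dih_conj (ha : ∀ y, a (a y) = y) (hb : ∀ y, b (b y) = y) (m : ℤ) (y : Y) :
    ((b * a) ^ m) (a y) = a (((b * a) ^ (-m)) y) := by
  have ha' : a⁻¹ = a := by ext y; rw [Equiv.Perm.inv_eq_iff_eq, ha]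
  have hb' : b⁻¹ = b := by ext y; rw [Equiv.Perm.inv_eq_iff_eq, hb]
  have h1 : a * (b * a)⁻¹ * a⁻¹ = b * a := by
    rw [mul_inv_rev, ha', hb']
    ext y; simp [ha]
  have h2 : (b * a) ^ m = a * (b * a) ^ (-m) * a⁻¹ := by
    rw [zpow_neg, ← inv_zpow, ← conj_zpow, h1]
  rw [h2]
  simp

lemma dih_free (ha : ∀ y, a (a y) = y) (hb : ∀ y, b (b y) = y) (ha0 : ∀ y, a y ≠ y)
    (hb0 : ∀ y, b y ≠ y) (m l : ℤ) (y : Y) :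
    ((b * a) ^ m) y ≠ a (((b * a) ^ l) y) := by
  intro h
  set T := b * a with hT
  have key : ∀ (i : ℤ) (z : Y), a ((T ^ i) z) ≠ z := by
    intro i z hz
    rcases Int.even_or_odd' i with ⟨j, rfl | rfl⟩
    · apply ha0 ((T ^ j) z)
      have e1 : (T ^ (2 * j)) z = (T ^ j) ((T ^ j) z) := by
        rw [← Equiv.Perm.mul_apply, ← zpow_add]; congr 2; ring
      rw [e1] at hz
      have e2 : a ((T ^ j) ((T ^ j) z)) = (T ^ (-j)) (a ((T ^ j) z)) := by
        rw [dih_conj a b ha hb, neg_neg]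
      rw [e2] at hz
      have := congrArg (T ^ j) hz
      rwa [← Equiv.Perm.mul_apply, ← zpow_add, add_neg_cancel, zpow_zero, Equiv.Perm.one_apply] at this
    · apply hb0 (a ((T ^ j) z))
      have e1 : (T ^ (2 * j + 1)) z = (T ^ j) ((T ^ (j + 1)) z) := by
        rw [← Equiv.Perm.mul_apply, ← zpow_add]; congr 2; ring
      rw [e1] at hz
      have e2 : a ((T ^ j) ((T ^ (j + 1)) z)) = (T ^ (-j)) (a ((T ^ (j + 1)) z)) := by
        rw [dih_conj a b ha hb, neg_neg]
      rw [e2] at hz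
      have := congrArg (T ^ j) hz
      rw [← Equiv.Perm.mul_apply, ← zpow_add, add_neg_cancel, zpow_zero, Equiv.Perm.one_apply] at this
      have h4 : (T ^ (j + 1)) z = b (a ((T ^ j) z)) := by
        rw [add_comm, zpow_add, zpow_one]; rfl
      rw [h4] at this
      have h5 := congrArg a this
      rwa [ha] at h5
  apply key (l - m) ((T ^ m) y)
  rw [← Equiv.Perm.mul_apply (T ^ (l - m)), ← zpow_add, sub_add_cancel]
  exact h.symm

lemma measurable_zpow_perm [MeasurableSpace Y] (T : Equiv.Perm Y) (h1 : Measurable T)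
    (h2 : Measurable (T⁻¹ : Equiv.Perm Y)) (m : ℤ) : Measurable (T ^ m : Equiv.Perm Y) := by
  have key : ∀ (S : Equiv.Perm Y) (_ : Measurable S) (k : ℕ), Measurable (S ^ k : Equiv.Perm Y) := by
    intro S hS k
    rw [← Equiv.Perm.iterate_eq_pow]
    exact hS.iterate k
  cases m with
  | ofNat k => simpa using key T h1 k
  | negSucc k =>
    rw [zpow_negSucc, ← inv_pow]
    exact key _ h2 _

lemma measurable_finset_sup_nat [MeasurableSpace Y] {ι : Type*} (F : Finset ι) (f : ι → Y → ℕ)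
    (hf : ∀ i ∈ F, Measurable (f i)) : Measurable (fun y => F.sup fun i => f i y) := by
  classical
  induction F using Finset.induction_on with
  | empty => simp
  | insert i F hi ih =>
    simp only [Finset.sup_insert]
    exact (hf i (by simp)).sup (ih fun j hj => hf j (by simp [hj]))

lemma zpow_window (T : Equiv.Perm Y) (y : Y) (p : ℕ) (hp : 0 < p) (hT : (T ^ (p : ℤ)) y = y)
    (A m : ℤ) : ∃ m' ∈ Finset.Icc A (A + p - 1), (T ^ m) y = (T ^ m') y := by
  have hp' : (0 : ℤ) < p := by exact_mod_cast hp
  refine ⟨A + (m - A) % p, ?_, ?_⟩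
  · have h1 := Int.emod_nonneg (m - A) hp'.ne'
    have h2 := Int.emod_lt_of_pos (m - A) hp'
    rw [Finset.mem_Icc]; constructor <;> linarith
  · have h3 : m = A + (m - A) % p + p * ((m - A) / p) := by
      have := Int.emod_add_mul_ediv (m - A) p
      linarith
    conv_lhs => rw [h3]
    rw [zpow_add, zpow_mul, Equiv.Perm.mul_apply]
    congr 1
    exact Equiv.Perm.zpow_apply_eq_self_of_apply_eq_self hT _

lemma prim_fpf [MeasurableSpace Y] [StandardBorelSpace Y] (ν : Measure Y) [IsFiniteMeasure ν]
    (hma : Measurable a) (hmb : Measurable b)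
    (ha : ∀ y, a (a y) = y) (hb : ∀ y, b (b y) = y) (ha0 : ∀ y, a y ≠ y)
    (hb0 : ∀ y, b y ≠ y) (δ : ENNReal) (hδ : δ ≠ 0) :
    ∃ s : Y → Bool, Measurable s ∧ ν {y | s (a y) = s y} ≤ δ ∧ ν {y | s (b y) = s y} ≤ δ := by
  classical
  have ha' : a⁻¹ = a := by ext y; rw [Equiv.Perm.inv_eq_iff_eq, ha]
  have hb' : b⁻¹ = b := by ext y; rw [Equiv.Perm.inv_eq_iff_eq, hb]
  set T := b * a with hT
  have hmT : ∀ m : ℤ, Measurable (T ^ m : Equiv.Perm Y) := by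
    apply measurable_zpow_perm
    · exact hmb.comp hma
    · rw [hT, mul_inv_rev, ha', hb']; exact hma.comp hmb
  -- choose N
  obtain ⟨N, hN⟩ : ∃ N : ℕ, ν Set.univ / ((N : ENNReal) + 1) ≤ δ / 2 := by
    have h2 : δ / 2 ≠ 0 := by simp [hδ]
    obtain ⟨N, hN⟩ := ENNReal.exists_nat_mul_gt h2 (measure_ne_top ν Set.univ)
    refine ⟨N, ENNReal.div_le_of_le_mul ?_⟩
    refine hN.le.trans ?_
    rw [mul_comm]; gcongr; exact le_self_add
  let K := ↥(Finset.Icc (-(N:ℤ) - 1) N) × Bool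
  let u : K → Y → Y := fun κ y => if κ.2 then a ((T ^ (κ.1 : ℤ)) y) else (T ^ (κ.1 : ℤ)) y
  have hu : ∀ κ, Measurable (u κ) := by
    rintro ⟨m, ε⟩
    cases ε
    · simpa [u] using hmT m
    · have := hma.comp (hmT m)
      simpa [u, Function.comp_def] using this
  obtain ⟨k, c, hc, hBm, hBν⟩ := sep_lemma ν u hu (δ / 2) (by simp [hδ])
  set B := {y | ∃ i j, u i y ≠ u j y ∧ c (u i y) = c (u j y)} with hBdef
  let v : (Fin k → Bool) → ℕ := fun z => (Fintype.equivFin (Fin k → Bool) z : ℕ)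
  have hv : Function.Injective v := fun z w h => (Fintype.equivFin _).injective (Fin.ext h)
  let L : Equiv.Perm (Fin k → Bool) → Y → ℕ := fun p y => v (p (c y))
  have hL : ∀ p, Measurable (L p) := fun p =>
    (measurable_of_finite (fun z : Fin k → Bool => v (p z))).comp hc
  let W : Finset ℤ := Finset.Icc (-(N:ℤ)) N
  let W' : Finset ℤ := Finset.Icc (-(N:ℤ) - 1) (N - 1)
  let MP : Equiv.Perm (Fin k → Bool) → Finset ℤ → Y → ℕ := fun p F y =>
    F.sup fun m => L p ((T ^ m) y)
  let MO : Equiv.Perm (Fin k → Bool) → Finset ℤ → Y → ℕ := fun p F y =>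
    F.sup fun m => L p (a ((T ^ m) y))
  have hMP : ∀ p F, Measurable (MP p F) := fun p F => by
    apply measurable_finset_sup_nat
    intro m _; exact (hL p).comp (hmT m)
  have hMO : ∀ p F, Measurable (MO p F) := fun p F => by
    apply measurable_finset_sup_nat
    intro m _; exact (hL p).comp (hma.comp (hmT m))
  let s : Equiv.Perm (Fin k → Bool) → Y → Bool := fun p y => decide (MO p W y < MP p W y)
  have hs : ∀ p, Measurable (s p) := fun p => by
    apply measurable_to_bool
    have : s p ⁻¹' {true} = {y | MO p W y < MP p W y} := by ext y; simp [s]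
    rw [this]
    exact measurableSet_lt (hMO p W) (hMP p W)
  -- transformation rules
  have hPa : ∀ p y, MP p W (a y) = MO p W y := by
    intro p y
    apply le_antisymm
    · refine Finset.sup_le fun m hm => ?_
      rw [dih_conj a b ha hb]
      exact Finset.le_sup (f := fun m => L p (a ((T ^ m) y)))
        (by simp only [W, Finset.mem_Icc] at hm ⊢; omega)
    · refine Finset.sup_le fun m hm => ?_
      have := dih_conj a b ha hb (-m) y
      rw [neg_neg] at this
      rw [← this]
      exact Finset.le_sup (f := fun m => L p ((T ^ m) (a y)))
        (by simp only [W, Finset.mem_Icc] at hm ⊢; omega)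
  have hOa : ∀ p y, MO p W (a y) = MP p W y := by
    intro p y
    rw [← hPa, ha]
  have hby : ∀ y, b y = a ((T ^ (-1 : ℤ)) y) := by
    intro y
    have : (T ^ (-1 : ℤ)) y = a (b y) := by
      rw [zpow_neg_one, hT, mul_inv_rev, ha', hb']; rfl
    rw [this, ha]
  have hPb : ∀ p y, MP p W (b y) = MO p W' y := by
    intro p y
    have e : ∀ m : ℤ, (T ^ m) (b y) = a ((T ^ (-m - 1)) y) := by
      intro m
      rw [hby, dih_conj a b ha hb, ← Equiv.Perm.mul_apply (T ^ (-m)), ← zpow_add]; rfl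
    apply le_antisymm
    · refine Finset.sup_le fun m hm => ?_
      rw [e]
      exact Finset.le_sup (f := fun m => L p (a ((T ^ m) y)))
        (by simp only [W, W', Finset.mem_Icc] at hm ⊢; omega)
    · refine Finset.sup_le fun m hm => ?_
      have := e (-m - 1)
      rw [show -(-m - 1) - 1 = m by ring] at this
      rw [← this]
      exact Finset.le_sup (f := fun m => L p ((T ^ m) (b y)))
        (by simp only [W, W', Finset.mem_Icc] at hm ⊢; omega)
  have hOb : ∀ p y, MO p W (b y) = MP p W' y := by
    intro p y
    have e : ∀ m : ℤ, a ((T ^ m) (b y)) = (T ^ (-m - 1)) y := by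
      intro m
      rw [hby, dih_conj a b ha hb, ← Equiv.Perm.mul_apply (T ^ (-m)), ← zpow_add, ha]; rfl
    apply le_antisymm
    · refine Finset.sup_le fun m hm => ?_
      rw [e]
      exact Finset.le_sup (f := fun m => L p ((T ^ m) y))
        (by simp only [W, W', Finset.mem_Icc] at hm ⊢; omega)
    · refine Finset.sup_le fun m hm => ?_
      have := e (-m - 1)
      rw [show -(-m - 1) - 1 = m by ring] at this
      rw [← this]
      exact Finset.le_sup (f := fun m => L p (a ((T ^ m) (b y))))
        (by simp only [W, W', Finset.mem_Icc] at hm ⊢; omega)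
  -- injectivity off B
  have hinj : ∀ y, y ∉ B → ∀ p i j, L p (u i y) = L p (u j y) → u i y = u j y := by
    intro y hy p i j h
    by_contra hne
    exact hy ⟨i, j, hne, p.injective (hv h)⟩
  have hne : ∀ y, y ∉ B → ∀ p, ∀ m ∈ Finset.Icc (-(N:ℤ) - 1) N, ∀ l ∈ Finset.Icc (-(N:ℤ) - 1) N,
      L p ((T ^ m) y) ≠ L p (a ((T ^ l) y)) := by
    intro y hy p m hm l hl h
    have := hinj y hy p (⟨m, hm⟩, false) (⟨l, hl⟩, true) (by simpa [u] using h)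
    simp only [u] at this
    exact dih_free a b ha hb ha0 hb0 m l y (by simpa using this)
  have hW0 : W.Nonempty := ⟨0, by simp [W]⟩
  have hWs : W ⊆ Finset.Icc (-(N:ℤ) - 1) N := by
    intro m hm; simp only [W, Finset.mem_Icc] at hm ⊢; omega
  have hMne : ∀ y, y ∉ B → ∀ p, MO p W y ≠ MP p W y := by
    intro y hy p h
    obtain ⟨m, hm, hm'⟩ := Finset.exists_mem_eq_sup W hW0 (fun m => L p ((T ^ m) y))
    obtain ⟨l, hl, hl'⟩ := Finset.exists_mem_eq_sup W hW0 (fun m => L p (a ((T ^ m) y)))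
    exact hne y hy p m (hWs hm) l (hWs hl) (by rw [← hm', ← hl']; exact h.symm)
  have hdefa : ∀ p, {y | s p (a y) = s p y} ⊆ B := by
    intro p y hy
    by_contra hyB
    have h1 := hMne y hyB p
    simp only [s, Set.mem_ofPred_eq, hPa, hOa, decide_eq_decide] at hy
    omega
  have hcardK : Fintype.card K = 2 * (2 * N + 2) := by
    simp only [K, Fintype.card_prod, Fintype.card_coe, Int.card_Icc, Fintype.card_bool]
    omega
  -- defects for b
  have hcount : ∀ y ∈ Bᶜ, (Nat.card {p // y ∈ {y | s p (b y) = s p y}} : ENNReal) ≤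
      ((N : ENNReal) + 1)⁻¹ * Fintype.card (Equiv.Perm (Fin k → Bool)) := by
    intro y hy
    by_cases hcyc : ∃ q : ℕ, 0 < q ∧ q ≤ 2 * N + 1 ∧ (T ^ (q : ℤ)) y = y
    · obtain ⟨q, hq0, hq, hqy⟩ := hcyc
      have e1 : ∀ p, MP p W y = MP p W' y := by
        intro p
        apply le_antisymm
        · refine Finset.sup_le fun m hm => ?_
          obtain ⟨m', hm', h'⟩ := zpow_window T y q hq0 hqy (-(N:ℤ) - 1) m
          rw [h']
          exact Finset.le_sup (f := fun m => L p ((T ^ m) y))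
            (by simp only [W', Finset.mem_Icc] at hm' ⊢; omega)
        · refine Finset.sup_le fun m hm => ?_
          obtain ⟨m', hm', h'⟩ := zpow_window T y q hq0 hqy (-(N:ℤ)) m
          rw [h']
          exact Finset.le_sup (f := fun m => L p ((T ^ m) y))
            (by simp only [W, Finset.mem_Icc] at hm' ⊢; omega)
      have e2 : ∀ p, MO p W y = MO p W' y := by
        intro p
        apply le_antisymm
        · refine Finset.sup_le fun m hm => ?_
          obtain ⟨m', hm', h'⟩ := zpow_window T y q hq0 hqy (-(N:ℤ) - 1) m
          rw [h']
          exact Finset.le_sup (f := fun m => L p (a ((T ^ m) y)))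
            (by simp only [W', Finset.mem_Icc] at hm' ⊢; omega)
        · refine Finset.sup_le fun m hm => ?_
          obtain ⟨m', hm', h'⟩ := zpow_window T y q hq0 hqy (-(N:ℤ)) m
          rw [h']
          exact Finset.le_sup (f := fun m => L p (a ((T ^ m) y)))
            (by simp only [W, Finset.mem_Icc] at hm' ⊢; omega)
      have : IsEmpty {p // y ∈ {y | s p (b y) = s p y}} := by
        constructor
        rintro ⟨p, hp⟩
        have h1 := hMne y hy p
        simp only [s, Set.mem_ofPred_eq, hPb, hOb, decide_eq_decide, ← e1, ← e2] at hp
        omega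
      rw [Nat.card_of_isEmpty]
      simp
    · have huinj : ∀ y' , y' = y → Function.Injective (fun κ => u κ y') := by
        intro y' hy'
        rw [hy']
        have hz : ∀ m ∈ Finset.Icc (-(N:ℤ) - 1) N, ∀ l ∈ Finset.Icc (-(N:ℤ) - 1) N, m < l →
            (T ^ m) y ≠ (T ^ l) y := by
          intro m hm l hl hml h
          rw [Finset.mem_Icc] at hm hl
          apply hcyc
          refine ⟨(l - m).toNat, by omega, by omega, ?_⟩
          rw [Int.toNat_of_nonneg (by omega)]
          have := congrArg (T ^ (-m)) h
          rw [← Equiv.Perm.mul_apply, ← Equiv.Perm.mul_apply, ← zpow_add, ← zpow_add,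
            neg_add_cancel, zpow_zero, Equiv.Perm.one_apply] at this
          rw [show l - m = -m + l by ring]
          exact this.symm
        have hz' : ∀ m ∈ Finset.Icc (-(N:ℤ) - 1) N, ∀ l ∈ Finset.Icc (-(N:ℤ) - 1) N,
            (T ^ m) y = (T ^ l) y → m = l := by
          intro m hm l hl h
          rcases lt_trichotomy m l with h' | h' | h'
          · exact absurd h (hz m hm l hl h')
          · exact h'
          · exact absurd h.symm (hz l hl m hm h')
        rintro ⟨⟨m, hm⟩, ε⟩ ⟨⟨l, hl⟩, ε'⟩ h
        cases ε <;> cases ε' <;> simp only [u] at h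
        · have := hz' m hm l hl (by simpa using h)
          subst this; rfl
        · exact absurd (by simpa using h) (dih_free a b ha hb ha0 hb0 m l y)
        · exact absurd (by simpa using h.symm) (dih_free a b ha hb ha0 hb0 l m y)
        · have := hz' m hm l hl (by simpa using h)
          subst this; rfl
      have huc : Function.Injective (fun κ => c (u κ y)) := by
        intro κ κ' h
        apply huinj y rfl
        by_contra hne'
        exact hy ⟨κ, κ', hne', h⟩
      have hlo : -(N:ℤ) - 1 ∈ Finset.Icc (-(N:ℤ) - 1) N := by simp; omega
      have hhi : (N:ℤ) ∈ Finset.Icc (-(N:ℤ) - 1) N := by simp; omega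
      let x : Fin 2 × Bool → K := fun t => (if t.1 = 0 then ⟨_, hlo⟩ else ⟨_, hhi⟩, t.2)
      let Sx : Fin 2 × Bool → Finset (Equiv.Perm (Fin k → Bool)) := fun t =>
        Finset.univ.filter fun p => ∀ κ, v (p (c (u κ y))) ≤ v (p (c (u (x t) y)))
      have hSx : ∀ t, (Sx t).card * (2 * (2 * N + 2)) ≤ Fintype.card (Equiv.Perm (Fin k → Bool)) := by
        intro t
        have := count_max v hv (fun κ => c (u κ y)) huc (x t)
        rw [hcardK, Nat.card_eq_fintype_card, Fintype.card_subtype] at this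
        exact this
      have hsub : (Finset.univ.filter fun p => s p (b y) = s p y) ⊆ Finset.univ.biUnion Sx := by
        intro p hp
        simp only [Finset.mem_filter, Finset.mem_univ, true_and, s, hPb, hOb,
          decide_eq_decide] at hp
        by_contra hcon
        simp only [Finset.mem_biUnion, Finset.mem_univ, true_and, Sx, Finset.mem_filter,
          not_exists, not_forall, not_le] at hcon
        have : Nonempty K := ⟨x (0, false)⟩
        obtain ⟨⟨⟨m, hm⟩, ε⟩, hmax⟩ := Finite.exists_max (fun κ : K => L p (u κ y))
        have hm1 : m ≠ -(N:ℤ) - 1 := by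
          rintro rfl
          obtain ⟨κ, hκ⟩ := hcon (0, ε)
          exact absurd (hmax κ) (not_le.2 hκ)
        have hm2 : m ≠ N := by
          rintro rfl
          obtain ⟨κ, hκ⟩ := hcon (1, ε)
          exact absurd (hmax κ) (not_le.2 hκ)
        have hmI := Finset.mem_Icc.1 hm
        have hmW : m ∈ W := by simp only [W, Finset.mem_Icc]; omega
        have hmW' : m ∈ W' := by simp only [W', Finset.mem_Icc]; omega
        have hW's : W' ⊆ Finset.Icc (-(N:ℤ) - 1) N := by
          intro m hm; simp only [W', Finset.mem_Icc] at hm ⊢; omega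
        cases ε
        · have g1 : ∀ F : Finset ℤ, m ∈ F → F ⊆ Finset.Icc (-(N:ℤ) - 1) N →
              MO p F y < MP p F y := by
            intro F hmF hF
            have h1 : L p ((T ^ m) y) ≤ MP p F y :=
              Finset.le_sup (f := fun m => L p ((T ^ m) y)) hmF
            refine lt_of_lt_of_le ?_ h1
            obtain ⟨l, hl, hl'⟩ := Finset.exists_mem_eq_sup F ⟨m, hmF⟩ (fun m => L p (a ((T ^ m) y)))
            have h2 := hmax (⟨l, hF hl⟩, true)
            simp only [u] at h2
            have h3 := hne y hy p m hm l (hF hl)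
            change F.sup _ < _
            rw [hl']
            exact lt_of_le_of_ne (by simpa using h2) h3.symm
          have := g1 W hmW hWs
          have := g1 W' hmW' hW's
          omega
        · have g1 : ∀ F : Finset ℤ, m ∈ F → F ⊆ Finset.Icc (-(N:ℤ) - 1) N →
              MP p F y < MO p F y := by
            intro F hmF hF
            have h1 : L p (a ((T ^ m) y)) ≤ MO p F y :=
              Finset.le_sup (f := fun m => L p (a ((T ^ m) y))) hmF
            refine lt_of_lt_of_le ?_ h1
            obtain ⟨l, hl, hl'⟩ := Finset.exists_mem_eq_sup F ⟨m, hmF⟩ (fun m => L p ((T ^ m) y))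
            have h2 := hmax (⟨l, hF hl⟩, false)
            simp only [u] at h2
            have h3 := hne y hy p l (hF hl) m hm
            change F.sup _ < _
            rw [hl']
            exact lt_of_le_of_ne (by simpa using h2) h3
          have := g1 W hmW hWs
          have := g1 W' hmW' hW's
          omega
      have hfin : (Finset.univ.filter fun p => s p (b y) = s p y).card * (N + 1) ≤
          Fintype.card (Equiv.Perm (Fin k → Bool)) := by
        have h1 := (Finset.card_le_card hsub).trans Finset.card_biUnion_le
        have h2 : (∑ t, (Sx t).card) * (2 * (2 * N + 2)) ≤
            4 * Fintype.card (Equiv.Perm (Fin k → Bool)) := by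
          rw [Finset.sum_mul]
          refine (Finset.sum_le_sum fun t _ => hSx t).trans ?_
          simp
        have h3 := Nat.mul_le_mul_right (2 * (2 * N + 2)) h1
        nlinarith
      have hcd : Nat.card {p // y ∈ {y | s p (b y) = s p y}} =
          (Finset.univ.filter fun p => s p (b y) = s p y).card := by
        rw [Nat.card_eq_fintype_card, Fintype.card_subtype]; rfl
      rw [hcd, mul_comm, ← div_eq_mul_inv, ENNReal.le_div_iff_mul_le (by simp) (by simp)]
      exact_mod_cast hfin
  obtain ⟨p, hp⟩ := avg_lemma ν (fun p => {y | s p (b y) = s p y})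
    (fun p => measurableSet_eq_fun ((hs p).comp hmb) (hs p)) Bᶜ hBm.compl _ hcount
  refine ⟨s p, hs p, ?_, ?_⟩
  · exact (measure_mono (hdefa p)).trans (hBν.trans ENNReal.half_le_self)
  · refine hp.trans ?_
    rw [compl_compl, ← ENNReal.add_halves δ]
    refine add_le_add hBν ?_
    rw [mul_comm, ← ENNReal.div_eq_inv_mul.trans (mul_comm _ _)]
    exact hN

lemma prim_inv [MeasurableSpace Y] [StandardBorelSpace Y] (ν : Measure Y) [IsFiniteMeasure ν]
    (a b : Y → Y) (hma : Measurable a) (hmb : Measurable b)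
    (ha : ∀ y, a (a y) = y) (hb : ∀ y, b (b y) = y) (δ : ENNReal) (hδ : δ ≠ 0) :
    ∃ s : Y → Bool, Measurable s ∧ ν {y | a y ≠ y ∧ s (a y) = s y} ≤ δ ∧
      ν {y | b y ≠ y ∧ s (b y) = s y} ≤ δ := by
  classical
  let d : (Y → Y) → Y × Bool → Y × Bool := fun f z =>
    if f z.1 = z.1 then (z.1, !z.2) else (f z.1, z.2)
  have hd : ∀ f : Y → Y, (∀ y, f (f y) = y) → ∀ z, d f (d f z) = z := by
    rintro f hf ⟨y, e⟩
    by_cases h : f y = y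
    · simp [d, h]
    · have h' : ¬ y = f y := fun h' => h h'.symm
      simp [d, h, hf, h']
  have hd0 : ∀ f : Y → Y, ∀ z, d f z ≠ z := by
    rintro f ⟨y, e⟩
    by_cases h : f y = y
    · simp [d, h]
    · simp [d, h]
  have hdm : ∀ f : Y → Y, Measurable f → Measurable (d f) := by
    intro f hf
    refine Measurable.ite ?_ ?_ ?_
    · exact measurableSet_eq_fun (hf.comp measurable_fst) measurable_fst
    · exact measurable_fst.prodMk ((measurable_of_finite (fun e : Bool => !e)).comp measurable_snd)
    · exact (hf.comp measurable_fst).prodMk measurable_snd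
  have hin : Measurable (fun y : Y => (y, false)) := measurable_id.prodMk measurable_const
  obtain ⟨s, hs, h1, h2⟩ := prim_fpf (⟨d a, d a, hd a ha, hd a ha⟩ : Equiv.Perm (Y × Bool))
    ⟨d b, d b, hd b hb, hd b hb⟩ (ν.map fun y => (y, false)) (hdm a hma) (hdm b hmb)
    (hd a ha) (hd b hb) (hd0 a) (hd0 b) δ hδ
  refine ⟨fun y => s (y, false), hs.comp hin, ?_, ?_⟩
  · refine le_trans ?_ h1
    refine le_trans (measure_mono ?_) (Measure.le_map_apply hin.aemeasurable _)
    rintro y ⟨hy1, hy2⟩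
    change s (d a (y, false)) = s (y, false)
    simpa [d, hy1] using hy2
  · refine le_trans ?_ h2
    refine le_trans (measure_mono ?_) (Measure.le_map_apply hin.aemeasurable _)
    rintro y ⟨hy1, hy2⟩
    change s (d b (y, false)) = s (y, false)
    simpa [d, hy1] using hy2

end prim

lemma exists_pairing {I : Type*} [DecidableEq I] (S : Finset I) :
    ∃ p : I → I, (∀ i, p (p i) = i) ∧ (∀ i ∈ S, p i ∈ S) ∧ (∀ i, i ∉ S → p i = i) ∧
      (∀ i ∈ S, ∀ j ∈ S, p i = i → p j = j → i = j) := by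
  induction S using Finset.strongInduction with
  | H S ih =>
    by_cases hS : S.card ≤ 1
    · exact ⟨id, fun _ => rfl, fun _ h => h, fun _ _ => rfl, fun i hi j hj _ _ =>
        Finset.card_le_one.1 hS i hi j hj⟩
    · obtain ⟨x, hx, y, hy, hxy⟩ := Finset.one_lt_card.1 (not_le.1 hS)
      obtain ⟨p, h1, h2, h3, h4⟩ := ih ((S.erase x).erase y) (by
        refine lt_of_le_of_lt (Finset.erase_subset _ _) (Finset.erase_ssubset hx))
      have hpx : p x = x := h3 x (by simp)
      have hpy : p y = y := h3 y (by simp)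
      refine ⟨fun i => Equiv.swap x y (p i), ?_, ?_, ?_, ?_⟩
      · intro i
        by_cases hix : i = x
        · subst hix; simp [hpx, hpy]
        by_cases hiy : i = y
        · subst hiy; simp [hpx, hpy]
        have e1 : p i ≠ x := fun h => hix (by rw [← h1 i, h, hpx])
        have e2 : p i ≠ y := fun h => hiy (by rw [← h1 i, h, hpy])
        show Equiv.swap x y (p (Equiv.swap x y (p i))) = i
        rw [Equiv.swap_apply_of_ne_of_ne e1 e2, h1, Equiv.swap_apply_of_ne_of_ne hix hiy]
      · intro i hi
        by_cases hix : i = x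
        · subst hix; simpa [hpx] using hy
        by_cases hiy : i = y
        · subst hiy; simpa [hpy] using hx
        have e1 : p i ≠ x := fun h => hix (by rw [← h1 i, h, hpx])
        have e2 : p i ≠ y := fun h => hiy (by rw [← h1 i, h, hpy])
        show Equiv.swap x y (p i) ∈ S
        rw [Equiv.swap_apply_of_ne_of_ne e1 e2]
        have := h2 i (by simp [hix, hiy, hi])
        simp only [Finset.mem_erase] at this
        exact this.2.2
      · intro i hi
        have hix : i ≠ x := fun h => hi (h ▸ hx)
        have hiy : i ≠ y := fun h => hi (h ▸ hy)
        show Equiv.swap x y (p i) = i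
        rw [h3 i (by simp [hi]), Equiv.swap_apply_of_ne_of_ne hix hiy]
      · have key : ∀ i ∈ S, Equiv.swap x y (p i) = i → i ∈ (S.erase x).erase y ∧ p i = i := by
          intro i hi h
          by_cases hix : i = x
          · subst hix; rw [hpx, Equiv.swap_apply_left] at h; exact absurd h.symm hxy
          by_cases hiy : i = y
          · subst hiy; rw [hpy, Equiv.swap_apply_right] at h; exact absurd h hxy
          have e1 : p i ≠ x := fun h => hix (by rw [← h1 i, h, hpx])
          have e2 : p i ≠ y := fun h => hiy (by rw [← h1 i, h, hpy])
          rw [Equiv.swap_apply_of_ne_of_ne e1 e2] at h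
          exact ⟨by simp [hix, hiy, hi], h⟩
        intro i hi j hj h h'
        exact h4 i (key i hi h).1 j (key j hj h').1 (key i hi h).2 (key j hj h').2

noncomputable def pairing {I : Type*} [DecidableEq I] (S : Finset I) : I → I :=
  (exists_pairing S).choose

lemma pairing_spec {I : Type*} [DecidableEq I] (S : Finset I) :
    (∀ i, pairing S (pairing S i) = i) ∧ (∀ i ∈ S, pairing S i ∈ S) ∧
      (∀ i, i ∉ S → pairing S i = i) ∧
      (∀ i ∈ S, ∀ j ∈ S, pairing S i = i → pairing S j = j → i = j) :=
  (exists_pairing S).choose_spec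

/-- halving of the weights at a vertex without defect -/
lemma halving {I : Type*} [Fintype I] [DecidableEq I] (w : I → ℕ) (s : I → Bool) (S : Finset I)
    (hS : ∀ i, i ∈ S ↔ Odd (w i))
    (hs : ∀ i, pairing S i ≠ i → s (pairing S i) ≠ s i) (t : ℕ) (hw : ∑ i, w i ≤ 2 ^ (t + 1)) :
    ∑ i, (w i + (if s i then 1 else 0)) / 2 ≤ 2 ^ t := by
  obtain ⟨h1, h2, h3, h4⟩ := pairing_spec S
  let g : I → ℤ := fun i => if i ∈ S then (if s i then 1 else -1) else 0
  have e1 : ∀ i, 2 * (((w i + (if s i then 1 else 0)) / 2 : ℕ) : ℤ) = w i + g i := by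
    intro i
    by_cases hi : i ∈ S
    · have ho := (hS i).1 hi
      obtain ⟨m, hm⟩ := ho
      cases hsi : s i <;> simp [g, hi, hsi] <;> omega
    · have ho : Even (w i) := by rw [← Nat.not_odd_iff_even, ← hS]; exact hi
      obtain ⟨m, hm⟩ := ho
      cases hsi : s i <;> simp [g, hi] <;> omega
  have e2 : ∑ i, g i ≤ 1 := by
    have hp : ∑ i, g (pairing S i) = ∑ i, g i :=
      Equiv.sum_comp (⟨pairing S, pairing S, h1, h1⟩ : Equiv.Perm I) g
    have h5 : 2 * ∑ i, g i = ∑ i, (g i + g (pairing S i)) := by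
      rw [Finset.sum_add_distrib, hp]; ring
    have h6 : ∑ i, (g i + g (pairing S i)) ≤ ∑ i, (if i ∈ S ∧ pairing S i = i then 2 else 0) := by
      apply Finset.sum_le_sum
      intro i _
      by_cases hi : i ∈ S
      · by_cases hpi : pairing S i = i
        · simp only [g, hi, hpi, if_true, and_self]
          split_ifs <;> norm_num
        · have := hs i hpi
          simp only [g, hi, h2 i hi, hpi, if_true, and_false, if_false]
          revert this
          cases s i <;> cases s (pairing S i) <;> simp
      · have : pairing S i ∉ S := fun h => hi (by rw [← h1 i]; exact h2 _ h)
        simp [g, hi, this]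
    have h7 : ∑ i, (if i ∈ S ∧ pairing S i = i then (2:ℤ) else 0) ≤ 2 := by
      rw [← Finset.sum_filter, Finset.sum_const]
      have : (Finset.univ.filter fun i => i ∈ S ∧ pairing S i = i).card ≤ 1 := by
        apply Finset.card_le_one.2
        intro i hi j hj
        simp only [Finset.mem_filter, Finset.mem_univ, true_and] at hi hj
        exact h4 i hi.1 j hj.1 hi.2 hj.2
      rw [nsmul_eq_mul]
      have : ((Finset.univ.filter fun i => i ∈ S ∧ pairing S i = i).card : ℤ) ≤ 1 := by
        exact_mod_cast this
      linarith
    omega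
  have e3 : 2 * ((∑ i, (w i + (if s i then 1 else 0)) / 2 : ℕ) : ℤ) ≤ (∑ i, w i : ℕ) + 1 := by
    rw [Nat.cast_sum, Finset.mul_sum, Finset.sum_congr rfl (fun i _ => e1 i),
      Finset.sum_add_distrib, Nat.cast_sum]
    linarith
  have e4 : ((∑ i, w i : ℕ) : ℤ) ≤ 2 * 2 ^ t := by
    have : ∑ i, w i ≤ 2 * 2 ^ t := by rw [← pow_succ']; exact hw
    exact_mod_cast this
  have e5 : ((∑ i, (w i + (if s i then 1 else 0)) / 2 : ℕ) : ℤ) ≤ 2 ^ t := by omega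
  exact_mod_cast e5

section round
variable {X I : Type*} [MeasurableSpace X] [StandardBorelSpace X] [Fintype I] [DecidableEq I]
  [MeasurableSpace I] [MeasurableSingletonClass I] [StandardBorelSpace I]

lemma meas_mk (i : I) : Measurable (fun x : X => (x, i)) := measurable_id.prodMk measurable_const

lemma measurable_fib {Z : Type*} [MeasurableSpace Z] (f : X × I → Z)
    (h : ∀ i, Measurable fun x => f (x, i)) : Measurable f :=
  measurable_from_prod_countable_left h

lemma measurable_pair (S : X → Finset I) (hS : ∀ i, MeasurableSet {x | i ∈ S x}) :
    Measurable (fun h : X × I => ((h.1, pairing (S h.1) h.2) : X × I)) := by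
  let _ : MeasurableSpace (Finset I) := ⊤
  have hSm : Measurable S := by
    apply measurable_to_countable'
    intro F
    have : S ⁻¹' {F} = ⋂ i, {x | i ∈ S x ↔ i ∈ F} := by
      ext x; simp [Finset.ext_iff]
    rw [this]
    refine MeasurableSet.iInter fun i => ?_
    by_cases hi : i ∈ F
    · simpa [hi] using hS i
    · have : {x | i ∈ S x ↔ i ∈ F} = {x | i ∈ S x}ᶜ := by ext x; simp [hi]
      rw [this]; exact (hS i).compl
  apply measurable_fib
  intro i
  refine measurable_id.prodMk ?_
  have : Measurable (fun F : Finset I => pairing F i) := measurable_from_top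
  exact this.comp hSm


lemma rounding_step (τ : X × I → X × I) (hτ : Measurable τ) (hττ : ∀ h, τ (τ h) = h)
    (κ : Measure (X × I)) [IsFiniteMeasure κ] (t : ℕ) (w : X × I → ℕ) (hw : Measurable w)
    (hL : ∀ x, ∑ i, w (x, i) ≤ 2 ^ (t + 1)) (hR : ∀ x, ∑ i, w (τ (x, i)) ≤ 2 ^ (t + 1))
    (δ : ENNReal) (hδ : δ ≠ 0) :
    ∃ w' : X × I → ℕ, Measurable w' ∧ (∀ h, w h = 0 → w' h = 0) ∧
      (∀ x, ∑ i, w' (x, i) ≤ 2 ^ t) ∧ (∀ x, ∑ i, w' (τ (x, i)) ≤ 2 ^ t) ∧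
      ∫⁻ h, (w h : ENNReal) ∂κ ≤ 2 * ∫⁻ h, (w' h : ENNReal) ∂κ + δ := by
  classical
  let SL : X → Finset I := fun x => Finset.univ.filter fun i => Odd (w (x, i))
  let SR : X → Finset I := fun x => Finset.univ.filter fun i => Odd (w (τ (x, i)))
  have hodd : MeasurableSet {h | Odd (w h)} := hw (MeasurableSet.of_discrete (s := {m : ℕ | Odd m}))
  have hSL : ∀ i, MeasurableSet {x | i ∈ SL x} := fun i => by
    simpa [SL] using meas_mk i hodd
  have hSR : ∀ i, MeasurableSet {x | i ∈ SR x} := fun i => by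
    simpa [SR] using (hτ.comp (meas_mk i)) hodd
  let a : X × I → X × I := fun h => (h.1, pairing (SL h.1) h.2)
  let a' : X × I → X × I := fun h => (h.1, pairing (SR h.1) h.2)
  let b : X × I → X × I := fun h => τ (a' (τ h))
  have ham : Measurable a := measurable_pair SL hSL
  have ha'm : Measurable a' := measurable_pair SR hSR
  have hbm : Measurable b := hτ.comp (ha'm.comp hτ)
  have haa : ∀ h, a (a h) = h := fun h => by simp [a, (pairing_spec _).1]
  have hbb : ∀ h, b (b h) = h := fun h => by simp [b, a', hττ, (pairing_spec _).1]
  let Lm : I → X × I → X × I := fun i h => (h.1, i)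
  let Rm : I → X × I → X × I := fun i h => τ ((τ h).1, i)
  have hLm : ∀ i, Measurable (Lm i) := fun i => (meas_mk i).comp measurable_fst
  have hRm : ∀ i, Measurable (Rm i) := fun i =>
    hτ.comp ((meas_mk i).comp (measurable_fst.comp hτ))
  let κ' : Measure (X × I) := ∑ i, (κ.map (Lm i)) + ∑ i, (κ.map (Rm i))
  let η : ENNReal := δ / 2 / (2 ^ (t + 1))
  have hη : η ≠ 0 := by
    simp [η, ENNReal.div_eq_zero_iff, hδ]
  obtain ⟨s, hs, hsa, hsb⟩ := prim_inv κ' a b ham hbm haa hbb η hη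
  set Da := {h | a h ≠ h ∧ s (a h) = s h} with hDa
  set Db := {h | b h ≠ h ∧ s (b h) = s h} with hDb
  have hDam : MeasurableSet Da :=
    (measurableSet_eq_fun ham measurable_id).compl.inter (measurableSet_eq_fun (hs.comp ham) hs)
  have hDbm : MeasurableSet Db :=
    (measurableSet_eq_fun hbm measurable_id).compl.inter (measurableSet_eq_fun (hs.comp hbm) hs)
  let D : Set (X × I) := (⋃ i, Lm i ⁻¹' Da) ∪ (⋃ i, Rm i ⁻¹' Db)
  have hDm : MeasurableSet D := (MeasurableSet.iUnion fun i => hLm i hDam).union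
    (MeasurableSet.iUnion fun i => hRm i hDbm)
  have hκD : κ D ≤ δ / (2 ^ (t + 1)) := by
    have h1 : κ (⋃ i, Lm i ⁻¹' Da) ≤ κ' Da := by
      refine (measure_iUnion_fintype_le _ _).trans ?_
      simp only [κ', Measure.add_apply, Measure.finsetSum_apply]
      refine le_trans (le_of_eq ?_) le_self_add
      refine Finset.sum_congr rfl fun i _ => ?_
      rw [Measure.map_apply (hLm i) hDam]
    have h2 : κ (⋃ i, Rm i ⁻¹' Db) ≤ κ' Db := by
      refine (measure_iUnion_fintype_le _ _).trans ?_
      simp only [κ', Measure.add_apply, Measure.finsetSum_apply]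
      refine le_trans (le_of_eq ?_) le_add_self
      refine Finset.sum_congr rfl fun i _ => ?_
      rw [Measure.map_apply (hRm i) hDbm]
    calc κ D ≤ κ (⋃ i, Lm i ⁻¹' Da) + κ (⋃ i, Rm i ⁻¹' Db) := measure_union_le _ _
      _ ≤ η + η := add_le_add (h1.trans hsa) (h2.trans hsb)
      _ = _ := by simp only [η]; rw [← ENNReal.add_div, ENNReal.add_halves]
  let W : (X × I → Bool) → X × I → ℕ := fun σ h =>
    if h ∈ D then 0 else (w h + (if σ h then 1 else 0)) / 2
  have hWm : ∀ σ, Measurable σ → Measurable (W σ) := by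
    intro σ hσ
    refine Measurable.ite hDm measurable_const ?_
    have : Measurable (fun h => w h + (if σ h then 1 else 0)) :=
      hw.add (Measurable.ite (hσ (measurableSet_singleton true)) measurable_const measurable_const)
    exact (measurable_from_top (f := fun m : ℕ => m / 2)).comp this
  have hgood : ∀ σ : X × I → Bool, (∀ h, a h ≠ h → s (a h) ≠ s h → σ (a h) ≠ σ h) →
      (∀ h, b h ≠ h → s (b h) ≠ s h → σ (b h) ≠ σ h) →
      (∀ h, w h = 0 → W σ h = 0) ∧
      (∀ x, ∑ i, W σ (x, i) ≤ 2 ^ t) ∧ (∀ x, ∑ i, W σ (τ (x, i)) ≤ 2 ^ t) := by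
    intro σ h1 h2
    refine ⟨?_, ?_, ?_⟩
    · intro h hw0
      simp only [W, hw0]
      split_ifs <;> rfl
    · intro x
      by_cases hx : ∃ i, (x, i) ∈ Da
      · obtain ⟨i, hi⟩ := hx
        have : ∀ j, W σ (x, j) = 0 := fun j => by
          have : (x, j) ∈ D := Or.inl (Set.mem_iUnion.2 ⟨i, hi⟩)
          simp [W, this]
        simp [this]
      · push Not at hx
        refine le_trans (Finset.sum_le_sum (g := fun i => (w (x, i) +
          (if σ (x, i) then 1 else 0)) / 2) ?_) (halving (fun i => w (x, i)) (fun i => σ (x, i))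
            (SL x) (by simp [SL]) ?_ t (hL x))
        · intro i _
          simp only [W]
          split_ifs <;> simp
        · intro i hi
          have hne : a (x, i) ≠ (x, i) := by
            intro h; exact hi (congrArg Prod.snd h)
          exact h1 (x, i) hne fun h => hx i ⟨hne, h⟩
    · intro x
      by_cases hx : ∃ i, τ (x, i) ∈ Db
      · obtain ⟨i, hi⟩ := hx
        have : ∀ j, W σ (τ (x, j)) = 0 := fun j => by
          have : τ (x, j) ∈ D := Or.inr (Set.mem_iUnion.2 ⟨i, by
            simp only [Rm, Set.mem_preimage, hττ]; exact hi⟩)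
          simp [W, this]
        simp [this]
      · push Not at hx
        refine le_trans (Finset.sum_le_sum (g := fun i => (w (τ (x, i)) +
          (if σ (τ (x, i)) then 1 else 0)) / 2) ?_) (halving (fun i => w (τ (x, i)))
            (fun i => σ (τ (x, i))) (SR x) (by simp [SR]) ?_ t (hR x))
        · intro i _
          simp only [W]
          split_ifs <;> simp
        · intro i hi
          have e : b (τ (x, i)) = τ (x, pairing (SR x) i) := by simp [b, a', hττ]
          have hne : b (τ (x, i)) ≠ τ (x, i) := by
            rw [e]
            intro h
            have := congrArg τ h
            rw [hττ, hττ] at this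
            exact hi (congrArg Prod.snd this)
          have := h2 (τ (x, i)) hne fun h => hx i ⟨hne, h⟩
          rwa [e] at this
  have hwle : ∀ h, w h ≤ 2 ^ (t + 1) := fun h =>
    (Finset.single_le_sum (f := fun i => w (h.1, i)) (fun _ _ => Nat.zero_le _)
      (Finset.mem_univ h.2)).trans (hL h.1)
  let s' : X × I → Bool := fun h => !(s h)
  have hs' : Measurable s' := (measurable_of_finite (fun e : Bool => !e)).comp hs
  have hcast : ∀ σ, Measurable σ → Measurable fun h => (W σ h : ENNReal) := fun σ hσ =>
    (measurable_from_top (f := fun m : ℕ => (m : ENNReal))).comp (hWm σ hσ)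
  have hint : ∫⁻ h, (w h : ENNReal) ∂κ ≤
      ∫⁻ h, (W s h : ENNReal) ∂κ + ∫⁻ h, (W s' h : ENNReal) ∂κ + δ := by
    have hpt : ∀ h, (w h : ENNReal) ≤ ((W s h : ENNReal) + (W s' h : ENNReal)) +
        D.indicator (fun _ => (2 : ENNReal) ^ (t + 1)) h := by
      intro h
      by_cases hD : h ∈ D
      · simp only [W, hD, if_true, Set.indicator_of_mem]
        have := hwle h
        simp only [Nat.cast_zero, zero_add]
        exact_mod_cast this
      · simp only [W, hD, if_false, not_false_eq_true, Set.indicator_of_notMem, add_zero, s']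
        have : w h ≤ (w h + (if s h then 1 else 0)) / 2 + (w h + (if !(s h) then 1 else 0)) / 2 := by
          cases s h <;> simp <;> omega
        exact_mod_cast this
    refine (lintegral_mono hpt).trans ?_
    have hsum : Measurable fun h => (W s h : ENNReal) + (W s' h : ENNReal) :=
      (hcast s hs).add (hcast s' hs')
    rw [lintegral_add_left hsum, lintegral_add_left (hcast s hs)]
    gcongr
    rw [lintegral_indicator_const hDm, mul_comm]
    refine (mul_le_mul_left hκD _).trans ?_
    rw [ENNReal.div_mul_cancel (by simp) (by simp)]
  rcases le_total (∫⁻ h, (W s' h : ENNReal) ∂κ) (∫⁻ h, (W s h : ENNReal) ∂κ) with hle | hle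
  · obtain ⟨g1, g2, g3⟩ := hgood s (fun _ _ h => h) (fun _ _ h => h)
    refine ⟨W s, hWm s hs, g1, g2, g3, hint.trans ?_⟩
    rw [two_mul]; gcongr
  · obtain ⟨g1, g2, g3⟩ := hgood s' (fun _ _ h => by simpa [s'] using h)
      (fun _ _ h => by simpa [s'] using h)
    refine ⟨W s', hWm s' hs', g1, g2, g3, hint.trans ?_⟩
    rw [two_mul]; gcongr

end round

section matching
variable {X I : Type*} [MeasurableSpace X] [StandardBorelSpace X] [Fintype I] [DecidableEq I]
  [MeasurableSpace I] [MeasurableSingletonClass I] [StandardBorelSpace I]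

lemma round_iter (τ : X × I → X × I) (hτ : Measurable τ) (hττ : ∀ h, τ (τ h) = h)
    (κ : Measure (X × I)) [IsFiniteMeasure κ] (t : ℕ) : ∀ (w : X × I → ℕ) (_ : Measurable w)
    (_ : ∀ x, ∑ i, w (x, i) ≤ 2 ^ t) (_ : ∀ x, ∑ i, w (τ (x, i)) ≤ 2 ^ t)
    (δ : ENNReal) (_ : δ ≠ 0),
    ∃ w' : X × I → ℕ, Measurable w' ∧ (∀ h, w h = 0 → w' h = 0) ∧
      (∀ x, ∑ i, w' (x, i) ≤ 1) ∧ (∀ x, ∑ i, w' (τ (x, i)) ≤ 1) ∧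
      ∫⁻ h, (w h : ENNReal) ∂κ ≤ 2 ^ t * ∫⁻ h, (w' h : ENNReal) ∂κ + δ := by
  induction t with
  | zero =>
    intro w hw hL hR δ _
    exact ⟨w, hw, fun _ h => h, by simpa using hL, by simpa using hR, by simp⟩
  | succ t ih =>
    intro w hw hL hR δ hδ
    obtain ⟨w1, a1, a2, a3, a4, a5⟩ := rounding_step τ hτ hττ κ t w hw hL hR (δ / 2) (by simpa using hδ)
    obtain ⟨w2, b1, b2, b3, b4, b5⟩ := ih w1 a1 a3 a4 (δ / 2 / 2) (by
      simp [ENNReal.div_eq_zero_iff, hδ])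
    refine ⟨w2, b1, fun h hh => b2 h (a2 h hh), b3, b4, a5.trans ?_⟩
    calc _ ≤ 2 * (2 ^ t * ∫⁻ h, (w2 h : ENNReal) ∂κ + δ / 2 / 2) + δ / 2 := by gcongr
      _ = 2 ^ (t + 1) * ∫⁻ h, (w2 h : ENNReal) ∂κ + (2 * (δ / 2 / 2) + δ / 2) := by ring
      _ = _ := by
        rw [ENNReal.mul_div_cancel (by simp) (by simp), ENNReal.add_halves]

lemma matching_lemma (τ : X × I → X × I) (hτ : Measurable τ) (hττ : ∀ h, τ (τ h) = h)
    (κ : Measure (X × I)) [IsFiniteMeasure κ] (E : Set (X × I)) (hE : MeasurableSet E)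
    (k : ℕ) (hL : ∀ x, ∑ i, E.indicator (1 : X × I → ℕ) (x, i) ≤ k + 1)
    (hR : ∀ x, ∑ i, E.indicator (1 : X × I → ℕ) (τ (x, i)) ≤ k + 1)
    (δ : ENNReal) (hδ : δ ≠ 0) :
    ∃ M : Set (X × I), MeasurableSet M ∧ M ⊆ E ∧
      (∀ x i j, (x, i) ∈ M → (x, j) ∈ M → i = j) ∧
      (∀ x i j, τ (x, i) ∈ M → τ (x, j) ∈ M → i = j) ∧
      κ E ≤ (k + 1 : ℕ) * κ M + δ := by
  obtain ⟨t, ht⟩ : ∃ t : ℕ, ((k + 1 : ℕ) * (1 + κ E)) / δ ≤ (2 : ENNReal) ^ t := by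
    have hfin : ((k + 1 : ℕ) * (1 + κ E)) / δ ≠ ⊤ := by
      refine ENNReal.div_ne_top (ENNReal.mul_ne_top (by simp) ?_) hδ
      simp
    obtain ⟨m, hm⟩ := ENNReal.exists_nat_gt hfin
    refine ⟨m, hm.le.trans ?_⟩
    have : m ≤ 2 ^ m := Nat.lt_two_pow_self.le
    exact_mod_cast this
  let α := 2 ^ t / (k + 1)
  have hα : α * (k + 1) ≤ 2 ^ t := Nat.div_mul_le_self _ _
  have hα2 : 2 ^ t ≤ (k + 1) * α + (k + 1) := by
    have := Nat.div_add_mod (2 ^ t) (k + 1)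
    have h2 : 2 ^ t % (k + 1) < k + 1 := Nat.mod_lt (2 ^ t) (Nat.succ_pos k)
    show 2 ^ t ≤ (k + 1) * (2 ^ t / (k + 1)) + (k + 1)
    generalize 2 ^ t % (k + 1) = r at *
    generalize (k + 1) * (2 ^ t / (k + 1)) = q at *
    omega
  let w : X × I → ℕ := fun h => α * E.indicator (1 : X × I → ℕ) h
  have hw : Measurable w := (measurable_one.indicator hE).const_mul α
  obtain ⟨w', b1, b2, b3, b4, b5⟩ := round_iter τ hτ hττ κ t w hw
    (fun x => by
      simp only [w]; rw [← Finset.mul_sum]; exact (Nat.mul_le_mul_left _ (hL x)).trans hα)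
    (fun x => by
      simp only [w]; rw [← Finset.mul_sum]; exact (Nat.mul_le_mul_left _ (hR x)).trans hα) 1 one_ne_zero
  have key : ∀ u : I → ℕ, ∑ i, u i ≤ 1 → ∀ i j, u i ≠ 0 → u j ≠ 0 → i = j := by
    intro u hu i j hi hj
    by_contra hij
    have : u i + u j ≤ ∑ i, u i := by
      rw [← Finset.sum_pair hij]
      exact Finset.sum_le_sum_of_subset (Finset.subset_univ _)
    omega
  have hMm : MeasurableSet {h | w' h ≠ 0} := (b1 (measurableSet_singleton 0)).compl
  refine ⟨{h | w' h ≠ 0}, hMm, ?_, fun x i j hi hj => key (fun i => w' (x, i)) (b3 x) i j hi hj,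
    fun x i j hi hj => key (fun i => w' (τ (x, i))) (b4 x) i j hi hj, ?_⟩
  · intro h hh
    by_contra hE'
    exact hh (b2 h (by simp [w, hE']))
  · have h1 : ∫⁻ h, (w h : ENNReal) ∂κ = α * κ E := by
      rw [← lintegral_indicator_const hE]
      refine lintegral_congr fun h => ?_
      by_cases hh : h ∈ E <;> simp [w, hh]
    have h2 : ∫⁻ h, (w' h : ENNReal) ∂κ ≤ κ {h | w' h ≠ 0} := by
      rw [← lintegral_indicator_one hMm]
      refine lintegral_mono fun h => ?_
      by_cases hh : w' h = 0
      · simp [hh]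
      · have : w' h ≤ 1 := (Finset.single_le_sum (f := fun i => w' (h.1, i))
          (fun _ _ => Nat.zero_le _) (Finset.mem_univ h.2)).trans (b3 h.1)
        have h' : h ∈ {h | w' h ≠ 0} := hh
        rw [Set.indicator_of_mem h', Pi.one_apply]
        exact ((Nat.cast_le (α := ENNReal)).2 this).trans (by simp)
    rw [h1] at b5
    have h3 : (2 : ENNReal) ^ t * κ E ≤ 2 ^ t * ((k + 1 : ℕ) * κ {h | w' h ≠ 0}) + 2 ^ t * δ := by
      have e1 : (2 : ENNReal) ^ t ≤ (k + 1 : ℕ) * α + (k + 1 : ℕ) := by exact_mod_cast hα2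
      calc (2 : ENNReal) ^ t * κ E ≤ ((k + 1 : ℕ) * α + (k + 1 : ℕ)) * κ E := by gcongr
        _ = (k + 1 : ℕ) * (α * κ E) + (k + 1 : ℕ) * κ E := by ring
        _ ≤ (k + 1 : ℕ) * (2 ^ t * κ {h | w' h ≠ 0} + 1) + (k + 1 : ℕ) * κ E := by
          gcongr; exact b5.trans (by gcongr)
        _ = 2 ^ t * ((k + 1 : ℕ) * κ {h | w' h ≠ 0}) + (k + 1 : ℕ) * (1 + κ E) := by ring
        _ ≤ _ := by
          refine add_le_add le_rfl ?_
          rcases eq_or_ne δ ⊤ with h | h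
          · subst h; rw [ENNReal.mul_top (by simp)]; exact le_top
          · exact (ENNReal.div_le_iff hδ h).1 ht
    rw [← mul_add] at h3
    exact (ENNReal.mul_le_mul_iff_right (by simp) (by simp)).1 h3

lemma sum_meas (ν : Measure X) (E : Set (X × I)) (hE : MeasurableSet E) (g : X × I → X × I)
    (hg : Measurable g) :
    ∑ i, ν.map (fun x => g (x, i)) E
      = ∫⁻ x, ((∑ i, E.indicator (1 : X × I → ℕ) (g (x, i)) : ℕ) : ENNReal) ∂ν := by
  have hm : ∀ i, Measurable fun x => g (x, i) := fun i => hg.comp (meas_mk i)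
  simp only [Nat.cast_sum]
  rw [lintegral_finsetSum]
  · refine Finset.sum_congr rfl fun i _ => ?_
    rw [Measure.map_apply (hm i) hE, ← lintegral_indicator_one (hm i hE)]
    refine lintegral_congr fun x => ?_
    by_cases h : g (x, i) ∈ E <;> simp [h]
  · intro i _
    exact (measurable_from_top (f := fun m : ℕ => (m : ENNReal))).comp
      ((measurable_one.indicator hE).comp (hm i))

lemma matching_cover (τ : X × I → X × I) (hτ : Measurable τ) (hττ : ∀ h, τ (τ h) = h)
    (ν : Measure X) [IsFiniteMeasure ν] (E : Set (X × I)) (hE : MeasurableSet E)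
    (k : ℕ) (hL : ∀ x, ∑ i, E.indicator (1 : X × I → ℕ) (x, i) ≤ k + 1)
    (hR : ∀ x, ∑ i, E.indicator (1 : X × I → ℕ) (τ (x, i)) ≤ k + 1)
    (δ : ENNReal) (hδ : δ ≠ 0) :
    ∃ M : Set (X × I), MeasurableSet M ∧ M ⊆ E ∧
      (∀ x i j, (x, i) ∈ M → (x, j) ∈ M → i = j) ∧
      (∀ x i j, τ (x, i) ∈ M → τ (x, j) ∈ M → i = j) ∧
      ∃ UL UR : Set X, MeasurableSet UL ∧ MeasurableSet UR ∧ ν UL + ν UR ≤ δ ∧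
        (∀ x, x ∉ UL → (∀ i, (x, i) ∉ M) → ∑ i, E.indicator (1 : X × I → ℕ) (x, i) ≤ k) ∧
        (∀ x, x ∉ UR → (∀ i, τ (x, i) ∉ M) →
          ∑ i, E.indicator (1 : X × I → ℕ) (τ (x, i)) ≤ k) := by
  let DL : Set X := {x | ∑ i, E.indicator (1 : X × I → ℕ) (x, i) = k + 1}
  let DR : Set X := {x | ∑ i, E.indicator (1 : X × I → ℕ) (τ (x, i)) = k + 1}
  have hdeg : ∀ g : X × I → X × I, Measurable g →
      Measurable fun x => ∑ i, E.indicator (1 : X × I → ℕ) (g (x, i)) := by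
    intro g hg
    refine Finset.measurable_sum _ fun i _ => ?_
    exact (measurable_one.indicator hE).comp (hg.comp (meas_mk i))
  have hDL : MeasurableSet DL := hdeg id measurable_id (measurableSet_singleton (k + 1))
  have hDR : MeasurableSet DR := hdeg τ hτ (measurableSet_singleton (k + 1))
  let κ : Measure (X × I) := ∑ i, (ν.restrict DL).map (fun x => id (x, i)) +
    ∑ i, (ν.restrict DR).map (fun x => τ (x, i))
  obtain ⟨M, m1, m2, m3, m4, m5⟩ := matching_lemma τ hτ hττ κ E hE k hL hR ((k + 1 : ℕ) * δ)
    (by simp [hδ])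
  let CL : Set X := ⋃ i, (fun x => id (x, i)) ⁻¹' M
  let CR : Set X := ⋃ i, (fun x => τ (x, i)) ⁻¹' M
  have hCL : MeasurableSet CL := MeasurableSet.iUnion fun i => (measurable_id.comp (meas_mk i)) m1
  have hCR : MeasurableSet CR := MeasurableSet.iUnion fun i => (hτ.comp (meas_mk i)) m1
  have hsE : ∀ g : X × I → X × I, Measurable g → ∀ D : Set X, MeasurableSet D →
      (∀ x ∈ D, ∑ i, E.indicator (1 : X × I → ℕ) (g (x, i)) = k + 1) →
      ∑ i, (ν.restrict D).map (fun x => g (x, i)) E = (k + 1 : ℕ) * ν D := by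
    intro g hg D hD h
    rw [sum_meas _ E hE g hg, setLIntegral_congr_fun (g := fun _ => ((k + 1 : ℕ) : ENNReal)) hD
      (fun x hx => by simp only [h x hx])]
    simp
  have hsM : ∀ g : X × I → X × I, Measurable g → ∀ D : Set X, MeasurableSet D →
      (∀ x i j, g (x, i) ∈ M → g (x, j) ∈ M → i = j) →
      ∑ i, (ν.restrict D).map (fun x => g (x, i)) M ≤ ν (D ∩ ⋃ i, (fun x => g (x, i)) ⁻¹' M) := by
    intro g hg D hD h
    have hC : MeasurableSet (⋃ i, (fun x => g (x, i)) ⁻¹' M) :=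
      MeasurableSet.iUnion fun i => (hg.comp (meas_mk i)) m1
    rw [sum_meas _ M m1 g hg, Set.inter_comm, ← Measure.restrict_apply hC,
      ← lintegral_indicator_one hC]
    refine lintegral_mono fun x => ?_
    by_cases hx : ∃ i, g (x, i) ∈ M
    · obtain ⟨i, hi⟩ := hx
      have h1 : x ∈ ⋃ i, (fun x => g (x, i)) ⁻¹' M := Set.mem_iUnion.2 ⟨i, hi⟩
      have h2 : ∑ j, M.indicator (1 : X × I → ℕ) (g (x, j)) = 1 := by
        rw [Finset.sum_eq_single i]
        · simp [hi]
        · intro j _ hj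
          have : g (x, j) ∉ M := fun h' => hj (h x j i h' hi)
          simp [this]
        · simp
      rw [Set.indicator_of_mem h1, h2]; simp
    · push Not at hx
      simp [hx]
  have hE' : κ E = (k + 1 : ℕ) * (ν DL + ν DR) := by
    simp only [κ, Measure.add_apply, Measure.finsetSum_apply]
    rw [hsE id measurable_id DL hDL (fun x hx => hx), hsE τ hτ DR hDR (fun x hx => hx), mul_add]
  have hM' : κ M ≤ ν (DL ∩ CL) + ν (DR ∩ CR) := by
    simp only [κ, Measure.add_apply, Measure.finsetSum_apply]
    exact add_le_add (hsM id measurable_id DL hDL m3) (hsM τ hτ DR hDR m4)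
  refine ⟨M, m1, m2, m3, m4, DL \ CL, DR \ CR, hDL.diff hCL, hDR.diff hCR, ?_, ?_, ?_⟩
  · rw [hE'] at m5
    have h1 := m5.trans (add_le_add_left (mul_le_mul_right hM' ((k + 1 : ℕ) : ENNReal)) _)
    rw [← mul_add, ENNReal.mul_le_mul_iff_right (by simp) (by simp)] at h1
    rw [← measure_inter_add_sdiff DL hCL, ← measure_inter_add_sdiff DR hCR] at h1
    have h2 : (ν (DL ∩ CL) + ν (DR ∩ CR)) + (ν (DL \ CL) + ν (DR \ CR)) ≤
      (ν (DL ∩ CL) + ν (DR ∩ CR)) + δ := by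
      refine le_trans (le_of_eq ?_) h1; ring
    exact (ENNReal.add_le_add_iff_left (by simp)).1 h2
  · intro x hx hM
    have : x ∉ DL := fun h => hx ⟨h, by simpa [CL] using hM⟩
    have h2 := hL x
    have h3 : ∑ i, E.indicator (1 : X × I → ℕ) (x, i) ≠ k + 1 := this
    omega
  · intro x hx hM
    have : x ∉ DR := fun h => hx ⟨h, by simpa [CR] using hM⟩
    have h2 := hR x
    have h3 : ∑ i, E.indicator (1 : X × I → ℕ) (τ (x, i)) ≠ k + 1 := this
    omega

lemma coloring_lemma (τ : X × I → X × I) (hτ : Measurable τ) (hττ : ∀ h, τ (τ h) = h)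
    (κ : Measure (X × I)) [IsFiniteMeasure κ] (k : ℕ) : ∀ (E : Set (X × I)) (_ : MeasurableSet E)
    (_ : ∀ x, ∑ i, E.indicator (1 : X × I → ℕ) (x, i) ≤ k)
    (_ : ∀ x, ∑ i, E.indicator (1 : X × I → ℕ) (τ (x, i)) ≤ k)
    (δ : ENNReal) (_ : δ ≠ 0), ∃ c : X × I → ℕ, Measurable c ∧ (∀ h, c h < k → h ∈ E) ∧
      (∀ x i j, c (x, i) = c (x, j) → c (x, i) < k → i = j) ∧
      (∀ x i j, c (τ (x, i)) = c (τ (x, j)) → c (τ (x, i)) < k → i = j) ∧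
      κ {h | h ∈ E ∧ k ≤ c h} ≤ δ := by
  induction k with
  | zero =>
    intro E hE hL hR δ hδ
    have : E = ∅ := by
      ext h
      have := hL h.1
      simp only [nonpos_iff_eq_zero, Finset.sum_eq_zero_iff, Finset.mem_univ, true_imp_iff] at this
      have := this h.2
      simpa using this
    exact ⟨fun _ => 0, measurable_const, by simp, by simp, by simp, by simp [this]⟩
  | succ k ih =>
    intro E hE hL hR δ hδ
    classical
    let ν : Measure X := κ.map Prod.fst + κ.map (fun h => (τ h).1)
    have hτ1 : Measurable fun h => (τ h).1 := measurable_fst.comp hτ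
    obtain ⟨M, m1, m2, m3, m4, UL, UR, u1, u2, u3, u4, u5⟩ :=
      matching_cover τ hτ hττ ν E hE k hL hR (δ / 2) (by simpa using hδ)
    let E' : Set (X × I) := (E \ M) ∩ ((Prod.fst ⁻¹' UL)ᶜ ∩ ((fun h => (τ h).1) ⁻¹' UR)ᶜ)
    have hE' : MeasurableSet E' :=
      (hE.diff m1).inter ((measurable_fst u1).compl.inter (hτ1 u2).compl)
    have hsub : ∀ h, E'.indicator (1 : X × I → ℕ) h ≤ E.indicator (1 : X × I → ℕ) h := by
      intro h
      by_cases hh : h ∈ E'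
      · simp [hh, hh.1.1]
      · simp [hh]
    have hcase : ∀ g : I → X × I, (∀ i, g i ∉ M) ∨ (∃ i, g i ∈ M) →
      ((∀ i, g i ∉ M) → ∑ i, E.indicator (1 : X × I → ℕ) (g i) ≤ k) →
      ∑ i, E.indicator (1 : X × I → ℕ) (g i) ≤ k + 1 →
      ∑ i, E'.indicator (1 : X × I → ℕ) (g i) ≤ k := by
      intro g h1 h2 h3
      rcases h1 with h1 | ⟨i, hi⟩
      · exact (Finset.sum_le_sum fun i _ => hsub _).trans (h2 h1)
      · have : ∑ i, E'.indicator (1 : X × I → ℕ) (g i) < ∑ i, E.indicator (1 : X × I → ℕ) (g i) := by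
          refine Finset.sum_lt_sum (fun i _ => hsub _) ⟨i, Finset.mem_univ _, ?_⟩
          have : g i ∉ E' := fun h => h.1.2 hi
          simp [this, m2 hi]
        omega
    obtain ⟨c', c1, c2, c3, c4, c5⟩ := ih E' hE' (by
        intro x
        by_cases hx : x ∈ UL
        · have : ∀ i, (x, i) ∉ E' := fun i h => h.2.1 hx
          simp [this]
        · refine hcase (fun i => (x, i)) ?_ (u4 x hx) (hL x)
          by_cases h : ∃ i, (x, i) ∈ M
          · exact Or.inr h
          · exact Or.inl (by push Not at h; exact h)) (by
        intro x
        by_cases hx : x ∈ UR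
        · have : ∀ i, τ (x, i) ∉ E' := fun i h => h.2.2 (by
            simp only [Set.mem_preimage, hττ]; exact hx)
          simp [this]
        · refine hcase (fun i => τ (x, i)) ?_ (u5 x hx) (hR x)
          by_cases h : ∃ i, τ (x, i) ∈ M
          · exact Or.inr h
          · exact Or.inl (by push Not at h; exact h)) (δ / 2) (by simpa using hδ)
    let c : X × I → ℕ := fun h => if h ∈ M then k else if c' h < k then c' h else k + 1
    have hcm : Measurable c := Measurable.ite m1 measurable_const
      (Measurable.ite (c1 (MeasurableSet.of_discrete (s := {m : ℕ | m < k}))) c1 measurable_const)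
    have hinj : ∀ g : I → X × I, (∀ i j, g i ∈ M → g j ∈ M → i = j) →
        (∀ i j, c' (g i) = c' (g j) → c' (g i) < k → i = j) →
        ∀ i j, c (g i) = c (g j) → c (g i) < k + 1 → i = j := by
      intro g h1 h2 i j h3 h4
      simp only [c] at h3 h4
      by_cases hi : g i ∈ M
      · by_cases hj : g j ∈ M
        · exact h1 i j hi hj
        · simp only [hi, hj, if_true, if_false] at h3
          split_ifs at h3 <;> omega
      · by_cases hj : g j ∈ M
        · simp only [hi, hj, if_true, if_false] at h3
          split_ifs at h3 <;> omega
        · simp only [hi, hj, if_false] at h3 h4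
          by_cases hi' : c' (g i) < k
          · simp only [hi', if_true] at h3
            split_ifs at h3
            · exact h2 i j h3 hi'
            · omega
          · simp [hi'] at h4
    refine ⟨c, hcm, ?_, fun x => hinj (fun i => (x, i)) (m3 x) (c3 x),
      fun x => hinj (fun i => τ (x, i)) (m4 x) (c4 x), ?_⟩
    · intro h hh
      simp only [c] at hh
      split_ifs at hh with h1 h2
      · exact m2 h1
      · exact (c2 h h2).1.1
      · omega
    · have hss : {h | h ∈ E ∧ k + 1 ≤ c h} ⊆ {h | h ∈ E' ∧ k ≤ c' h} ∪
          (Prod.fst ⁻¹' UL ∪ (fun h => (τ h).1) ⁻¹' UR) := by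
        rintro h ⟨h1, h2⟩
        simp only [c] at h2
        split_ifs at h2 with h3 h4
        · omega
        · omega
        · by_cases h5 : h.1 ∈ UL
          · exact Or.inr (Or.inl h5)
          by_cases h6 : (τ h).1 ∈ UR
          · exact Or.inr (Or.inr h6)
          exact Or.inl ⟨⟨⟨h1, h3⟩, h5, h6⟩, not_lt.1 h4⟩
      calc _ ≤ _ := measure_mono hss
        _ ≤ κ {h | h ∈ E' ∧ k ≤ c' h} + (κ (Prod.fst ⁻¹' UL) + κ ((fun h => (τ h).1) ⁻¹' UR)) :=
          (measure_union_le _ _).trans (add_le_add le_rfl (measure_union_le _ _))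
        _ ≤ δ / 2 + (ν UL + ν UR) := by
          gcongr
          · simp only [ν, Measure.add_apply]
            rw [Measure.map_apply measurable_fst u1]; exact le_self_add
          · simp only [ν, Measure.add_apply]
            rw [Measure.map_apply hτ1 u2]; exact le_add_self
        _ ≤ δ / 2 + δ / 2 := by gcongr
        _ = δ := ENNReal.add_halves δ

end matching

def lflip {n : ℕ} (l : Fin n × Bool) : Fin n × Bool := (l.1, !l.2)

lemma lflip_lflip {n : ℕ} (l : Fin n × Bool) : lflip (lflip l) = l := by
  simp [lflip]

lemma decoration {X : Type*} [MeasurableSpace X] [StandardBorelSpace X] {n : ℕ}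
    (τ : X × (Fin n × Bool) → X × (Fin n × Bool)) (hτ : Measurable τ) (hττ : ∀ h, τ (τ h) = h)
    (hfp : ∀ h, τ h ≠ h) (κ : Measure (X × (Fin n × Bool))) [IsFiniteMeasure κ]
    (δ : ENNReal) (hδ : δ ≠ 0) :
    ∃ lam : X × (Fin n × Bool) → Option (Fin n × Bool),
      (∀ l, MeasurableSet {h | lam h = some l}) ∧
      (∀ h l, lam h = some l → lam (τ h) = some (lflip l)) ∧
      (∀ x i j l, lam (x, i) = some l → lam (x, j) = some l → i = j) ∧
      κ {h | lam h = none} ≤ δ := by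
  classical
  let π : X × (Fin n × Bool) → X × (Fin n × Bool) := fun h => (h.1, lflip h.2)
  have hπ : Measurable π := measurable_fib _ fun i => meas_mk (lflip i)
  have hππ : ∀ h, π (π h) = h := fun h => by simp [π, lflip_lflip]
  have hπfp : ∀ h, π h ≠ h := by
    intro h hh
    have := congrArg (fun h => h.2.2) hh
    simp [π, lflip] at this
  let Lm : Fin n × Bool → X × (Fin n × Bool) → X × (Fin n × Bool) := fun i h => (h.1, i)
  let Rm : Fin n × Bool → X × (Fin n × Bool) → X × (Fin n × Bool) := fun i h => ((τ h).1, i)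
  have hLm : ∀ i, Measurable (Lm i) := fun i => (meas_mk i).comp measurable_fst
  have hRm : ∀ i, Measurable (Rm i) := fun i => (meas_mk i).comp (measurable_fst.comp hτ)
  let κ1 : Measure (X × (Fin n × Bool)) := ∑ i, κ.map (Lm i) + ∑ i, κ.map (Rm i)
  obtain ⟨o, ho, o1, o2⟩ := prim_inv (κ + κ1) τ π hτ hπ hττ hππ (δ / 2 / 2)
    (by simp [ENNReal.div_eq_zero_iff, hδ])
  simp only [hfp, hπfp, ne_eq, not_false_eq_true, true_and] at o1 o2
  let Dt : Set (X × (Fin n × Bool)) := {h | o (τ h) = o h}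
  let Dp : Set (X × (Fin n × Bool)) := {h | o (π h) = o h}
  have hDt : MeasurableSet Dt := measurableSet_eq_fun (ho.comp hτ) ho
  have hDp : MeasurableSet Dp := measurableSet_eq_fun (ho.comp hπ) ho
  let d : Set X := ⋃ i, (fun x => (x, i)) ⁻¹' Dp
  have hd : MeasurableSet d := MeasurableSet.iUnion fun i => meas_mk i hDp
  let E : Set (X × (Fin n × Bool)) := ({h | o h = true} ∩ {h | o (τ h) = false}) ∩
    ({h | h.1 ∉ d} ∩ {h | (τ h).1 ∉ d})
  have hE : MeasurableSet E := by
    refine MeasurableSet.inter (MeasurableSet.inter ?_ ?_) (MeasurableSet.inter ?_ ?_)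
    · exact ho (measurableSet_singleton true)
    · exact (ho.comp hτ) (measurableSet_singleton false)
    · exact measurable_fst hd.compl
    · exact (measurable_fst.comp hτ) hd.compl
  have hdp : ∀ x, x ∉ d → ∀ i, o (x, lflip i) ≠ o (x, i) := by
    intro x hx i h
    exact hx (Set.mem_iUnion.2 ⟨i, h⟩)
  have hL : ∀ x, ∑ i, E.indicator (1 : X × (Fin n × Bool) → ℕ) (x, i) ≤ n := by
    intro x
    rw [Fintype.sum_prod_type]
    refine le_trans (Finset.sum_le_card_nsmul _ _ 1 ?_) (by simp)
    intro j _
    rw [Fintype.sum_bool]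
    by_cases h1 : (x, (j, true)) ∈ E
    · by_cases h2 : (x, (j, false)) ∈ E
      · exfalso
        exact hdp x h1.2.1 (j, true) (by
          have e1 : o (x, (j, true)) = true := h1.1.1
          have e2 : o (x, (j, false)) = true := h2.1.1
          simp [lflip, e1, e2])
      · simp [h1, h2]
    · by_cases h2 : (x, (j, false)) ∈ E
      · simp [h1, h2]
      · simp [h1, h2]
  have hR : ∀ x, ∑ i, E.indicator (1 : X × (Fin n × Bool) → ℕ) (τ (x, i)) ≤ n := by
    intro x
    rw [Fintype.sum_prod_type]
    refine le_trans (Finset.sum_le_card_nsmul _ _ 1 ?_) (by simp)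
    intro j _
    rw [Fintype.sum_bool]
    by_cases h1 : τ (x, (j, true)) ∈ E
    · by_cases h2 : τ (x, (j, false)) ∈ E
      · exfalso
        have e0 : x ∉ d := by
          have : (τ (τ (x, (j, true)))).1 ∉ d := h1.2.2
          rwa [hττ] at this
        exact hdp x e0 (j, true) (by
          have e1 : o (τ (τ (x, (j, true)))) = false := h1.1.2
          have e2 : o (τ (τ (x, (j, false)))) = false := h2.1.2
          rw [hττ] at e1 e2
          simp [lflip, e1, e2])
      · simp [h1, h2]
    · by_cases h2 : τ (x, (j, false)) ∈ E
      · simp [h1, h2]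
      · simp [h1, h2]
  obtain ⟨c, c1, c2, c3, c4, c5⟩ := coloring_lemma τ hτ hττ (κ + κ.map τ) n E hE hL hR (δ / 2)
    (by simpa using hδ)
  have hex : ∀ h, c h < n → ¬ c (τ h) < n := by
    intro h h1 h2
    have e1 : o h = true := (c2 h h1).1.1
    have e2 : o (τ h) = false := (c2 h h1).1.2
    have e3 : o (τ h) = true := (c2 _ h2).1.1
    rw [e2] at e3; exact absurd e3 (by simp)
  let lam : X × (Fin n × Bool) → Option (Fin n × Bool) := fun h =>
    if h1 : c h < n then some (⟨c h, h1⟩, true) else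
      if h2 : c (τ h) < n then some (⟨c (τ h), h2⟩, false) else none
  have lt : ∀ h j, lam h = some (j, true) ↔ c h = j := by
    intro h j
    simp only [lam]
    constructor
    · intro hh
      split_ifs at hh with h1 h2
      · simp only [Option.some.injEq, Prod.mk.injEq, and_true] at hh
        rw [← hh]
      · simp at hh
    · intro hh
      have : c h < n := by rw [hh]; exact j.2
      simp [this, hh]
  have lf : ∀ h j, lam h = some (j, false) ↔ c (τ h) = j := by
    intro h j
    simp only [lam]
    constructor
    · intro hh
      split_ifs at hh with h1 h2
      · simp at hh
      · simp only [Option.some.injEq, Prod.mk.injEq, and_true] at hh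
        rw [← hh]
    · intro hh
      have h0 : c (τ h) < n := by rw [hh]; exact j.2
      have : ¬ c h < n := fun h' => hex h h' h0
      simp [this, hh]
  refine ⟨lam, ?_, ?_, ?_, ?_⟩
  · rintro ⟨j, b⟩
    cases b
    · simp only [lf]
      exact (c1.comp hτ) (measurableSet_singleton (j : ℕ))
    · simp only [lt]
      exact c1 (measurableSet_singleton (j : ℕ))
  · rintro h ⟨j, b⟩ hh
    cases b
    · rw [lf] at hh
      exact (lt _ _).2 hh
    · rw [lt] at hh
      exact (lf _ _).2 (by rw [hττ]; exact hh)
  · rintro x i i' ⟨j, b⟩ h1 h2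
    cases b
    · rw [lf] at h1 h2
      exact c4 x i i' (h1.trans h2.symm) (by rw [h1]; exact j.2)
    · rw [lt] at h1 h2
      exact c3 x i i' (h1.trans h2.symm) (by rw [h1]; exact j.2)
  · let B : Set (X × (Fin n × Bool)) := {h | h ∈ E ∧ n ≤ c h}
    have hB : MeasurableSet B :=
      hE.inter (c1 (MeasurableSet.of_discrete (s := {m : ℕ | n ≤ m})))
    have hss : {h | lam h = none} ⊆ (B ∪ τ ⁻¹' B) ∪
        (Dt ∪ ((⋃ i, Lm i ⁻¹' Dp) ∪ (⋃ i, Rm i ⁻¹' Dp))) := by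
      intro h hh
      have hh' : lam h = none := hh
      simp only [lam] at hh'
      split_ifs at hh' with h1 h2
      by_cases g1 : h ∈ Dt
      · exact Or.inr (Or.inl g1)
      by_cases g2 : h.1 ∈ d
      · exact Or.inr (Or.inr (Or.inl (by simpa [d, Lm] using g2)))
      by_cases g3 : (τ h).1 ∈ d
      · exact Or.inr (Or.inr (Or.inr (by simpa [d, Rm] using g3)))
      left
      have g1' : o (τ h) ≠ o h := g1
      cases ho1 : o h
      · right
        refine ⟨⟨⟨?_, ?_⟩, g3, ?_⟩, not_lt.1 h2⟩
        · show o (τ h) = true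
          rw [ho1] at g1'; simpa using g1'
        · show o (τ (τ h)) = false
          rw [hττ]; exact ho1
        · show (τ (τ h)).1 ∉ d
          rw [hττ]; exact g2
      · left
        refine ⟨⟨⟨ho1, ?_⟩, g2, g3⟩, not_lt.1 h1⟩
        show o (τ h) = false
        rw [ho1] at g1'; simpa using g1'
    calc _ ≤ _ := measure_mono hss
      _ ≤ (κ B + κ (τ ⁻¹' B)) + (κ Dt + (κ (⋃ i, Lm i ⁻¹' Dp) + κ (⋃ i, Rm i ⁻¹' Dp))) :=
        (measure_union_le _ _).trans (add_le_add (measure_union_le _ _)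
          ((measure_union_le _ _).trans (add_le_add le_rfl (measure_union_le _ _))))
      _ ≤ δ / 2 + (δ / 2 / 2 + δ / 2 / 2) := by
        refine add_le_add ?_ (add_le_add ?_ ?_)
        · rw [← Measure.map_apply hτ hB]; exact c5
        · exact (by rw [Measure.add_apply]; exact le_self_add : κ Dt ≤ (κ + κ1) Dt).trans o1
        · refine le_trans ?_ o2
          rw [Measure.add_apply]
          refine le_trans ?_ le_add_self
          simp only [κ1, Measure.add_apply, Measure.finsetSum_apply]
          refine add_le_add ((measure_iUnion_fintype_le _ _).trans (le_of_eq ?_))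
            ((measure_iUnion_fintype_le _ _).trans (le_of_eq ?_))
          · exact Finset.sum_congr rfl fun i _ => (Measure.map_apply (hLm i) hDp).symm
          · exact Finset.sum_congr rfl fun i _ => (Measure.map_apply (hRm i) hDp).symm
      _ = δ := by rw [ENNReal.add_halves, ENNReal.add_halves]

lemma nbr_enum {X : Type*} [MeasurableSpace X] [StandardBorelSpace X] (n : ℕ) (hn : 1 ≤ n)
    (Q : SimpleGraph X) (hQ : MeasurableSet {p : X × X | Q.Adj p.1 p.2})
    (hreg : ∀ x : X, Nat.card {y : X // Q.Adj x y} = 2 * n) :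
    ∃ f : (Fin n × Bool) → X → X, (∀ i, Measurable (f i)) ∧ (∀ x i, Q.Adj x (f i x)) ∧
      (∀ x i j, f i x = f j x → i = j) ∧ (∀ x y, Q.Adj x y → ∃ i, f i x = y) := by
  classical
  let e : X → ℝ := embeddingReal X
  have he : MeasurableEmbedding e := measurableEmbedding_embeddingReal X
  have hfin : ∀ x, {y | Q.Adj x y}.Finite := by
    intro x
    have : Finite {y : X // Q.Adj x y} := Nat.finite_of_card_ne_zero (by rw [hreg]; omega)
    exact Set.finite_coe_iff.1 this
  let S : X → Finset X := fun x => (hfin x).toFinset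
  have hS : ∀ x y, y ∈ S x ↔ Q.Adj x y := by intro x y; simp [S]
  let T : X → Finset ℝ := fun x => (S x).map ⟨e, he.injective⟩
  have hT : ∀ x, (T x).card = 2 * n := by
    intro x
    rw [Finset.card_map, ← hreg x, Nat.card_congr (Equiv.subtypeEquivRight (hS x)).symm]
    simp
  let W : Set (X × (Fin (2 * n) → X)) := {p | (∀ i, Q.Adj p.1 (p.2 i)) ∧
    ∀ i j, i < j → e (p.2 i) < e (p.2 j)}
  have hW : MeasurableSet W := by
    have h1 : W = (⋂ i, {p | Q.Adj p.1 (p.2 i)}) ∩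
        ⋂ i, ⋂ j, ⋂ (_ : i < j), {p | e (p.2 i) < e (p.2 j)} := by
      ext p; simp [W]
    rw [h1]
    have hp : ∀ i, Measurable fun p : X × (Fin (2 * n) → X) => p.2 i := fun i =>
      (measurable_pi_apply i).comp measurable_snd
    refine MeasurableSet.inter (MeasurableSet.iInter fun i => ?_)
      (MeasurableSet.iInter fun i => MeasurableSet.iInter fun j => MeasurableSet.iInter fun _ => ?_)
    · exact (measurable_fst.prodMk (hp i)) hQ
    · exact measurableSet_lt (he.measurable.comp (hp i)) (he.measurable.comp (hp j))
  have huniq : ∀ x y, (x, y) ∈ W → (fun i => e (y i)) = (T x).orderEmbOfFin (hT x) := by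
    rintro x y ⟨h1, h2⟩
    refine Finset.orderEmbOfFin_unique (hT x) ?_ (fun i j h => h2 i j h)
    intro i
    exact Finset.mem_map.2 ⟨y i, (hS _ _).2 (h1 i), rfl⟩
  have hexist : ∀ x, ∃ y, (x, y) ∈ W := by
    intro x
    have : ∀ i, ∃ z, Q.Adj x z ∧ e z = (T x).orderEmbOfFin (hT x) i := by
      intro i
      obtain ⟨z, hz, hz'⟩ := Finset.mem_map.1 ((T x).orderEmbOfFin_mem (hT x) i)
      exact ⟨z, (hS _ _).1 hz, hz'⟩
    choose y h1 h2 using this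
    refine ⟨y, h1, fun i j hij => ?_⟩
    show e (y i) < e (y j)
    rw [h2, h2]
    exact (OrderEmbedding.strictMono _) hij
  choose y hy using hexist
  have hinj : ∀ x z, (x, z) ∈ W → z = y x := by
    intro x z hz
    funext i
    exact he.injective (congrFun ((huniq x z hz).trans (huniq x (y x) (hy x)).symm) i)
  have hym : Measurable y := by
    intro B hB
    have : y ⁻¹' B = Prod.fst '' (W ∩ Prod.snd ⁻¹' B) := by
      ext x
      constructor
      · intro h
        exact ⟨(x, y x), ⟨hy x, h⟩, rfl⟩
      · rintro ⟨⟨x', z⟩, ⟨h1, h2⟩, rfl⟩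
        have := hinj x' z h1
        subst this
        exact h2
    rw [this]
    refine MeasurableSet.image_of_measurable_injOn (hW.inter (measurable_snd hB)) measurable_fst ?_
    rintro ⟨x, z⟩ h1 ⟨x', z'⟩ h2 (h3 : x = x')
    subst h3
    rw [hinj x z h1.1, hinj x z' h2.1]
  let r : Fin n × Bool ≃ Fin (2 * n) := Fintype.equivFinOfCardEq (by simp [mul_comm])
  refine ⟨fun i x => y x (r i), fun i => (measurable_pi_apply _).comp hym, fun x i => (hy x).1 _,
    ?_, ?_⟩
  · intro x i j h
    apply r.injective
    have h1 : e (y x (r i)) = e (y x (r j)) := congrArg e h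
    have h2 := huniq x (y x) (hy x)
    have h3 := congrFun h2 (r i)
    have h4 := congrFun h2 (r j)
    exact (RelEmbedding.injective _) (h3.symm.trans (h1.trans h4))
  · intro x z hz
    have h1 : e z ∈ Set.range ((T x).orderEmbOfFin (hT x)) := by
      rw [Finset.range_orderEmbOfFin]
      exact Finset.mem_coe.2 (Finset.mem_map.2 ⟨z, (hS _ _).2 hz, rfl⟩)
    obtain ⟨k, hk⟩ := h1
    refine ⟨r.symm k, he.injective ?_⟩
    have h2 := congrFun (huniq x (y x) (hy x)) k
    simp only [Equiv.apply_symm_apply]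
    exact h2.trans hk

lemma nbr_tau {X : Type*} [MeasurableSpace X] [StandardBorelSpace X] (n : ℕ)
    (Q : SimpleGraph X) (f : (Fin n × Bool) → X → X) (hf : ∀ i, Measurable (f i))
    (hadj : ∀ x i, Q.Adj x (f i x)) (hinj : ∀ x i j, f i x = f j x → i = j)
    (hsurj : ∀ x y, Q.Adj x y → ∃ i, f i x = y) :
    ∃ τ : X × (Fin n × Bool) → X × (Fin n × Bool), Measurable τ ∧ (∀ h, τ (τ h) = h) ∧
      (∀ h, τ h ≠ h) ∧ (∀ x i, (τ (x, i)).1 = f i x) := by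
  have : ∀ x i, ∃ j, f j (f i x) = x := fun x i => hsurj _ _ (hadj x i).symm
  choose r hr using this
  have hrm : ∀ i, Measurable fun x => r x i := by
    intro i
    apply measurable_to_countable'
    intro j
    have : (fun x => r x i) ⁻¹' {j} = {x | f j (f i x) = x} := by
      ext x
      constructor
      · intro h
        have h' : r x i = j := h
        show f j (f i x) = x
        rw [← h', hr]
      · intro h
        exact hinj (f i x) _ _ ((hr x i).trans h.symm)
    rw [this]
    exact measurableSet_eq_fun ((hf j).comp (hf i)) measurable_id
  refine ⟨fun h => (f h.2 h.1, r h.1 h.2), measurable_fib _ fun i => (hf i).prodMk (hrm i), ?_, ?_,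
    fun _ _ => rfl⟩
  · rintro ⟨x, i⟩
    have h1 : f (r x i) (f i x) = x := hr x i
    have h2 : r (f i x) (r x i) = i := by
      apply hinj x
      have := hr (f i x) (r x i)
      rw [h1] at this
      exact this
    simp [h1, h2]
  · rintro ⟨x, i⟩ h
    have h1 : f i x = x := congrArg Prod.fst h
    exact (hadj x i).ne h1.symm

section action
variable {X : Type*} {n : ℕ}

open Classical in
noncomputable def dstep (f : (Fin n × Bool) → X → X)
    (lam : X × (Fin n × Bool) → Option (Fin n × Bool)) (l : Fin n × Bool) (p : X × Bool) :
    X × Bool :=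
  if h : ∃ i, lam (p.1, i) = some (if p.2 then lflip l else l) then (f h.choose p.1, p.2)
    else (p.1, !p.2)

lemma dstep_of {f : (Fin n × Bool) → X → X}
    {lam : X × (Fin n × Bool) → Option (Fin n × Bool)}
    (hl : ∀ x i j l, lam (x, i) = some l → lam (x, j) = some l → i = j)
    {l : Fin n × Bool} {x : X} {c : Bool} {i : Fin n × Bool}
    (h : lam (x, i) = some (if c then lflip l else l)) : dstep f lam l (x, c) = (f i x, c) := by
  have hex : ∃ i, lam ((x, c).1, i) = some (if (x, c).2 then lflip l else l) := ⟨i, h⟩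
  unfold dstep
  rw [dif_pos hex]
  rw [hl x _ i _ hex.choose_spec h]

lemma dstep_not {f : (Fin n × Bool) → X → X}
    {lam : X × (Fin n × Bool) → Option (Fin n × Bool)}
    {l : Fin n × Bool} {x : X} {c : Bool}
    (h : ¬ ∃ i, lam (x, i) = some (if c then lflip l else l)) :
    dstep f lam l (x, c) = (x, !c) := by
  unfold dstep
  rw [dif_neg h]

lemma dstep_inv (f : (Fin n × Bool) → X → X)
    (lam : X × (Fin n × Bool) → Option (Fin n × Bool))
    (τ : X × (Fin n × Bool) → X × (Fin n × Bool)) (hττ : ∀ h, τ (τ h) = h)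
    (hτf : ∀ x i, (τ (x, i)).1 = f i x)
    (hfl : ∀ h l, lam h = some l → lam (τ h) = some (lflip l))
    (hl : ∀ x i j l, lam (x, i) = some l → lam (x, j) = some l → i = j)
    (l : Fin n × Bool) (p : X × Bool) : dstep f lam (lflip l) (dstep f lam l p) = p := by
  obtain ⟨x, c⟩ := p
  by_cases h : ∃ i, lam (x, i) = some (if c then lflip l else l)
  · obtain ⟨i, hi⟩ := h
    rw [dstep_of hl hi]
    have h1 := hfl _ _ hi
    have h2 : τ (x, i) = (f i x, (τ (x, i)).2) := by rw [← hτf]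
    have h3 : lam (f i x, (τ (x, i)).2) = some (if c then lflip (lflip l) else lflip l) := by
      rw [← h2, h1]; cases c <;> simp
    rw [dstep_of hl h3, ← hτf, ← h2, hττ]
  · rw [dstep_not h]
    have h2 : ¬ ∃ i, lam (x, i) = some (if !c then lflip (lflip l) else lflip l) := by
      convert h using 4
      cases c <;> simp [lflip_lflip]
    rw [dstep_not h2]; simp

noncomputable def dperm (f : (Fin n × Bool) → X → X)
    (lam : X × (Fin n × Bool) → Option (Fin n × Bool))
    (hinv : ∀ l p, dstep f lam (lflip l) (dstep f lam l p) = p) (j : Fin n) :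
    Equiv.Perm (X × Bool) where
  toFun := dstep f lam (j, true)
  invFun := dstep f lam (j, false)
  left_inv := hinv (j, true)
  right_inv := hinv (j, false)

lemma lift_dperm (f : (Fin n × Bool) → X → X)
    (lam : X × (Fin n × Bool) → Option (Fin n × Bool))
    (hinv : ∀ l p, dstep f lam (lflip l) (dstep f lam l p) = p) (L : List (Fin n × Bool))
    (p : X × Bool) : FreeGroup.lift (dperm f lam hinv) (FreeGroup.mk L) p =
      L.foldr (dstep f lam) p := by
  rw [FreeGroup.lift_mk]
  induction L with
  | nil => rfl
  | cons l L ih =>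
    rw [List.map_cons, List.prod_cons, Equiv.Perm.mul_apply, ih, List.foldr_cons]
    obtain ⟨j, b⟩ := l
    cases b <;> rfl

lemma measurable_dstep [MeasurableSpace X] [StandardBorelSpace X] (f : (Fin n × Bool) → X → X)
    (hf : ∀ i, Measurable (f i))
    (lam : X × (Fin n × Bool) → Option (Fin n × Bool))
    (hlm : ∀ l, MeasurableSet {h | lam h = some l})
    (hl : ∀ x i j l, lam (x, i) = some l → lam (x, j) = some l → i = j)
    (l : Fin n × Bool) : Measurable (dstep f lam l) := by
  apply measurable_fib
  intro c
  intro B hB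
  let l' := if c then lflip l else l
  let A : Fin n × Bool → Set X := fun i => {x | lam (x, i) = some l'}
  have hA : ∀ i, MeasurableSet (A i) := fun i => meas_mk i (hlm l')
  have : (fun x => dstep f lam l (x, c)) ⁻¹' B =
      (⋃ i, (A i ∩ (fun x => (f i x, c)) ⁻¹' B)) ∪ ((⋃ i, A i)ᶜ ∩ (fun x => (x, !c)) ⁻¹' B) := by
    ext x
    simp only [Set.mem_preimage, Set.mem_union, Set.mem_iUnion, Set.mem_inter_iff, Set.mem_compl_iff]
    by_cases h : ∃ i, lam (x, i) = some l'
    · obtain ⟨i, hi⟩ := h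
      rw [dstep_of hl hi]
      constructor
      · intro h; exact Or.inl ⟨i, hi, h⟩
      · rintro (⟨j, hj, h⟩ | ⟨h, _⟩)
        · rwa [hl x i j l' hi hj]
        · exact absurd ⟨i, hi⟩ h
    · rw [dstep_not h]
      constructor
      · intro h'; exact Or.inr ⟨h, h'⟩
      · rintro (⟨j, hj, _⟩ | ⟨_, h'⟩)
        · exact absurd ⟨j, hj⟩ h
        · exact h'
  rw [this]
  refine MeasurableSet.union (MeasurableSet.iUnion fun i => (hA i).inter ?_)
    ((MeasurableSet.iUnion hA).compl.inter ?_)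
  · exact ((hf i).prodMk measurable_const) hB
  · exact (measurable_id.prodMk measurable_const) hB

def badset (f : (Fin n × Bool) → X → X) (N : Set (X × (Fin n × Bool))) : ℕ → Set X
  | 0 => {x | ∃ i, (x, i) ∈ N}
  | r + 1 => {x | ∃ i, (x, i) ∈ N} ∪ ⋃ i, f i ⁻¹' (badset f N r)

lemma badset_good {f : (Fin n × Bool) → X → X} {N : Set (X × (Fin n × Bool))} {r : ℕ} {x : X}
    (hx : x ∉ badset f N r) (i : Fin n × Bool) : (x, i) ∉ N := by
  intro h
  cases r with
  | zero => exact hx ⟨i, h⟩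
  | succ r => exact hx (Or.inl ⟨i, h⟩)

lemma measurableSet_badset [MeasurableSpace X] (f : (Fin n × Bool) → X → X)
    (hf : ∀ i, Measurable (f i)) (N : Set (X × (Fin n × Bool))) (hN : MeasurableSet N) (r : ℕ) :
    MeasurableSet (badset f N r) := by
  have h0 : MeasurableSet {x | ∃ i, (x, i) ∈ N} := by
    have : {x | ∃ i, (x, i) ∈ N} = ⋃ i, (fun x => (x, i)) ⁻¹' N := by ext x; simp
    rw [this]
    exact MeasurableSet.iUnion fun i => (measurable_id.prodMk measurable_const) hN
  induction r with
  | zero => exact h0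
  | succ r ih => exact h0.union (MeasurableSet.iUnion fun i => hf i ih)

lemma badset_measure [MeasurableSpace X] (f : (Fin n × Bool) → X → X)
    (hf : ∀ i, Measurable (f i)) (r : ℕ) : ∀ (ν : Measure X) [IsFiniteMeasure ν],
    ∃ κ : Measure (X × (Fin n × Bool)), IsFiniteMeasure κ ∧
      ∀ N, MeasurableSet N → ν (badset f N r) ≤ κ N := by
  have h0 : ∀ (ν : Measure X) [IsFiniteMeasure ν],
      ∃ κ : Measure (X × (Fin n × Bool)), IsFiniteMeasure κ ∧
      ∀ N, MeasurableSet N → ν {x | ∃ i, (x, i) ∈ N} ≤ κ N := by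
    intro ν _
    refine ⟨∑ i, ν.map (fun x => (x, i)), inferInstance, fun N hN => ?_⟩
    have : {x | ∃ i, (x, i) ∈ N} = ⋃ i, (fun x => (x, i)) ⁻¹' N := by ext x; simp
    rw [this, Measure.finsetSum_apply]
    refine (measure_iUnion_fintype_le _ _).trans (le_of_eq ?_)
    exact Finset.sum_congr rfl fun i _ =>
      (Measure.map_apply (measurable_id.prodMk measurable_const) hN).symm
  induction r with
  | zero => exact h0
  | succ r ih =>
    intro ν _
    obtain ⟨κ0, k0, k1⟩ := h0 ν
    have := fun i => ih (ν.map (f i))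
    choose κ k2 k3 using this
    refine ⟨κ0 + ∑ i, κ i, inferInstance, fun N hN => ?_⟩
    simp only [badset]
    rw [Measure.add_apply, Measure.finsetSum_apply]
    refine (measure_union_le _ _).trans (add_le_add (k1 N hN)
      ((measure_iUnion_fintype_le _ _).trans (Finset.sum_le_sum fun i _ => ?_)))
    rw [← Measure.map_apply (hf i) (measurableSet_badset f hf N hN r)]
    exact k3 i N hN

lemma good_all {lam : X × (Fin n × Bool) → Option (Fin n × Bool)}
    (hl : ∀ x i j l, lam (x, i) = some l → lam (x, j) = some l → i = j)
    {x : X} (hx : ∀ i, lam (x, i) ≠ none) (l : Fin n × Bool) : ∃ i, lam (x, i) = some l := by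
  have : ∀ i, ∃ l, lam (x, i) = some l := fun i => Option.ne_none_iff_exists'.1 (hx i)
  choose g hg using this
  have hinj : Function.Injective g := fun i j h => hl x i j (g j) (by rw [hg, h]) (hg j)
  obtain ⟨i, hi⟩ := (Finite.injective_iff_surjective.1 hinj) l
  exact ⟨i, by rw [hg, hi]⟩

lemma walk_lemma (Q : SimpleGraph X) (f : (Fin n × Bool) → X → X)
    (hadj : ∀ x i, Q.Adj x (f i x)) (hinj : ∀ x i j, f i x = f j x → i = j)
    (lam : X × (Fin n × Bool) → Option (Fin n × Bool))
    (τ : X × (Fin n × Bool) → X × (Fin n × Bool)) (hττ : ∀ h, τ (τ h) = h)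
    (hτf : ∀ x i, (τ (x, i)).1 = f i x)
    (hfl : ∀ h l, lam h = some l → lam (τ h) = some (lflip l))
    (hl : ∀ x i j l, lam (x, i) = some l → lam (x, j) = some l → i = j)
    (x : X) (L : List (Fin n × Bool)) : FreeGroup.IsReduced L → ∀ r,
      x ∉ badset f {h | lam h = none} (r + L.length) →
      ∃ (y : X) (p : Q.Walk y x), L.foldr (dstep f lam) (x, false) = (y, false) ∧
        y ∉ badset f {h | lam h = none} r ∧ p.length = L.length ∧
        List.IsChain (· ≠ ·) p.edges ∧ ∀ l L', L = l :: L' → ∃ z i, lam (z, i) = some l ∧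
          y = f i z ∧ p.edges.head? = some s(y, z) := by
  induction L with
  | nil =>
    intro _ r hx
    exact ⟨x, SimpleGraph.Walk.nil, rfl, hx, rfl, by simp, by simp⟩
  | cons l L ih =>
    intro hred r hx
    obtain ⟨y, p, h1, h2, h3, h4, h5⟩ := ih (hred.infix ⟨[l], [], by simp⟩) (r + 1) (by
      rw [List.length_cons] at hx
      rwa [show r + 1 + L.length = r + (L.length + 1) by omega])
    obtain ⟨j, hj⟩ := good_all hl (fun i => badset_good h2 i) l
    have hst : dstep f lam l (y, false) = (f j y, false) := dstep_of hl (by simpa using hj)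
    refine ⟨f j y, SimpleGraph.Walk.cons (hadj y j).symm p, ?_, ?_, ?_, ?_, ?_⟩
    · rw [List.foldr_cons, h1, hst]
    · intro h
      exact h2 (Or.inr (Set.mem_iUnion.2 ⟨j, h⟩))
    · simp [h3]
    · rw [SimpleGraph.Walk.edges_cons, List.isChain_cons]
      refine ⟨?_, h4⟩
      intro e he
      cases L with
      | nil =>
        have : p.edges.length = 0 := by rw [SimpleGraph.Walk.length_edges, h3]; rfl
        rw [List.length_eq_zero_iff] at this
        rw [this] at he; simp at he
      | cons l2 L2 =>
        obtain ⟨z, i, a1, a2, a3⟩ := h5 l2 L2 rfl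
        rw [a3] at he
        simp only [Option.mem_def, Option.some.injEq] at he
        subst he
        intro heq
        have hyz : f j y = z := by
          rw [Sym2.eq_swap, Sym2.congr_right] at heq
          exact heq
        have b1 : τ (z, i) = (y, (τ (z, i)).2) := by rw [a2, ← hτf]
        have b2 : f (τ (z, i)).2 y = z := by rw [← hτf, ← b1, hττ]
        have b3 : j = (τ (z, i)).2 := hinj y _ _ (hyz.trans b2.symm)
        have b4 := hfl _ _ a1
        rw [b1, ← b3, hj] at b4
        have b5 : l = lflip l2 := Option.some.inj b4
        have b6 := (FreeGroup.isReduced_cons_cons.1 hred).1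
        rw [b5] at b6
        simp [lflip] at b6
    · intro l' L' hL
      obtain ⟨rfl, rfl⟩ := List.cons.inj hL
      exact ⟨y, j, hj, rfl, by simp⟩

lemma free_lemma (Q : SimpleGraph X) (hac : Q.IsAcyclic) (f : (Fin n × Bool) → X → X)
    (hadj : ∀ x i, Q.Adj x (f i x)) (hinj : ∀ x i j, f i x = f j x → i = j)
    (lam : X × (Fin n × Bool) → Option (Fin n × Bool))
    (τ : X × (Fin n × Bool) → X × (Fin n × Bool)) (hττ : ∀ h, τ (τ h) = h)
    (hτf : ∀ x i, (τ (x, i)).1 = f i x)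
    (hfl : ∀ h l, lam h = some l → lam (τ h) = some (lflip l))
    (hl : ∀ x i j l, lam (x, i) = some l → lam (x, j) = some l → i = j)
    (hinv : ∀ l p, dstep f lam (lflip l) (dstep f lam l p) = p)
    (R : ℕ) (x : X) (hx : x ∉ badset f {h | lam h = none} R)
    (γ δ : FreeGroup (Fin n)) (hR : (δ⁻¹ * γ).toWord.length ≤ R)
    (heq : FreeGroup.lift (dperm f lam hinv) γ (x, false) =
      FreeGroup.lift (dperm f lam hinv) δ (x, false)) : γ = δ := by
  by_contra hne
  have h1 : FreeGroup.lift (dperm f lam hinv) (δ⁻¹ * γ) (x, false) = (x, false) := by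
    rw [map_mul, Equiv.Perm.mul_apply, heq, map_inv]
    simp
  rw [← FreeGroup.mk_toWord (x := δ⁻¹ * γ), lift_dperm] at h1
  obtain ⟨y, p, a1, a2, a3, a4, a5⟩ := walk_lemma Q f hadj hinj lam τ hττ hτf hfl hl x
    (δ⁻¹ * γ).toWord FreeGroup.isReduced_toWord (R - (δ⁻¹ * γ).toWord.length) (by
      rwa [Nat.sub_add_cancel hR])
  have h2 : y = x := by
    rw [h1] at a1; exact (congrArg Prod.fst a1).symm
  subst h2
  have hp := (hac.isPath_iff_isChain p).2 a4
  rw [SimpleGraph.Walk.isPath_iff_eq_nil] at hp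
  rw [hp] at a3
  have h3 : (δ⁻¹ * γ).toWord = [] := List.length_eq_zero_iff.1 a3.symm
  rw [FreeGroup.toWord_eq_nil_iff] at h3
  exact hne (inv_mul_eq_one.1 h3).symm

end action

lemma card_fiber {K D : Type*} [Finite K] [Finite D] (ι : D → K) (hι : Function.Injective ι)
    (S : Set (D → Bool)) :
    Nat.card {ω : K → Bool // (fun d => ω (ι d)) ∈ S} * Nat.card (D → Bool) =
      Nat.card S * Nat.card (K → Bool) := by
  classical
  let C := ({k : K // ¬ (k ∈ Set.range ι)} → Bool)
  let e1 : (K → Bool) ≃ (({k : K // k ∈ Set.range ι} → Bool) × C) :=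
    Equiv.piEquivPiSubtypeProd (fun k => k ∈ Set.range ι) (fun _ => Bool)
  let e2 : ({k : K // k ∈ Set.range ι} → Bool) ≃ (D → Bool) :=
    (Equiv.arrowCongr (Equiv.ofInjective ι hι) (Equiv.refl Bool)).symm
  let e : (K → Bool) ≃ (D → Bool) × C := e1.trans (Equiv.prodCongr e2 (Equiv.refl C))
  have he : ∀ ω, (e ω).1 = fun d => ω (ι d) := by
    intro ω; funext d; rfl
  have h1 : Nat.card {ω : K → Bool // (fun d => ω (ι d)) ∈ S} = Nat.card S * Nat.card C := by
    rw [← Nat.card_prod]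
    refine Nat.card_congr ((Equiv.subtypeEquiv e (q := fun p => p.1 ∈ S) ?_).trans
      Equiv.prodSubtypeFstEquivSubtypeProd)
    intro ω; rw [he]
  rw [h1, Nat.card_congr e, Nat.card_prod]
  ring

lemma count_beta {Γ : Type*} [Group Γ] (β : Measure (Γ → Bool))
    (hβ : IsBernoulliMeasure β) (D : Finset Γ) (J : Set (Γ → Bool))
    (hJ : ∀ φ ψ : Γ → Bool, (∀ d ∈ D, φ d = ψ d) → φ ∈ J → ψ ∈ J)
    {K : Type*} [Fintype K] [DecidableEq K] (g : Γ → K) (hg : Set.InjOn g D) :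
    (Nat.card {ω : K → Bool // (fun γ => ω (g γ)) ∈ J} : ENNReal) =
      β J * (Fintype.card (K → Bool) : ENNReal) := by
  classical
  let res : (Γ → Bool) → (D → Bool) := fun φ d => φ d
  have hres : Measurable res := measurable_pi_lambda _ fun d => measurable_pi_apply _
  let S : Set (D → Bool) := res '' J
  have hS : ∀ φ, res φ ∈ S ↔ φ ∈ J := by
    intro φ
    constructor
    · rintro ⟨ψ, hψ, h⟩
      exact hJ ψ φ (fun d hd => congrFun h ⟨d, hd⟩) hψ
    · intro h; exact ⟨φ, h, rfl⟩
  have hJS : J = res ⁻¹' S := by ext φ; exact (hS φ).symm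
  have h1 : β J = (Nat.card S : ENNReal) * (1 / 2) ^ D.card := by
    have hsing : ∀ s : D → Bool, (β.map res) {s} = (1 / 2) ^ D.card := by
      intro s
      rw [Measure.map_apply hres (measurableSet_singleton s)]
      rw [← hβ D (fun γ => if h : γ ∈ D then s ⟨γ, h⟩ else false)]
      congr 1
      ext φ
      simp only [Set.mem_preimage, Set.mem_singleton_iff, funext_iff]
      constructor
      · intro h d hd
        simp only [hd, dite_true]
        exact h ⟨d, hd⟩
      · rintro h ⟨d, hd⟩
        have := h d hd
        simpa [hd] using this
    conv_lhs => rw [hJS]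
    rw [← Measure.map_apply hres (Set.toFinite S).measurableSet]
    have h2 : S = ↑(S.toFinset) := by simp
    conv_lhs => rw [h2]
    rw [← sum_measure_singleton]
    simp only [hsing, Finset.sum_const, nsmul_eq_mul]
    rw [Nat.card_eq_card_toFinset]
  have h2 := card_fiber (fun d : D => g d) (fun a b h => Subtype.ext (hg a.2 b.2 h)) S
  have h3 : Nat.card {ω : K → Bool // (fun γ => ω (g γ)) ∈ J} =
      Nat.card {ω : K → Bool // (fun d : D => ω (g d)) ∈ S} := by
    refine Nat.card_congr (Equiv.subtypeEquivRight fun ω => ?_)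
    exact (hS (fun γ => ω (g γ))).symm
  rw [← h3] at h2
  have h4 : Nat.card (D → Bool) = 2 ^ D.card := by simp
  rw [h4] at h2
  have h5 : (Nat.card {ω : K → Bool // (fun γ => ω (g γ)) ∈ J} : ENNReal) * 2 ^ D.card =
      (Nat.card S : ENNReal) * (Fintype.card (K → Bool) : ENNReal) := by
    rw [← Nat.card_eq_fintype_card]
    exact_mod_cast h2
  have h6 : (2 : ENNReal) ^ D.card * (1 / 2) ^ D.card = 1 := by
    rw [← mul_pow, one_div, ENNReal.mul_inv_cancel (by simp) (by simp), one_pow]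
  rw [h1, mul_right_comm, ← h5, mul_assoc, h6, mul_one]

lemma approx_J (n : ℕ) (β : Measure (FreeGroup (Fin n) → Bool)) [IsProbabilityMeasure β]
    (J : Set (FreeGroup (Fin n) → Bool))
    (hJmeas : NullMeasurableSet J β) (hJfree : J ⊆ freePart (FreeGroup (Fin n)))
    (hJind : IndepIn (freeGroupSchreierAdj n) J) (δ : ENNReal) (hδ : δ ≠ 0) :
    ∃ (D : Finset (FreeGroup (Fin n))) (J' : Set (FreeGroup (Fin n) → Bool)),
      (∀ φ ψ : FreeGroup (Fin n) → Bool, (∀ d ∈ D, φ d = ψ d) → φ ∈ J' → ψ ∈ J') ∧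
      (∀ φ ∈ J', ∀ l : Fin n × Bool, bernoulliShift (FreeGroup.mk [l]) φ ∉ J') ∧
      MeasurableSet J' ∧ β J ≤ β J' + δ := by
  classical
  obtain ⟨J0, j1, j2, j3⟩ := hJmeas.exists_measurable_subset_ae_eq
  let sh : Fin n × Bool → (FreeGroup (Fin n) → Bool) → (FreeGroup (Fin n) → Bool) :=
    fun l => bernoulliShift (FreeGroup.mk [l])
  have hsh : ∀ l, Measurable (sh l) := fun l =>
    measurable_pi_lambda _ fun d => measurable_pi_apply _
  have hdis : ∀ l φ, φ ∈ J0 → sh l φ ∉ J0 := by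
    rintro ⟨i, b⟩ φ h1 h2
    have hne : φ ≠ sh (i, b) φ := by
      refine (hJfree (j1 h1) (FreeGroup.mk [(i, b)]) ?_).symm
      intro h
      rw [← FreeGroup.toWord_eq_nil_iff, FreeGroup.toWord_mk] at h
      simp at h
    refine hJind φ (j1 h1) _ (j1 h2) ⟨hJfree (j1 h1), hJfree (j1 h2), hne, i, ?_⟩
    cases b
    · right; rfl
    · left; rfl
  let β' : Measure (FreeGroup (Fin n) → Bool) := β + ∑ l, β.map (sh l)
  obtain ⟨C, hC, hC2⟩ := exists_measure_symmDiff_lt_of_generateFrom_isSetRing (μ := β')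
    (isSetRing_measurableCylinders (α := fun _ : FreeGroup (Fin n) => Bool))
    ⟨{Set.univ}, Set.countable_singleton _,
      Set.singleton_subset_iff.2
        (isSetAlgebra_measurableCylinders (α := fun _ : FreeGroup (Fin n) => Bool)).univ_mem,
      by simp⟩
    generateFrom_measurableCylinders.symm j2 (pos_iff_ne_zero.2 hδ)
  obtain ⟨D0, S0, hS0, rfl⟩ := (mem_measurableCylinders C).1 hC
  let C : Set (FreeGroup (Fin n) → Bool) := cylinder D0 S0
  have hCm : MeasurableSet C := hS0.cylinder D0
  have hCdep : ∀ φ ψ : FreeGroup (Fin n) → Bool, (∀ d ∈ D0, φ d = ψ d) → (φ ∈ C ↔ ψ ∈ C) := by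
    intro φ ψ h
    simp only [C, mem_cylinder]
    have : D0.restrict φ = D0.restrict ψ := by
      funext d; exact h d d.2
    rw [this]
  let T := symmDiff C J0
  have hT : MeasurableSet T := hCm.symmDiff j2
  let D : Finset (FreeGroup (Fin n)) :=
    D0 ∪ Finset.univ.biUnion fun l : Fin n × Bool => D0.image fun d => d * FreeGroup.mk [l]
  let J' : Set (FreeGroup (Fin n) → Bool) := C \ ⋃ l, sh l ⁻¹' C
  have hJ'm : MeasurableSet J' := hCm.diff (MeasurableSet.iUnion fun l => hsh l hCm)
  refine ⟨D, J', ?_, ?_, hJ'm, ?_⟩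
  · rintro φ ψ h ⟨h1, h2⟩
    refine ⟨(hCdep φ ψ fun d hd => h d (Finset.mem_union_left _ hd)).1 h1, ?_⟩
    intro h3
    apply h2
    obtain ⟨l, hl⟩ := Set.mem_iUnion.1 h3
    refine Set.mem_iUnion.2 ⟨l, (hCdep _ _ fun d hd => ?_).2 hl⟩
    refine h _ (Finset.mem_union_right _ (Finset.mem_biUnion.2 ⟨l, Finset.mem_univ _, ?_⟩))
    exact Finset.mem_image.2 ⟨d, hd, rfl⟩
  · rintro φ ⟨h1, h2⟩ l ⟨h3, _⟩
    exact h2 (Set.mem_iUnion.2 ⟨l, h3⟩)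
  · have hss : J0 ⊆ J' ∪ (T ∪ ⋃ l, sh l ⁻¹' T) := by
      intro φ h0
      by_cases h1 : φ ∈ C
      · by_cases h2 : φ ∈ J'
        · exact Or.inl h2
        · right; right
          have h3 : φ ∈ ⋃ l, sh l ⁻¹' C := by
            by_contra h; exact h2 ⟨h1, h⟩
          obtain ⟨l, hl⟩ := Set.mem_iUnion.1 h3
          exact Set.mem_iUnion.2 ⟨l, Or.inl ⟨hl, hdis l φ h0⟩⟩
      · right; left; exact Or.inr ⟨h0, h1⟩
    calc β J = β J0 := (measure_congr j3).symm
      _ ≤ β (J' ∪ (T ∪ ⋃ l, sh l ⁻¹' T)) := measure_mono hss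
      _ ≤ β J' + (β T + ∑ l, β (sh l ⁻¹' T)) :=
        (measure_union_le _ _).trans (add_le_add le_rfl ((measure_union_le _ _).trans
          (add_le_add le_rfl (measure_iUnion_fintype_le _ _))))
      _ = β J' + β' T := by
        simp only [β', Measure.add_apply, Measure.finsetSum_apply]
        congr 2
        exact Finset.sum_congr rfl fun l _ => (Measure.map_apply (hsh l) hT).symm
      _ ≤ β J' + δ := by gcongr

/-- If `Q` is a `2n`-regular acyclic Borel graph on a standard Borel
space with a Borel probability measure `μ`, then `α_μ(Q) ≥ α_β(G_n)`: for every
`β`-measurable `G_n`-independent set `J` and every `ε > 0` there is a `μ`-measurable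
`Q`-independent set `A` with `μ(A) ≥ β(J) − ε`. -/
theorem mu_independence_ge_bernoulli_independence
    (n : ℕ) (hn : 1 ≤ n)
    (β : Measure (FreeGroup (Fin n) → Bool)) [IsProbabilityMeasure β]
    (hβ : IsBernoulliMeasure β)
    {X : Type*} [MeasurableSpace X] [StandardBorelSpace X]
    (Q : SimpleGraph X)
    (hQBorel : MeasurableSet {p : X × X | Q.Adj p.1 p.2})
    (hQreg : ∀ x : X, Nat.card {y : X // Q.Adj x y} = 2 * n)
    (hQacyclic : Q.IsAcyclic)
    (μ : Measure X) [IsProbabilityMeasure μ]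
    (J : Set (FreeGroup (Fin n) → Bool))
    (hJmeas : NullMeasurableSet J β) (hJfree : J ⊆ freePart (FreeGroup (Fin n)))
    (hJind : IndepIn (freeGroupSchreierAdj n) J)
    (ε : ℝ) (hε : 0 < ε) :
    ∃ A : Set X, NullMeasurableSet A μ ∧
      (∀ x ∈ A, ∀ y ∈ A, ¬ Q.Adj x y) ∧
      (β J).toReal - ε ≤ (μ A).toReal := by
  classical
  let δ : ENNReal := ENNReal.ofReal (ε / 3)
  have hδ : δ ≠ 0 := by
    simp only [δ, ne_eq, ENNReal.ofReal_eq_zero, not_le]; positivity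
  obtain ⟨D, J', d1, d2, d3, d4⟩ := approx_J n β J hJmeas hJfree hJind δ hδ
  obtain ⟨f, f1, f2, f3, f4⟩ := nbr_enum n hn Q hQBorel hQreg
  obtain ⟨τ, t1, t2, t3, t4⟩ := nbr_tau n Q f f1 f2 f3 f4
  let R : ℕ := (D ×ˢ D).sup (fun p => (p.2⁻¹ * p.1).toWord.length)
  obtain ⟨κ, k1, k2⟩ := badset_measure f f1 R μ
  obtain ⟨lam, l1, l2, l3, l4⟩ := decoration τ t1 t2 t3 κ δ hδ
  let N : Set (X × (Fin n × Bool)) := {h | lam h = none}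
  have hN : MeasurableSet N := by
    have : N = (⋃ l, {h | lam h = some l})ᶜ := by
      ext h
      simp only [N, Set.mem_setOf_eq, Set.mem_compl_iff, Set.mem_iUnion]
      cases lam h <;> simp
    rw [this]
    exact (MeasurableSet.iUnion l1).compl
  have hinv := dstep_inv f lam τ t2 t4 l2 l3
  let ρ := FreeGroup.lift (dperm f lam hinv)
  have hρm : ∀ γ, Measurable fun x : X => ρ γ (x, false) := by
    intro γ
    have h1 : ∀ L : List (Fin n × Bool), Measurable fun p => L.foldr (dstep f lam) p := by
      intro L
      induction L with
      | nil => exact measurable_id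
      | cons l L ih => exact (measurable_dstep f f1 lam l1 l3 l).comp ih
    have h2 : (fun x : X => ρ γ (x, false)) =
        fun x => γ.toWord.foldr (dstep f lam) (x, false) := by
      funext x
      rw [← lift_dperm f lam hinv, FreeGroup.mk_toWord]
    rw [h2]
    exact (h1 γ.toWord).comp (meas_mk false)
  obtain ⟨k, c, c1, c2, c3⟩ := sep_lemma μ (fun (d : D) (x : X) => ρ d (x, false))
    (fun d => hρm d) δ hδ
  let B : Set X := {y | ∃ i j : D, ρ i (y, false) ≠ ρ j (y, false) ∧
    c (ρ i (y, false)) = c (ρ j (y, false))}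
  have hB : MeasurableSet B := c2
  have hBμ : μ B ≤ δ := c3
  let bad : Set X := badset f N R
  have hbad : MeasurableSet bad := measurableSet_badset f f1 N hN R
  have hbadμ : μ bad ≤ δ := (k2 N hN).trans l4
  let Φ : ((Fin k → Bool) → Bool) → X → (FreeGroup (Fin n) → Bool) :=
    fun ω x γ => ω (c (ρ γ (x, false)))
  have hΦ : ∀ ω, Measurable (Φ ω) := fun ω =>
    measurable_pi_lambda _ fun γ => (measurable_of_finite ω).comp (c1.comp (hρm γ))
  let A : ((Fin k → Bool) → Bool) → Set X := fun ω => badᶜ ∩ Φ ω ⁻¹' J'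
  have hA : ∀ ω, MeasurableSet (A ω) := fun ω => hbad.compl.inter (hΦ ω d3)
  obtain ⟨ω, hω⟩ := avg_lemma μ (fun ω => (A ω)ᶜ) (fun ω => (hA ω).compl) (bad ∪ B)ᶜ
    (hbad.union hB).compl (β J'ᶜ) (by
      intro y hy
      have hy1 : y ∉ bad := fun h => hy (Or.inl h)
      have hy2 : y ∉ B := fun h => hy (Or.inr h)
      have hinj : Set.InjOn (fun γ => c (ρ γ (y, false))) D := by
        intro γ hγ γ' hγ' h
        have h1 : ρ γ (y, false) = ρ γ' (y, false) := by
          by_contra hne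
          exact hy2 ⟨⟨γ, hγ⟩, ⟨γ', hγ'⟩, hne, h⟩
        refine free_lemma Q hQacyclic f f2 f3 lam τ t2 t4 l2 l3 hinv R y hy1 γ γ' ?_ h1
        exact Finset.le_sup (f := fun p : FreeGroup (Fin n) × FreeGroup (Fin n) =>
          (p.2⁻¹ * p.1).toWord.length) (b := (γ, γ')) (Finset.mk_mem_product hγ hγ')
      have h2 := count_beta β hβ D J'ᶜ
        (fun φ ψ h hφ hψ => hφ (d1 ψ φ (fun d hd => (h d hd).symm) hψ))
        (fun γ => c (ρ γ (y, false))) hinj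
      rw [← h2]
      refine le_of_eq ?_
      congr 1
      refine Nat.card_congr (Equiv.subtypeEquivRight fun ω => ?_)
      constructor
      · intro h1 h2; exact h1 ⟨hy1, h2⟩
      · intro h1 h2; exact h1 h2.2)
  refine ⟨A ω, (hA ω).nullMeasurableSet, ?_, ?_⟩
  · rintro x ⟨hx1, hx2⟩ y ⟨hy1, hy2⟩ hadj
    obtain ⟨i, rfl⟩ := f4 x y hadj
    obtain ⟨l, hl⟩ := Option.ne_none_iff_exists'.1 (badset_good hx1 i : lam (x, i) ≠ none)
    have h1 : ρ (FreeGroup.mk [l]) (x, false) = (f i x, false) := by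
      simp only [ρ]
      rw [lift_dperm]
      exact dstep_of l3 (by simpa using hl)
    have h2 : Φ ω (f i x) = bernoulliShift (FreeGroup.mk [l]) (Φ ω x) := by
      funext γ
      simp only [Φ, bernoulliShift]
      rw [map_mul, Equiv.Perm.mul_apply, h1]
    refine d2 (Φ ω x) hx2 l ?_
    rw [← h2]; exact hy2
  · rw [compl_compl, measure_univ, mul_one] at hω
    have h1 : μ (A ω)ᶜ ≤ δ + δ + β J'ᶜ :=
      hω.trans (add_le_add ((measure_union_le _ _).trans (add_le_add hbadμ hBμ)) le_rfl)
    have h2 := ENNReal.toReal_mono (by simp [δ]) h1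
    rw [ENNReal.toReal_add (by simp [δ]) (by simp), ENNReal.toReal_add (by simp [δ]) (by simp [δ])] at h2
    have h3 := ENNReal.toReal_mono (by simp [δ]) d4
    rw [ENNReal.toReal_add (by simp) (by simp [δ])] at h3
    have h4 : (μ (A ω)ᶜ).toReal = 1 - (μ (A ω)).toReal := probReal_compl_eq_one_sub (hA ω)
    have h5 : (β J'ᶜ).toReal = 1 - (β J').toReal := probReal_compl_eq_one_sub d3
    have h6 : δ.toReal = ε / 3 := ENNReal.toReal_ofReal (by positivity)
    rw [h4, h5, h6] at h2
    rw [h6] at h3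
    linarith
end

section
/- (Grebík) Let n ≥ 1 and let Q be a 2n-regular Borel graph on a standard Borel space X (every vertex has exactly 2n neighbors), let μ be a Borel probability measure on X, and let ε > 0. Then there exist Borel sets A_1, …, A_n ⊆ X and Borel maps p_1, …, p_n : X → X such that each p_i is injective on A_i, p_i(x) is adjacent to x in Q for every x ∈ A_i, and the set C of all x ∈ X satisfying: (i) x ∈ A_i and x ∈ p_i(A_i) for every 1 ≤ i ≤ n, and (ii) the set of neighbors of x in Q equals { p_1(x), …, p_n(x) } ∪ { y ∈ A_i : p_i(y) = x, 1 ≤ i ≤ n }, has measure μ(C) ≥ 1 − ε. -/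
open MeasureTheory
open scoped ENNReal

namespace SchreierAux

lemma perm_count (M N : ℕ) (c : Fin (N+1) → Fin M) (hc : Function.Injective c) (i0 : Fin (N+1)) :
    (N+1) * (Finset.univ.filter (fun ψ : Equiv.Perm (Fin M) => ∀ j, ψ (c j) ≤ ψ (c i0))).card
      ≤ Fintype.card (Equiv.Perm (Fin M)) := by
  classical
  set Ev : Fin (N+1) → Finset (Equiv.Perm (Fin M)) := fun i =>
    Finset.univ.filter (fun ψ : Equiv.Perm (Fin M) => ∀ j, ψ (c j) ≤ ψ (c i)) with hEv
  have hcard : ∀ i, (Ev i0).card ≤ (Ev i).card := by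
    intro i
    refine Finset.card_le_card_of_injOn (fun ψ => ψ * Equiv.swap (c i) (c i0)) ?_ ?_
    · intro ψ hψ
      simp only [hEv, Finset.coe_filter, Finset.mem_univ, true_and, Set.mem_ofPred_eq] at hψ ⊢
      intro j
      simp only [Equiv.Perm.coe_mul, Function.comp_apply, Equiv.swap_apply_left]
      rw [Equiv.swap_apply_def]
      split_ifs <;> apply hψ
    · intro a _ b _ h
      exact mul_right_cancel h
  have hdisj : (↑(Finset.univ : Finset (Fin (N+1))) : Set (Fin (N+1))).PairwiseDisjoint Ev := by
    intro i _ j _ hij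
    rw [Function.onFun, Finset.disjoint_left]
    intro ψ h1 h2
    simp only [hEv, Finset.mem_filter, Finset.mem_univ, true_and] at h1 h2
    exact hij (hc (ψ.injective (le_antisymm (h2 i) (h1 j))))
  have h1 : (Finset.univ.biUnion Ev).card = ∑ i, (Ev i).card := Finset.card_biUnion hdisj
  have h2 : (Finset.univ.biUnion Ev).card ≤ Fintype.card (Equiv.Perm (Fin M)) := Finset.card_le_univ _
  have h3 : ∑ _i : Fin (N+1), (Ev i0).card ≤ ∑ i, (Ev i).card := Finset.sum_le_sum (fun i _ => hcard i)
  simp only [Finset.sum_const, Finset.card_univ, Fintype.card_fin, smul_eq_mul] at h3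
  exact (h3.trans h1.ge).trans h2

lemma exists_coloring {H : Type*} [MeasurableSpace H] [StandardBorelSpace H]
    (ν : Measure H) [IsFiniteMeasure ν] {ι : Type*} [Finite ι] (u : ι → H → H)
    (hu : ∀ a, Measurable (u a)) (δ : ℝ≥0∞) (hδ : 0 < δ) :
    ∃ (M : ℕ) (c : H → Fin M), Measurable c ∧
      ν {h | ∃ a b, u a h ≠ u b h ∧ c (u a h) = c (u b h)} ≤ δ := by
  classical
  obtain ⟨φ, hφ, hφi⟩ := MeasurableSpace.measurable_injection_nat_bool_of_countablySeparated H
  let s : ℕ → Set H := fun k => {h | ∃ a b, u a h ≠ u b h ∧ ∀ i < k, φ (u a h) i = φ (u b h) i}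
  have hs : ∀ k, MeasurableSet (s k) := by
    intro k
    simp only [s, Set.ofPred_exists]
    refine MeasurableSet.iUnion fun a => MeasurableSet.iUnion fun b => ?_
    refine MeasurableSet.inter (measurableSet_eq_fun (hu a) (hu b)).compl ?_
    suffices hh : MeasurableSet {x | ∀ i < k, φ (u a x) i = φ (u b x) i} from hh
    rw [show {x | ∀ i < k, φ (u a x) i = φ (u b x) i} =
      ⋂ i, ⋂ (_ : i < k), {x | φ (u a x) i = φ (u b x) i} by ext; simp]
    refine MeasurableSet.iInter fun i => MeasurableSet.iInter fun _ => ?_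
    exact measurableSet_eq_fun ((measurable_pi_apply i).comp (hφ.comp (hu a)))
      ((measurable_pi_apply i).comp (hφ.comp (hu b)))
  have hanti : Antitone s := by
    rintro k l hkl h ⟨a, b, h1, h2⟩
    exact ⟨a, b, h1, fun i hi => h2 i (hi.trans_le hkl)⟩
  have hempty : ⋂ k, s k = ∅ := by
    ext h
    simp only [Set.mem_iInter, Set.mem_empty_iff_false, iff_false, not_forall]
    have key : ∀ p : ι × ι, ∃ k, u p.1 h = u p.2 h ∨ ∃ i < k, φ (u p.1 h) i ≠ φ (u p.2 h) i := by
      intro p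
      by_cases hp : u p.1 h = u p.2 h
      · exact ⟨0, Or.inl hp⟩
      · have : φ (u p.1 h) ≠ φ (u p.2 h) := fun h' => hp (hφi h')
        obtain ⟨i, hi⟩ := Function.ne_iff.1 this
        exact ⟨i+1, Or.inr ⟨i, Nat.lt_succ_self i, hi⟩⟩
    choose k hk using key
    obtain ⟨K, hK⟩ := (Set.finite_range k).bddAbove
    refine ⟨K, ?_⟩
    rintro ⟨a, b, h1, h2⟩
    rcases hk (a, b) with h | ⟨i, hi, hne⟩
    · exact h1 h
    · exact hne (h2 i (hi.trans_le (hK ⟨(a, b), rfl⟩)))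
  have ht := tendsto_measure_iInter_atTop (μ := ν) (s := s) (fun k => (hs k).nullMeasurableSet) hanti
    ⟨0, measure_ne_top _ _⟩
  rw [hempty, measure_empty] at ht
  obtain ⟨k, hk⟩ := (ht.eventually (gt_mem_nhds hδ)).exists
  let e := Fintype.equivFin (Fin k → Bool)
  refine ⟨_, fun h => e (fun i => φ h i), ?_, ?_⟩
  · refine (measurable_of_finite e).comp ?_
    exact measurable_pi_lambda _ (fun i => (measurable_pi_apply _).comp hφ)
  · refine (measure_mono ?_).trans hk.le
    rintro h ⟨a, b, h1, h2⟩
    refine ⟨a, b, h1, fun i hi => ?_⟩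
    have := congrFun (e.injective h2) ⟨i, hi⟩
    exact this

section dihedral
variable {H : Type*} {σ ι : H → H} 

lemma no_fix (hσ : Function.Involutive σ) (hι : Function.Involutive ι)
    (hσf : ∀ h, σ h ≠ h) (hιf : ∀ h, ι h ≠ h) :
    ∀ (k : ℕ) (g : H), (σ ∘ ι)^[k] g ≠ ι g := by
  intro k
  induction k using Nat.twoStepInduction with
  | zero => intro g h; exact hιf g h.symm
  | one => intro g h; exact hσf (ι g) h
  | more k ih _ =>
    intro g h
    refine ih (σ (ι g)) ?_
    rw [Function.iterate_succ_apply', Function.iterate_succ_apply] at h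
    have h2 := congrArg σ h
    simp only [Function.comp_apply] at h2
    rw [hσ] at h2
    have h3 := congrArg ι h2
    rw [hι] at h3
    exact h3

lemma no_meet (hσ : Function.Involutive σ) (hι : Function.Involutive ι)
    (hσf : ∀ h, σ h ≠ h) (hιf : ∀ h, ι h ≠ h) :
    ∀ (j i : ℕ) (h : H), (σ ∘ ι)^[i] h ≠ (σ ∘ ι)^[j] (ι h) := by
  intro j
  induction j with
  | zero => intro i h; exact no_fix hσ hι hσf hιf i h
  | succ j ih =>
    intro i h hh
    refine ih (i+1) (ι (σ h)) ?_
    rw [Function.iterate_succ_apply] at hh ⊢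
    simp only [Function.comp_apply, hι _, hσ _] at hh ⊢
    exact hh

/-- window maximum -/
def wmax (f : H → H) (N : ℕ) (v : H → ℕ) (z : H) : ℕ := (Finset.range N).sup (fun j => v (f^[j] z))

lemma wmax_eq_of_mem (f : H → H) (N : ℕ) (v : H → ℕ) (z : H) (j : ℕ) (h0 : 0 < j) (hj : j < N)
    (hmax : ∀ i ≤ N, v (f^[i] z) ≤ v (f^[j] z)) : wmax f N v (f z) = wmax f N v z := by
  have e1 : wmax f N v z = v (f^[j] z) := by
    apply le_antisymm
    · exact Finset.sup_le fun i hi => hmax i (Finset.mem_range.1 hi).le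
    · exact Finset.le_sup (f := fun j => v (f^[j] z)) (Finset.mem_range.2 hj)
  have e2 : wmax f N v (f z) = v (f^[j] z) := by
    apply le_antisymm
    · refine Finset.sup_le fun i hi => ?_
      rw [← Function.iterate_succ_apply]
      exact hmax (i+1) (Finset.mem_range.1 hi)
    · obtain ⟨j, rfl⟩ := Nat.exists_eq_succ_of_ne_zero h0.ne'
      rw [Function.iterate_succ_apply]
      exact Finset.le_sup (f := fun j => v (f^[j] (f z))) (Finset.mem_range.2 (by omega))
  rw [e1, e2]

lemma wmax_eq_of_period (f : H → H) (N : ℕ) (v : H → ℕ) (z : H) (p : ℕ) (h0 : 0 < p) (hp : p ≤ N)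
    (hper : f^[p] z = z) : wmax f N v (f z) = wmax f N v z := by
  apply le_antisymm
  · refine Finset.sup_le fun i hi => ?_
    rw [Finset.mem_range] at hi
    rw [← Function.iterate_succ_apply]
    rcases Nat.lt_or_ge (i+1) N with h | h
    · exact Finset.le_sup (f := fun j => v (f^[j] z)) (Finset.mem_range.2 h)
    · have : f^[i.succ] z = f^[i + 1 - p] z := by
        have : i.succ = (i + 1 - p) + p := by omega
        rw [this, Function.iterate_add_apply, hper]
      rw [this]
      exact Finset.le_sup (f := fun j => v (f^[j] z)) (Finset.mem_range.2 (by omega))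
  · refine Finset.sup_le fun i hi => ?_
    rw [Finset.mem_range] at hi
    rcases Nat.eq_zero_or_pos i with h | h
    · subst h
      obtain ⟨p, rfl⟩ := Nat.exists_eq_succ_of_ne_zero h0.ne'
      rw [Function.iterate_zero_apply]
      conv_lhs => rw [← hper, Function.iterate_succ_apply]
      exact Finset.le_sup (f := fun j => v (f^[j] (f z))) (Finset.mem_range.2 (by omega))
    · obtain ⟨i, rfl⟩ := Nat.exists_eq_succ_of_ne_zero h.ne'
      rw [Function.iterate_succ_apply]
      exact Finset.le_sup (f := fun j => v (f^[j] (f z))) (Finset.mem_range.2 (by omega))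

lemma wmax_count {M : ℕ} (f : H → H) (hf : Function.Injective f) (N : ℕ) (c : H → Fin M) (z : H)
    (hc : ∀ i ≤ N, ∀ j ≤ N, c (f^[i] z) = c (f^[j] z) → f^[i] z = f^[j] z) :
    (N+1) * (Finset.univ.filter (fun ψ : Equiv.Perm (Fin M) =>
        wmax f N (fun h => (ψ (c h) : ℕ)) (f z) ≠ wmax f N (fun h => (ψ (c h) : ℕ)) z)).card
      ≤ 2 * Fintype.card (Equiv.Perm (Fin M)) := by
  classical
  by_cases hinj : Function.Injective (fun i : Fin (N+1) => f^[(i:ℕ)] z)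
  · have hci : Function.Injective (fun i : Fin (N+1) => c (f^[(i:ℕ)] z)) := by
      intro i j hij
      exact hinj (hc i (by omega) j (by omega) hij)
    have h1 := perm_count M N _ hci 0
    have h2 := perm_count M N _ hci (Fin.last N)
    have hsub : (Finset.univ.filter (fun ψ : Equiv.Perm (Fin M) =>
        wmax f N (fun h => (ψ (c h) : ℕ)) (f z) ≠ wmax f N (fun h => (ψ (c h) : ℕ)) z)) ⊆
        (Finset.univ.filter (fun ψ : Equiv.Perm (Fin M) =>
          ∀ j : Fin (N+1), ψ (c (f^[(j:ℕ)] z)) ≤ ψ (c (f^[((0:Fin (N+1)):ℕ)] z)))) ∪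
        (Finset.univ.filter (fun ψ : Equiv.Perm (Fin M) =>
          ∀ j : Fin (N+1), ψ (c (f^[(j:ℕ)] z)) ≤ ψ (c (f^[((Fin.last N:Fin (N+1)):ℕ)] z)))) := by
      intro ψ hψ
      simp only [Finset.mem_union, Finset.mem_filter, Finset.mem_univ, true_and] at hψ ⊢
      obtain ⟨m, hm⟩ := Finite.exists_max (fun i : Fin (N+1) => ψ (c (f^[(i:ℕ)] z)))
      by_cases hm0 : m = 0
      · left; rw [← hm0]; exact hm
      by_cases hmN : m = Fin.last N
      · right; rw [← hmN]; exact hm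
      exfalso
      apply hψ
      apply wmax_eq_of_mem f N _ z m
      · exact Nat.pos_of_ne_zero (fun h => hm0 (Fin.ext h))
      · have : (m:ℕ) ≠ N := fun h => hmN (Fin.ext h)
        omega
      · intro i hi
        exact hm ⟨i, by omega⟩
    have h3 := (Finset.card_le_card hsub).trans (Finset.card_union_le _ _)
    nlinarith
  · have : ∃ p, 0 < p ∧ p ≤ N ∧ f^[p] z = z := by
      simp only [Function.Injective, not_forall] at hinj
      obtain ⟨i, j, hij, hne⟩ := hinj
      have hne' : (i:ℕ) ≠ j := fun h => hne (Fin.ext h)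
      have aux : ∀ i j : ℕ, i < j → j ≤ N → f^[i] z = f^[j] z → ∃ p, 0 < p ∧ p ≤ N ∧ f^[p] z = z := by
        intro i j hlt hj h
        refine ⟨j - i, by omega, by omega, ?_⟩
        have e : j = i + (j - i) := by omega
        rw [e, Function.iterate_add_apply] at h
        exact (hf.iterate i h).symm
      rcases lt_or_gt_of_ne hne' with h | h
      · exact aux i j h (by omega) hij
      · exact aux j i h (by omega) hij.symm
    obtain ⟨p, h0, hp, hper⟩ := this
    rw [Finset.filter_false_of_mem]
    · simp
    · intro ψ _ h
      exact h (wmax_eq_of_period f N _ z p h0 hp hper)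

lemma measurable_wmax [MeasurableSpace H] (f : H → H) (hf : Measurable f) (N : ℕ) (v : H → ℕ)
    (hv : Measurable v) : Measurable (wmax f N v) := by
  unfold wmax
  induction N with
  | zero => simp
  | succ N ih =>
    simp only [Finset.range_add_one, Finset.sup_insert]
    exact (hv.comp (hf.iterate N)).sup ih

end dihedral

lemma alternate_free {H : Type*} [MeasurableSpace H] [StandardBorelSpace H]
    (ν : Measure H) [IsFiniteMeasure ν] (σ ι : H → H)
    (hσ : Function.Involutive σ) (hι : Function.Involutive ι)
    (hσf : ∀ h, σ h ≠ h) (hιf : ∀ h, ι h ≠ h) (mσ : Measurable σ) (mι : Measurable ι)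
    (δ : ℝ≥0∞) (hδ : 0 < δ) :
    ∃ O : Set H, MeasurableSet O ∧ ν {h | h ∈ O ↔ ι h ∈ O} ≤ δ ∧ ν {h | h ∈ O ↔ σ h ∈ O} ≤ δ := by
  classical
  have hδ2 : 0 < δ / 2 := ENNReal.half_pos hδ.ne'
  obtain ⟨N, hN⟩ : ∃ N : ℕ, 4 * ν Set.univ ≤ δ / 2 * (N + 1) := by
    obtain ⟨N, hN⟩ := ENNReal.exists_nat_mul_gt hδ2.ne'
      (ENNReal.mul_ne_top (by norm_num : (4:ℝ≥0∞) ≠ ⊤) (measure_ne_top ν Set.univ))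
    refine ⟨N, hN.le.trans ?_⟩
    rw [mul_comm]
    gcongr
    exact le_self_add
  -- enlarge to ensure positivity
  obtain ⟨N, hN, hNpos⟩ : ∃ N : ℕ, 4 * ν Set.univ ≤ δ / 2 * (N + 1) ∧ 0 < N := by
    refine ⟨N + 1, hN.trans ?_, Nat.succ_pos _⟩
    gcongr
    push_cast
    exact le_self_add
  set T : H → H := σ ∘ ι with hT
  have mT : Measurable T := mσ.comp mι
  have hTi : Function.Injective T := hσ.injective.comp hι.injective
  let base : Fin 3 → H → H := ![id, ι, ι ∘ σ]
  have mbase : ∀ a, Measurable (base a) := by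
    intro a
    fin_cases a
    · exact measurable_id
    · exact mι
    · exact mι.comp mσ
  obtain ⟨M, c, mc, hc⟩ := exists_coloring ν (fun (p : Fin 3 × Fin (N+1)) => T^[(p.2:ℕ)] ∘ base p.1)
    (fun p => (mT.iterate _).comp (mbase _)) (δ/2) hδ2
  set B : Set H := {h | ∃ a b : Fin 3 × Fin (N+1), (T^[(a.2:ℕ)] ∘ base a.1) h ≠ (T^[(b.2:ℕ)] ∘ base b.1) h ∧
    c ((T^[(a.2:ℕ)] ∘ base a.1) h) = c ((T^[(b.2:ℕ)] ∘ base b.1) h)} with hB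
  have hG : ∀ h, h ∉ B → ∀ a b : Fin 3, ∀ i ≤ N, ∀ j ≤ N, c (T^[i] (base a h)) = c (T^[j] (base b h)) →
      T^[i] (base a h) = T^[j] (base b h) := by
    intro h hh a b i hi j hj he
    by_contra hne
    exact hh ⟨(a, ⟨i, by omega⟩), (b, ⟨j, by omega⟩), hne, he⟩
  let v : Equiv.Perm (Fin M) → H → ℕ := fun ψ h => (ψ (c h) : ℕ)
  have mv : ∀ ψ, Measurable (v ψ) := fun ψ => (measurable_of_finite (fun x => (ψ x : ℕ))).comp mc
  let e : Equiv.Perm (Fin M) → H → ℕ := fun ψ => wmax T N (v ψ)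
  have me : ∀ ψ, Measurable (e ψ) := fun ψ => measurable_wmax T mT N _ (mv ψ)
  let Z : Equiv.Perm (Fin M) → Set H := fun ψ => {z | e ψ (T z) ≠ e ψ z}
  have mZ : ∀ ψ, MeasurableSet (Z ψ) := fun ψ => (measurableSet_eq_fun ((me ψ).comp mT) (me ψ)).compl
  let Y : Equiv.Perm (Fin M) → Set H := fun ψ => (ι ⁻¹' Z ψ ∪ (ι ∘ σ) ⁻¹' Z ψ)
  have mY : ∀ ψ, MeasurableSet (Y ψ) := fun ψ => (mι (mZ ψ)).union ((mι.comp mσ) (mZ ψ))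
  have mB : MeasurableSet B := by
    simp only [hB, Set.ofPred_exists]
    refine MeasurableSet.iUnion fun a => MeasurableSet.iUnion fun b => ?_
    refine MeasurableSet.inter (measurableSet_eq_fun ((mT.iterate _).comp (mbase _)) ((mT.iterate _).comp (mbase _))).compl ?_
    exact measurableSet_eq_fun (mc.comp ((mT.iterate _).comp (mbase _))) (mc.comp ((mT.iterate _).comp (mbase _)))
  -- pointwise count
  have hcount : ∀ h, (N+1) * (Finset.univ.filter (fun ψ => h ∈ Y ψ \ B)).card ≤
      4 * Fintype.card (Equiv.Perm (Fin M)) := by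
    intro h
    by_cases hh : h ∈ B
    · simp [hh]
    have h1 := wmax_count T hTi N c (ι h) (fun i hi j hj => hG h hh 1 1 i hi j hj)
    have h2 := wmax_count T hTi N c (ι (σ h)) (fun i hi j hj => hG h hh 2 2 i hi j hj)
    have hsub : (Finset.univ.filter (fun ψ => h ∈ Y ψ \ B)) ⊆
      (Finset.univ.filter (fun ψ : Equiv.Perm (Fin M) =>
        wmax T N (fun h => (ψ (c h) : ℕ)) (T (ι h)) ≠ wmax T N (fun h => (ψ (c h) : ℕ)) (ι h))) ∪
      (Finset.univ.filter (fun ψ : Equiv.Perm (Fin M) =>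
        wmax T N (fun h => (ψ (c h) : ℕ)) (T (ι (σ h))) ≠ wmax T N (fun h => (ψ (c h) : ℕ)) (ι (σ h)))) := by
      intro ψ hψ
      simp only [Finset.mem_union, Finset.mem_filter, Finset.mem_univ, true_and] at hψ ⊢
      exact hψ.1
    have h3 := (Finset.card_le_card hsub).trans (Finset.card_union_le _ _)
    nlinarith
  have hsum : (N+1 : ℝ≥0∞) * ∑ ψ, ν (Y ψ \ B) ≤ 4 * Fintype.card (Equiv.Perm (Fin M)) * ν Set.univ := by
    have : ∑ ψ, ν (Y ψ \ B) = ∫⁻ h, ((Finset.univ.filter (fun ψ => h ∈ Y ψ \ B)).card : ℝ≥0∞) ∂ν := by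
      have e1 : ∀ h, ((Finset.univ.filter (fun ψ => h ∈ Y ψ \ B)).card : ℝ≥0∞) =
          ∑ ψ, (Y ψ \ B).indicator 1 h := by
        intro h
        rw [Finset.card_filter]
        push_cast
        refine Finset.sum_congr rfl fun ψ _ => ?_
        simp [Set.indicator_apply]
      simp_rw [e1]
      rw [lintegral_finsetSum]
      · refine Finset.sum_congr rfl fun ψ _ => ?_
        rw [lintegral_indicator_one ((mY ψ).diff mB)]
      · intro ψ _
        exact measurable_one.indicator ((mY ψ).diff mB)
    rw [this, ← lintegral_const_mul' _ _ (by finiteness), ← lintegral_const]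
    refine lintegral_mono fun h => ?_
    have := hcount h
    have h' : (((N+1 : ℕ) * (Finset.univ.filter (fun ψ => h ∈ Y ψ \ B)).card : ℕ) : ℝ≥0∞) ≤
      ((4 * Fintype.card (Equiv.Perm (Fin M)) : ℕ) : ℝ≥0∞) := Nat.cast_le.2 this
    simpa only [Nat.cast_mul, Nat.cast_add, Nat.cast_one, Nat.cast_ofNat] using h'
  obtain ⟨ψ, hψ⟩ : ∃ ψ, ν (Y ψ \ B) ≤ δ / 2 := by
    by_contra hcon
    push Not at hcon
    have h1 : ∑ _ψ : Equiv.Perm (Fin M), δ / 2 < ∑ ψ, ν (Y ψ \ B) :=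
      ENNReal.sum_lt_sum_of_nonempty Finset.univ_nonempty (fun ψ _ => hcon ψ)
    rw [Finset.sum_const, nsmul_eq_mul, Finset.card_univ] at h1
    have h2 : (N+1 : ℝ≥0∞) * (Fintype.card (Equiv.Perm (Fin M)) * (δ/2)) < (N+1 : ℝ≥0∞) * ∑ ψ, ν (Y ψ \ B) :=
      ENNReal.mul_lt_mul_right (by positivity) (by finiteness) h1
    have h3 := h2.trans_le hsum
    have h4 : 4 * (Fintype.card (Equiv.Perm (Fin M)) : ℝ≥0∞) * ν Set.univ ≤
        (N+1 : ℝ≥0∞) * (Fintype.card (Equiv.Perm (Fin M)) * (δ/2)) := by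
      calc 4 * (Fintype.card (Equiv.Perm (Fin M)) : ℝ≥0∞) * ν Set.univ
          = (Fintype.card (Equiv.Perm (Fin M)) : ℝ≥0∞) * (4 * ν Set.univ) := by ring
        _ ≤ (Fintype.card (Equiv.Perm (Fin M)) : ℝ≥0∞) * (δ / 2 * (N + 1)) := by gcongr
        _ = _ := by ring
    exact absurd h3 (not_lt.2 h4)
  have hne : ∀ h, h ∉ B → e ψ h ≠ e ψ (ι h) := by
    intro h hh heq
    have hr : (Finset.range N).Nonempty := Finset.nonempty_range_iff.2 hNpos.ne'
    obtain ⟨i, hi, hi'⟩ := Finset.exists_mem_eq_sup (Finset.range N) hr (fun j => v ψ (T^[j] h))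
    obtain ⟨j, hj, hj'⟩ := Finset.exists_mem_eq_sup (Finset.range N) hr (fun j => v ψ (T^[j] (ι h)))
    simp only [e, wmax] at heq
    rw [hi', hj'] at heq
    have h1 : c (T^[i] h) = c (T^[j] (ι h)) := ψ.injective (Fin.ext heq)
    exact no_meet hσ hι hσf hιf j i h
      (hG h hh 0 1 i (Finset.mem_range.1 hi).le j (Finset.mem_range.1 hj).le h1)
  refine ⟨{h | e ψ (ι h) < e ψ h}, measurableSet_lt ((me ψ).comp mι) (me ψ), ?_, ?_⟩
  · refine (measure_mono ?_).trans (hc.trans ENNReal.half_le_self)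
    intro h hh
    by_contra hB'
    have h1 := hne h hB'
    simp only [Set.mem_ofPred_eq, hι h] at hh
    omega
  · have : {h | h ∈ {h | e ψ (ι h) < e ψ h} ↔ σ h ∈ {h | e ψ (ι h) < e ψ h}} ⊆ B ∪ (Y ψ \ B) := by
      intro h hh
      by_contra hB'
      simp only [Set.mem_union, Set.mem_sdiff, not_or, not_and, not_not] at hB'
      have h1 := hne h hB'.1
      have h2 : h ∉ Y ψ := fun hy => hB'.1 (hB'.2 hy)
      simp only [Y, Z, Set.mem_union, Set.mem_preimage, Set.mem_ofPred_eq, not_or, not_not, T,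
        Function.comp_apply, hι _, hσ _] at h2
      simp only [Set.mem_ofPred_eq] at hh
      omega
    refine (measure_mono this).trans ((measure_union_le _ _).trans ?_)
    calc ν B + ν (Y ψ \ B) ≤ δ / 2 + δ / 2 := add_le_add hc hψ
      _ = δ := ENNReal.add_halves δ

lemma alternate {H : Type*} [MeasurableSpace H] [StandardBorelSpace H]
    (ν : Measure H) [IsFiniteMeasure ν] (σ ι : H → H)
    (hσ : Function.Involutive σ) (hι : Function.Involutive ι)
    (mσ : Measurable σ) (mι : Measurable ι)
    (δ : ℝ≥0∞) (hδ : 0 < δ) :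
    ∃ O : Set H, MeasurableSet O ∧ ν {h | ι h ≠ h ∧ (h ∈ O ↔ ι h ∈ O)} ≤ δ ∧
      ν {h | σ h ≠ h ∧ (h ∈ O ↔ σ h ∈ O)} ≤ δ := by
  classical
  let ext : (H → H) → (H × Bool → H × Bool) := fun f p => if f p.1 = p.1 then (p.1, !p.2) else (f p.1, p.2)
  have hinv : ∀ f, Function.Involutive f → Function.Involutive (ext f) := by
    intro f hf p
    by_cases h : f p.1 = p.1
    · simp [ext, h]
    · have h' : f (f p.1) ≠ f p.1 := fun h' => h (hf.injective h')
      simp only [ext, h, if_false, h']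
      simp [hf p.1]
  have hfree : ∀ f, ∀ p, ext f p ≠ p := by
    intro f p h
    by_cases h' : f p.1 = p.1
    · have := congrArg Prod.snd h
      simp [ext, h'] at this
    · have := congrArg Prod.fst h
      simp [ext, h'] at this
  have hm : ∀ f, Measurable f → Measurable (ext f) := by
    intro f hf
    refine Measurable.ite (measurableSet_eq_fun (hf.comp measurable_fst) measurable_fst) ?_ ?_
    · exact measurable_fst.prodMk ((measurable_of_finite not).comp measurable_snd)
    · exact (hf.comp measurable_fst).prodMk measurable_snd
  have mi : Measurable (fun h : H => (h, false)) := measurable_id.prodMk measurable_const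
  obtain ⟨O, mO, h1, h2⟩ := alternate_free (ν.map (fun h => (h, false))) (ext σ) (ext ι)
    (hinv σ hσ) (hinv ι hι) (hfree σ) (hfree ι) (hm σ mσ) (hm ι mι) δ hδ
  refine ⟨(fun h => (h, false)) ⁻¹' O, mi mO, ?_, ?_⟩
  · refine le_trans ?_ h1
    refine le_trans (measure_mono ?_) (Measure.le_map_apply mi.aemeasurable _)
    rintro h ⟨ha, hb⟩
    simpa [ext, ha] using hb
  · refine le_trans ?_ h2
    refine le_trans (measure_mono ?_) (Measure.le_map_apply mi.aemeasurable _)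
    rintro h ⟨ha, hb⟩
    simpa [ext, ha] using hb

end SchreierAux

namespace SchreierAux

lemma exists_pairing_aux {m : ℕ} (k : ℕ) : ∀ S : Finset (Fin m), S.card = 2 * k → ∃ τ : Fin m → Fin m,
    Function.Involutive τ ∧ (∀ j ∈ S, τ j ≠ j) ∧ (∀ j ∉ S, τ j = j) := by
  classical
  induction k with
  | zero =>
    intro S hS
    have : S = ∅ := by simpa using hS
    subst this
    exact ⟨id, fun _ => rfl, by simp, by simp⟩
  | succ k ih =>
    intro S hS
    have h1 : 1 < S.card := by omega
    obtain ⟨a, ha, b, hb, hab⟩ := Finset.one_lt_card.1 h1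
    have hb' : b ∈ S.erase a := Finset.mem_erase.2 ⟨hab.symm, hb⟩
    have hc : ((S.erase a).erase b).card = 2 * k := by
      rw [Finset.card_erase_of_mem hb', Finset.card_erase_of_mem ha]; omega
    obtain ⟨τ, t1, t2, t3⟩ := ih _ hc
    have ta : τ a = a := t3 a (by simp)
    have tb : τ b = b := t3 b (by simp)
    have t1' : ∀ x, τ (τ x) = x := t1
    refine ⟨fun j => if j = a then b else if j = b then a else τ j, ?_, ?_, ?_⟩
    · intro j
      have := t1' j
      grind
    · intro j hj
      have := t2 j
      simp only [Finset.mem_erase] at this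
      grind
    · intro j hj
      have := t3 j
      simp only [Finset.mem_erase] at this
      grind

lemma exists_pairing {m : ℕ} (S : Finset (Fin m)) : ∃ τ : Fin m → Fin m,
    Function.Involutive τ ∧ (Even S.card → ∀ j ∈ S, τ j ≠ j) ∧ (∀ j ∉ S, τ j = j) := by
  by_cases h : Even S.card
  · obtain ⟨k, hk⟩ := h
    obtain ⟨τ, h1, h2, h3⟩ := exists_pairing_aux k S (by omega)
    exact ⟨τ, h1, fun _ => h2, h3⟩
  · exact ⟨id, fun _ => rfl, fun h' => absurd h' h, fun _ _ => rfl⟩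

/-- chosen pairing -/
noncomputable def pairing {m : ℕ} (S : Finset (Fin m)) : Fin m → Fin m := (exists_pairing S).choose

lemma pairing_inv {m : ℕ} (S : Finset (Fin m)) : Function.Involutive (pairing S) :=
  (exists_pairing S).choose_spec.1
lemma pairing_ne {m : ℕ} (S : Finset (Fin m)) (h : Even S.card) : ∀ j ∈ S, pairing S j ≠ j :=
  (exists_pairing S).choose_spec.2.1 h
lemma pairing_out {m : ℕ} (S : Finset (Fin m)) : ∀ j ∉ S, pairing S j = j :=
  (exists_pairing S).choose_spec.2.2

open Classical in
lemma half_card {m : ℕ} (S : Finset (Fin m)) (hS : Even S.card) (O : Fin m → Prop)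
    (hO : ∀ j, pairing S j ≠ j → ¬ (O j ↔ O (pairing S j))) :
    2 * (S.filter O).card = S.card := by
  have hmem : ∀ j ∈ S, pairing S j ∈ S := by
    intro j hj
    by_contra h
    have h1 := pairing_out S _ h
    rw [pairing_inv S] at h1
    exact pairing_ne S hS j hj h1.symm
  have e : (S.filter O).card = (S.filter (fun j => ¬ O j)).card := by
    refine Finset.card_nbij' (pairing S) (pairing S) ?_ ?_ ?_ ?_
    · intro j hj
      simp only [Finset.coe_filter, Set.mem_ofPred_eq] at hj ⊢
      have := hO j (pairing_ne S hS j hj.1)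
      exact ⟨hmem j hj.1, by tauto⟩
    · intro j hj
      simp only [Finset.coe_filter, Set.mem_ofPred_eq] at hj ⊢
      have := hO j (pairing_ne S hS j hj.1)
      exact ⟨hmem j hj.1, by tauto⟩
    · intro j _; exact pairing_inv S j
    · intro j _; exact pairing_inv S j
  have := Finset.card_filter_add_card_filter_not (s := S) O
  omega

open Classical in
lemma half_sum {m : ℕ} (a : Fin m → ℕ) (O : Fin m → Prop) (S : Finset (Fin m))
    (hS' : ∀ j, j ∈ S ↔ Odd (a j))
    (hO : ∀ j, pairing S j ≠ j → ¬ (O j ↔ O (pairing S j)))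
    (q : ℕ) (hq : ∑ j, a j = 2 * q) :
    ∑ j, (a j / 2 + if Odd (a j) ∧ O j then 1 else 0) = q := by
  have hS : S = Finset.univ.filter (fun j => Odd (a j)) := by ext j; simp [hS']
  have e1 : ∑ j, a j = 2 * ∑ j, a j / 2 + S.card := by
    rw [hS, Finset.card_filter, Finset.mul_sum, ← Finset.sum_add_distrib]
    refine Finset.sum_congr rfl fun j _ => ?_
    split_ifs with h
    · have := Nat.odd_iff.1 h; omega
    · have := Nat.not_odd_iff.1 h; omega
  have hev : Even S.card := by
    rw [Nat.even_iff]; omega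
  have h2 := half_card S hev O hO
  rw [Finset.sum_add_distrib]
  have e2 : ∑ j, (if Odd (a j) ∧ O j then 1 else 0) = (S.filter O).card := by
    rw [← Finset.card_filter, hS, Finset.filter_filter]
  rw [e2]
  omega

section
variable {X : Type*} [MeasurableSpace X] {m : ℕ}

lemma proj_bound (ν : Measure X) [IsFiniteMeasure ν] (B : Set (X × Fin m)) :
    ν {x | ∃ j, (x, j) ∈ B} ≤ (ν.prod Measure.count) B := by
  rw [← measure_toMeasurable B]
  set B' := toMeasurable (ν.prod Measure.count) B
  have hB' : MeasurableSet B' := measurableSet_toMeasurable _ _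
  rw [Measure.prod_apply_symm hB', lintegral_count, tsum_fintype]
  refine le_trans (measure_mono ?_) (measure_iUnion_fintype_le ν (fun j : Fin m => (fun x => (x, j)) ⁻¹' B'))
  rintro x ⟨j, hj⟩
  exact Set.mem_iUnion.2 ⟨j, subset_toMeasurable _ _ hj⟩

/-- measure on half-edges -/
noncomputable def hm (ν : Measure X) (ι : X × Fin m → X × Fin m) : Measure (X × Fin m) :=
  ν.prod Measure.count + (ν.prod Measure.count).map ι

instance (ν : Measure X) [IsFiniteMeasure ν] (ι : X × Fin m → X × Fin m) : IsFiniteMeasure (hm ν ι) := by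
  unfold hm; infer_instance

lemma hm_bound1 (ν : Measure X) [IsFiniteMeasure ν] (ι : X × Fin m → X × Fin m) (B : Set (X × Fin m)) :
    ν {x | ∃ j, (x, j) ∈ B} ≤ hm ν ι B := by
  refine (proj_bound ν B).trans ?_
  simp only [hm, Measure.add_apply]
  exact le_self_add

lemma hm_bound2 (ν : Measure X) [IsFiniteMeasure ν] (ι : X × Fin m → X × Fin m) (mι : Measurable ι)
    (B : Set (X × Fin m)) :
    ν {x | ∃ j, ι (x, j) ∈ B} ≤ hm ν ι B := by
  refine (proj_bound ν (ι ⁻¹' B)).trans ?_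
  simp only [hm, Measure.add_apply]
  exact (Measure.le_map_apply mι.aemeasurable _).trans le_add_self

open Classical in
lemma measurable_section (D : Set (X × Fin m)) (hD : MeasurableSet D) (F : Finset (Fin m)) :
    MeasurableSet {x | Finset.univ.filter (fun j => (x, j) ∈ D) = F} := by
  have : {x | Finset.univ.filter (fun j => (x, j) ∈ D) = F} = ⋂ j, {x | (x, j) ∈ D ↔ j ∈ F} := by
    ext x
    simp [Finset.ext_iff]
  rw [this]
  refine MeasurableSet.iInter fun j => ?_
  have hj : MeasurableSet {x | (x, j) ∈ D} := (measurable_id.prodMk measurable_const) hD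
  by_cases h : j ∈ F
  · simpa [h] using hj
  · have e : {x | (x, j) ∈ D ↔ j ∈ F} = {x | (x, j) ∈ D}ᶜ := by ext x; simp [h]
    rw [e]; exact hj.compl

open Classical in
lemma measurable_pairing (D : Set (X × Fin m)) (hD : MeasurableSet D) :
    Measurable (fun p : X × Fin m => (p.1, pairing (Finset.univ.filter (fun j => (p.1, j) ∈ D)) p.2)) := by
  refine measurable_fst.prodMk ?_
  refine measurable_from_prod_countable_left fun j => ?_
  let _ : MeasurableSpace (Finset (Fin m)) := ⊤
  have h1 : Measurable (fun x => Finset.univ.filter (fun j => (x, j) ∈ D)) :=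
    measurable_to_countable' (fun F => measurable_section D hD F)
  have h2 : Measurable (fun F : Finset (Fin m) => pairing F j) := measurable_from_top
  exact h2.comp h1

variable [StandardBorelSpace X]

open Classical in
lemma halve (ν : Measure X) [IsFiniteMeasure ν] (ι : X × Fin m → X × Fin m)
    (hι : Function.Involutive ι) (mι : Measurable ι) (κ : Measure (X × Fin m))
    (w : X × Fin m → ℕ) (mw : Measurable w) (δ : ℝ≥0∞) (hδ : 0 < δ) :
    ∃ w' : X × Fin m → ℕ, Measurable w' ∧ (∀ h, w' h ≤ w h) ∧
      ν {x | ∃ q, ∑ j, w (x, j) = 2 * q ∧ ∑ j, w' (x, j) ≠ q} ≤ δ ∧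
      ν {x | ∃ q, ∑ j, w (ι (x, j)) = 2 * q ∧ ∑ j, w' (ι (x, j)) ≠ q} ≤ δ ∧
      2 * ∫⁻ h, w' h ∂κ ≤ ∫⁻ h, w h ∂κ := by
  obtain ⟨D, hDdef⟩ : ∃ D : Set (X × Fin m), D = {h | Odd (w h)} := ⟨_, rfl⟩
  have mD : MeasurableSet D := hDdef ▸ mw (MeasurableSet.of_discrete (s := {k : ℕ | Odd k}))
  let P : Set (X × Fin m) → X × Fin m → X × Fin m :=
    fun D p => (p.1, pairing (Finset.univ.filter (fun j => (p.1, j) ∈ D)) p.2)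
  have hP : ∀ D, Function.Involutive (P D) := fun D p => by
    simp only [P, pairing_inv _ _]
  have mP : ∀ D, MeasurableSet D → Measurable (P D) := fun D hD => measurable_pairing D hD
  have hR : Function.Involutive (ι ∘ P (ι ⁻¹' D) ∘ ι) := fun p => by
    simp only [Function.comp_apply, hι _, hP _ _]
  obtain ⟨O, mO, h2, h1⟩ := alternate (hm ν ι) (P D) (ι ∘ P (ι ⁻¹' D) ∘ ι) (hP D) hR (mP D mD)
    (mι.comp ((mP _ (mι mD)).comp mι)) δ hδ
  let W : Set (X × Fin m) → X × Fin m → ℕ := fun O h => w h / 2 + if Odd (w h) ∧ h ∈ O then 1 else 0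
  have mW : ∀ O, MeasurableSet O → Measurable (W O) := by
    intro O mO
    refine Measurable.add ((measurable_of_countable (fun k : ℕ => k / 2)).comp mw) ?_
    subst hDdef
    exact Measurable.ite (mD.inter mO) measurable_const measurable_const
  have hWle : ∀ O h, W O h ≤ w h := by
    intro O h
    simp only [W]
    split_ifs with hh
    · have := Nat.odd_iff.1 hh.1; omega
    · omega
  have hWadd : ∀ h, W O h + W Oᶜ h = w h := by
    intro h
    simp only [W, Set.mem_compl_iff]
    rcases Nat.even_or_odd (w h) with he | ho
    · have h' : ¬ Odd (w h) := Nat.not_odd_iff_even.2 he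
      have := Nat.even_iff.1 he
      simp only [h', false_and, if_false]; omega
    · have := Nat.odd_iff.1 ho
      by_cases hO : h ∈ O <;> simp [ho, hO] <;> omega
  -- generic good statement
  have key : ∀ O' : Set (X × Fin m), (∀ a b, (a ∈ O' ↔ b ∈ O') ↔ (a ∈ O ↔ b ∈ O)) →
      ν {x | ∃ q, ∑ j, w (x, j) = 2 * q ∧ ∑ j, W O' (x, j) ≠ q} ≤ δ ∧
      ν {x | ∃ q, ∑ j, w (ι (x, j)) = 2 * q ∧ ∑ j, W O' (ι (x, j)) ≠ q} ≤ δ := by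
    intro O' hO'
    constructor
    · refine le_trans (measure_mono ?_) ((hm_bound1 ν ι _).trans h1)
      rintro x ⟨q, hq, hne⟩
      by_contra hcon
      apply hne
      refine half_sum (fun j => w (x, j)) (fun j => (x, j) ∈ O')
        (Finset.univ.filter (fun j => (x, j) ∈ D)) (fun j => by simp [hDdef]) ?_ q hq
      intro j hj hiff
      refine hcon ⟨j, ?_, (hO' _ _).1 hiff⟩
      intro h
      exact hj (congrArg Prod.snd h)
    · refine le_trans (measure_mono ?_) ((hm_bound2 ν ι mι _).trans h2)
      rintro x ⟨q, hq, hne⟩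
      by_contra hcon
      apply hne
      refine half_sum (fun j => w (ι (x, j))) (fun j => ι (x, j) ∈ O')
        (Finset.univ.filter (fun j => (x, j) ∈ ι ⁻¹' D)) (fun j => by simp [hDdef]) ?_ q hq
      intro j hj hiff
      refine hcon ⟨j, ?_, ?_⟩
      · simp only [Function.comp_apply, hι _]
        intro h
        exact hj (congrArg Prod.snd (hι.injective h))
      · simp only [Function.comp_apply, hι _]
        exact (hO' _ _).1 hiff
  have hint : ∫⁻ h, W O h ∂κ + ∫⁻ h, W Oᶜ h ∂κ = ∫⁻ h, w h ∂κ := by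
    rw [← lintegral_add_left]
    · refine lintegral_congr fun h => ?_
      rw [← hWadd h]; push_cast; rfl
    · exact (measurable_of_countable (fun k : ℕ => (k : ℝ≥0∞))).comp (mW O mO)
  rcases le_total (∫⁻ h, (W O h : ℝ≥0∞) ∂κ) (∫⁻ h, (W Oᶜ h : ℝ≥0∞) ∂κ) with hle | hle
  · refine ⟨W O, mW O mO, hWle O, (key O (fun a b => Iff.rfl)).1, (key O (fun a b => Iff.rfl)).2, ?_⟩
    rw [two_mul, ← hint]; gcongr
  · have hc : ∀ a b, (a ∈ Oᶜ ↔ b ∈ Oᶜ) ↔ (a ∈ O ↔ b ∈ O) := fun a b => by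
      simp only [Set.mem_compl_iff]; tauto
    refine ⟨W Oᶜ, mW _ mO.compl, hWle _, (key _ hc).1, (key _ hc).2, ?_⟩
    rw [two_mul, ← hint]; gcongr

lemma sum_one_unique (a : Fin m → ℕ) (h : ∑ j, a j = 1) : ∃! j, a j ≠ 0 := by
  obtain ⟨j, hj⟩ : ∃ j, a j ≠ 0 := by
    by_contra hc
    push Not at hc
    simp [hc] at h
  refine ⟨j, hj, fun i hi => ?_⟩
  by_contra hne
  have h2 : ∑ k ∈ {i, j}, a k ≤ ∑ k, a k := Finset.sum_le_sum_of_subset (Finset.subset_univ _)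
  rw [Finset.sum_pair hne] at h2
  simp only [ne_eq] at hi hj
  omega

lemma round (ν : Measure X) [IsFiniteMeasure ν] (ι : X × Fin m → X × Fin m)
    (hι : Function.Involutive ι) (mι : Measurable ι) (κ : Measure (X × Fin m)) (T : ℕ) :
    ∀ (w : X × Fin m → ℕ) (_ : Measurable w) (δ : ℝ≥0∞) (_ : 0 < δ),
    ∃ M : Set (X × Fin m), MeasurableSet M ∧ (∀ h ∈ M, w h ≠ 0) ∧
      ν {x | ∑ j, w (x, j) = 2 ^ T ∧ ¬ ∃! j, (x, j) ∈ M} ≤ δ ∧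
      ν {x | ∑ j, w (ι (x, j)) = 2 ^ T ∧ ¬ ∃! j, ι (x, j) ∈ M} ≤ δ ∧
      2 ^ T * κ M ≤ ∫⁻ h, w h ∂κ := by
  induction T with
  | zero =>
    intro w mw δ hδ
    have mM : MeasurableSet {h | w h ≠ 0} := mw (MeasurableSet.of_discrete (s := {k : ℕ | k ≠ 0}))
    refine ⟨{h | w h ≠ 0}, mM, fun h hh => hh, ?_, ?_, ?_⟩
    · rw [show {x | ∑ j, w (x, j) = 2 ^ 0 ∧ ¬ ∃! j, (x, j) ∈ {h | w h ≠ 0}} = ∅ from ?_]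
      · simp
      · ext x
        simp only [Set.mem_ofPred_eq, Set.mem_empty_iff_false, iff_false, not_and, not_not, pow_zero]
        exact fun h => sum_one_unique _ h
    · rw [show {x | ∑ j, w (ι (x, j)) = 2 ^ 0 ∧ ¬ ∃! j, ι (x, j) ∈ {h | w h ≠ 0}} = ∅ from ?_]
      · simp
      · ext x
        simp only [Set.mem_ofPred_eq, Set.mem_empty_iff_false, iff_false, not_and, not_not, pow_zero]
        exact fun h => sum_one_unique _ h
    · rw [pow_zero, one_mul, ← lintegral_indicator_one mM]
      refine lintegral_mono fun h => ?_
      simp only [Set.indicator_apply, Set.mem_ofPred_eq]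
      split_ifs with hh
      · simp only [Pi.one_apply]
        exact_mod_cast Nat.one_le_iff_ne_zero.2 hh
      · simp
  | succ T ih =>
    intro w mw δ hδ
    have hδ2 : 0 < δ / 2 := ENNReal.half_pos hδ.ne'
    obtain ⟨w', mw', hle, a1, a2, a3⟩ := halve ν ι hι mι κ w mw (δ/2) hδ2
    obtain ⟨M, mM, b0, b1, b2, b3⟩ := ih w' mw' (δ/2) hδ2
    refine ⟨M, mM, fun h hh h0 => b0 h hh (Nat.le_zero.1 (h0 ▸ hle h)), ?_, ?_, ?_⟩
    · rw [← ENNReal.add_halves δ]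
      refine le_trans (measure_mono ?_) ((measure_union_le _ _).trans (add_le_add a1 b1))
      rintro x ⟨h1, h2⟩
      by_cases h : ∑ j, w' (x, j) = 2 ^ T
      · exact Or.inr ⟨h, h2⟩
      · exact Or.inl ⟨2 ^ T, by rw [h1]; ring, h⟩
    · rw [← ENNReal.add_halves δ]
      refine le_trans (measure_mono ?_) ((measure_union_le _ _).trans (add_le_add a2 b2))
      rintro x ⟨h1, h2⟩
      by_cases h : ∑ j, w' (ι (x, j)) = 2 ^ T
      · exact Or.inr ⟨h, h2⟩
      · exact Or.inl ⟨2 ^ T, by rw [h1]; ring, h⟩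
    · calc 2 ^ (T+1) * κ M = 2 * (2 ^ T * κ M) := by ring
        _ ≤ 2 * ∫⁻ h, w' h ∂κ := by gcongr
        _ ≤ _ := a3

end
end SchreierAux

namespace SchreierAux
section
variable {X : Type*} [MeasurableSpace X] [StandardBorelSpace X] {m : ℕ}

open Classical in
lemma matching (ν : Measure X) [IsFiniteMeasure ν] (ι : X × Fin m → X × Fin m)
    (hι : Function.Involutive ι) (mι : Measurable ι) (D : Set (X × Fin m)) (mD : MeasurableSet D)
    (k : ℕ) (hk : 0 < k) (δ : ℝ≥0∞) (hδ : 0 < δ) :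
    ∃ M : Set (X × Fin m), MeasurableSet M ∧ M ⊆ D ∧
      ν {x | (Finset.univ.filter (fun j => (x, j) ∈ D)).card = k ∧
        (Finset.univ.filter (fun j => ι (x, j) ∈ D)).card = k ∧
        ¬ ((∃! j, (x, j) ∈ M) ∧ (∃! j, ι (x, j) ∈ M))} ≤ δ := by
  have hδ3 : 0 < δ / 3 := ENNReal.div_pos hδ.ne' (by norm_num)
  obtain ⟨T, hT⟩ : ∃ T : ℕ, k * ν Set.univ ≤ 2 ^ T * (δ / 3) := by
    obtain ⟨N, hN⟩ := ENNReal.exists_nat_mul_gt hδ3.ne'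
      (ENNReal.mul_ne_top (by simp : (k:ℝ≥0∞) ≠ ⊤) (measure_ne_top ν Set.univ))
    refine ⟨N, hN.le.trans ?_⟩
    gcongr
    exact_mod_cast (Nat.lt_two_pow_self (n := N)).le
  let q := 2 ^ T / k
  let r := 2 ^ T % k
  have hqr : r + k * q = 2 ^ T := by
    simp only [q, r]; exact Nat.mod_add_div _ _
  let E : X × Fin m → X × Fin (m+1) := fun p => (p.1, p.2.succ)
  have mE : Measurable E := measurable_fst.prodMk ((measurable_of_finite Fin.succ).comp measurable_snd)
  let ι' : X × Fin (m+1) → X × Fin (m+1) := fun p =>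
    Fin.cases (motive := fun _ => X × Fin (m+1)) (p.1, 0) (fun j => E (ι (p.1, j))) p.2
  have i0 : ∀ x, ι' (x, 0) = (x, 0) := fun x => rfl
  have i1 : ∀ x j, ι' (x, Fin.succ j) = E (ι (x, j)) := fun x j => rfl
  have hι' : Function.Involutive ι' := by
    rintro ⟨x, j⟩
    refine Fin.cases ?_ (fun j => ?_) j
    · rfl
    · rw [i1]
      have : E (ι (x, j)) = ((ι (x, j)).1, Fin.succ (ι (x, j)).2) := rfl
      rw [this, i1, Prod.mk.eta, hι]
  have mι' : Measurable ι' := by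
    refine measurable_from_prod_countable_left fun j => ?_
    refine Fin.cases ?_ (fun j => ?_) j
    · exact measurable_id.prodMk measurable_const
    · exact mE.comp (mι.comp (measurable_id.prodMk measurable_const))
  let w : X × Fin (m+1) → ℕ := fun p =>
    Fin.cases (motive := fun _ => ℕ) r (fun j => if (p.1, j) ∈ D then q else 0) p.2
  have w0 : ∀ x, w (x, 0) = r := fun x => rfl
  have w1 : ∀ h, w (E h) = if h ∈ D then q else 0 := fun h => rfl
  have mw : Measurable w := by
    refine measurable_from_prod_countable_left fun j => ?_
    refine Fin.cases ?_ (fun j => ?_) j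
    · exact measurable_const
    · exact Measurable.ite ((measurable_id.prodMk measurable_const) mD) measurable_const measurable_const
  have mi : Measurable (fun x : X => (x, (0 : Fin (m+1)))) := measurable_id.prodMk measurable_const
  obtain ⟨M, mM, b0, b1, b2, b3⟩ := round ν ι' hι' mι' (ν.map (fun x => (x, 0))) T w mw (δ/3) hδ3
  have hloop : ν {x | (x, (0 : Fin (m+1))) ∈ M} ≤ δ / 3 := by
    rw [Measure.map_apply mi mM, lintegral_map (by exact (measurable_of_countable (fun k : ℕ => (k : ℝ≥0∞))).comp mw) mi] at b3
    simp only [w0, lintegral_const] at b3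
    have h1 : (r : ℝ≥0∞) * ν Set.univ ≤ k * ν Set.univ := by
      gcongr
      exact (Nat.mod_lt _ hk).le
    have h2 := (b3.trans h1).trans hT
    exact (ENNReal.mul_le_mul_iff_right (by positivity) (by finiteness)).1 h2
  have hMD : ∀ h, E h ∈ M → h ∈ D := by
    intro h hh
    have := b0 _ hh
    rw [w1] at this
    by_contra hc
    simp [hc] at this
  refine ⟨E ⁻¹' M, mE mM, fun h hh => hMD h hh, ?_⟩
  have hd : δ = δ / 3 + δ / 3 + δ / 3 := (ENNReal.add_thirds δ).symm
  rw [hd]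
  refine le_trans (measure_mono ?_) ((measure_union_le _ _).trans
    (add_le_add ((measure_union_le _ _).trans (add_le_add b1 b2)) hloop))
  rintro x ⟨h1, h2, h3⟩
  by_contra hcon
  simp only [Set.mem_union, not_or, Set.mem_ofPred_eq, not_and, not_not] at hcon
  obtain ⟨⟨c1, c2⟩, c3⟩ := hcon
  apply h3
  have s1 : ∑ j, w (x, j) = 2 ^ T := by
    rw [Fin.sum_univ_succ, ← hqr, w0, ← h1, Finset.card_filter, Finset.sum_mul]
    congr 1
    refine Finset.sum_congr rfl fun j _ => ?_
    exact (w1 (x, j)).trans (by split_ifs <;> simp)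
  have s2 : ∑ j, w (ι' (x, j)) = 2 ^ T := by
    rw [Fin.sum_univ_succ, ← hqr, i0, w0, ← h2, Finset.card_filter, Finset.sum_mul]
    congr 1
    refine Finset.sum_congr rfl fun j _ => ?_
    rw [i1]
    exact (w1 (ι (x, j))).trans (by split_ifs <;> simp)
  constructor
  · obtain ⟨j, hj, hju⟩ := c1 s1
    revert hj hju
    refine Fin.cases (fun hj => absurd hj c3) (fun j hj hju => ⟨j, hj, fun i hi => ?_⟩) j
    exact Fin.succ_injective _ (hju (Fin.succ i) hi)
  · obtain ⟨j, hj, hju⟩ := c2 s2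
    revert hj hju
    refine Fin.cases (fun hj => absurd hj c3) (fun j hj hju => ⟨j, hj, fun i hi => ?_⟩) j
    exact Fin.succ_injective _ (hju (Fin.succ i) hi)

open Classical in
lemma card_remove {m k : ℕ} (P R : Fin m → Prop) (hsub : ∀ j, R j → P j) (hR : ∃! j, R j)
    (hP : (Finset.univ.filter P).card = k + 1) :
    (Finset.univ.filter (fun j => P j ∧ ¬ R j)).card = k := by
  obtain ⟨j, hj, hju⟩ := hR
  have : Finset.univ.filter (fun j => P j ∧ ¬ R j) = (Finset.univ.filter P).erase j := by
    ext i
    simp only [Finset.mem_filter, Finset.mem_univ, true_and, Finset.mem_erase]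
    constructor
    · rintro ⟨a, b⟩; exact ⟨fun h => b (h ▸ hj), a⟩
    · rintro ⟨a, b⟩; exact ⟨b, fun h => a (hju i h)⟩
  rw [this, Finset.card_erase_of_mem (by simpa using hsub j hj), hP]; rfl

open Classical in
lemma colors (ν : Measure X) [IsFiniteMeasure ν] (ι : X × Fin m → X × Fin m)
    (hι : Function.Involutive ι) (mι : Measurable ι) (k : ℕ) :
    ∀ (D : Set (X × Fin m)) (_ : MeasurableSet D) (δ : ℝ≥0∞) (_ : 0 < δ),
    ∃ M : Fin k → Set (X × Fin m), (∀ i, MeasurableSet (M i)) ∧ (∀ i, M i ⊆ D) ∧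
      ν {x | (Finset.univ.filter (fun j => (x, j) ∈ D)).card = k ∧
        (Finset.univ.filter (fun j => ι (x, j) ∈ D)).card = k ∧
        ¬ ((∀ i, ∃! j, (x, j) ∈ M i) ∧ (∀ i, ∃! j, ι (x, j) ∈ M i) ∧
          (∀ j, (x, j) ∈ D → ∃ i, (x, j) ∈ M i) ∧ (∀ j, ι (x, j) ∈ D → ∃ i, ι (x, j) ∈ M i))} ≤ δ := by
  induction k with
  | zero =>
    intro D mD δ hδ
    refine ⟨fun i => i.elim0, fun i => i.elim0, fun i => i.elim0, ?_⟩
    refine le_of_eq_of_le ?_ (bot_le : (⊥ : ℝ≥0∞) ≤ δ)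
    refine (congrArg ν ?_).trans (measure_empty (μ := ν))
    ext x
    simp only [Set.mem_ofPred_eq, Set.mem_empty_iff_false, iff_false]
    rintro ⟨h1, h2, h3⟩
    rw [Finset.card_eq_zero, Finset.filter_eq_empty_iff] at h1 h2
    exact h3 ⟨fun i => i.elim0, fun i => i.elim0, fun j hj => absurd hj (h1 (Finset.mem_univ j)),
      fun j hj => absurd hj (h2 (Finset.mem_univ j))⟩
  | succ k ih =>
    intro D mD δ hδ
    have hδ2 : 0 < δ / 2 := ENNReal.half_pos hδ.ne'
    obtain ⟨M, mM, hMD, h1⟩ := matching ν ι hι mι D mD (k+1) (Nat.succ_pos k) (δ/2) hδ2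
    obtain ⟨F, mF, hF, h2⟩ := ih (D \ M) (mD.diff mM) (δ/2) hδ2
    refine ⟨Fin.cons M F, ?_, ?_, ?_⟩
    · intro i; refine Fin.cases mM mF i
    · intro i; refine Fin.cases hMD (fun i => (hF i).trans Set.sdiff_subset) i
    rw [← ENNReal.add_halves δ]
    refine le_trans (measure_mono ?_) ((measure_union_le _ _).trans (add_le_add h1 h2))
    rintro x ⟨a1, a2, a3⟩
    by_contra hcon
    rw [Set.mem_union, not_or] at hcon
    obtain ⟨c1, c2⟩ := hcon
    have c1 := not_not.1 (fun h => c1 ⟨a1, a2, h⟩)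
    obtain ⟨u1, u2⟩ := c1
    have d1 := card_remove (fun j => (x, j) ∈ D) (fun j => (x, j) ∈ M) (fun j hj => hMD hj) u1 a1
    have d2 := card_remove (fun j => ι (x, j) ∈ D) (fun j => ι (x, j) ∈ M) (fun j hj => hMD hj) u2 a2
    have c := not_not.1 (fun h => c2 ⟨by convert d1; exact Iff.rfl, by convert d2; exact Iff.rfl, h⟩)
    obtain ⟨v1, v2, v3, v4⟩ := c
    apply a3
    refine ⟨fun i => ?_, fun i => ?_, fun j hj => ?_, fun j hj => ?_⟩
    · refine Fin.cases u1 v1 i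
    · refine Fin.cases u2 v2 i
    · by_cases h : (x, j) ∈ M
      · exact ⟨0, h⟩
      · obtain ⟨i, hi⟩ := v3 j ⟨hj, h⟩
        exact ⟨i.succ, hi⟩
    · by_cases h : ι (x, j) ∈ M
      · exact ⟨0, h⟩
      · obtain ⟨i, hi⟩ := v4 j ⟨hj, h⟩
        exact ⟨i.succ, hi⟩

lemma enumeration (k : ℕ) (hk : 0 < k) (Q : SimpleGraph X)
    (hQ : MeasurableSet {p : X × X | Q.Adj p.1 p.2})
    (hreg : ∀ x : X, Nat.card {y : X // Q.Adj x y} = k) :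
    ∃ f : X → Fin k → X, Measurable f ∧ (∀ x, Function.Injective (f x)) ∧
      ∀ x y, Q.Adj x y ↔ ∃ j, f x j = y := by
  classical
  obtain ⟨φ, hφ⟩ := MeasureTheory.exists_measurableEmbedding_real X
  have hfin : ∀ x, {y | Q.Adj x y}.Finite := by
    intro x
    have : Finite {y : X // Q.Adj x y} := Nat.finite_of_card_ne_zero (by rw [hreg]; omega)
    exact this
  have hnc : ∀ x, {y | Q.Adj x y}.ncard = k := fun x => hreg x
  let W : Set (X × (Fin k → X)) := {p | (∀ j, Q.Adj p.1 (p.2 j)) ∧ StrictMono (φ ∘ p.2)}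
  have hinj : ∀ p ∈ W, Function.Injective p.2 := fun p hp => hp.2.injective.of_comp
  have hrange : ∀ p ∈ W, Set.range p.2 = {y | Q.Adj p.1 y} := by
    intro p hp
    refine Set.eq_of_subset_of_ncard_le ?_ ?_ (hfin _)
    · rintro _ ⟨j, rfl⟩; exact hp.1 j
    · rw [hnc, ← Set.image_univ, Set.ncard_image_of_injective _ (hinj p hp), Set.ncard_univ]; simp
  have mW : MeasurableSet W := by
    have : W = (⋂ j, {p | Q.Adj p.1 (p.2 j)}) ∩ ⋂ i, ⋂ j, ⋂ (_ : i < j), {p | φ (p.2 i) < φ (p.2 j)} := by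
      ext p
      simp [W, StrictMono]
    rw [this]
    have mj : ∀ j : Fin k, Measurable (fun p : X × (Fin k → X) => p.2 j) :=
      fun j => (measurable_pi_apply j).comp measurable_snd
    refine MeasurableSet.inter (MeasurableSet.iInter fun j => ?_)
      (MeasurableSet.iInter fun i => MeasurableSet.iInter fun j => MeasurableSet.iInter fun _ => ?_)
    · exact (measurable_fst.prodMk (mj j)) hQ
    · exact measurableSet_lt (hφ.measurable.comp (mj i)) (hφ.measurable.comp (mj j))
  have hfst : Set.InjOn Prod.fst W := by
    rintro ⟨x, y⟩ hp ⟨x', y'⟩ hp' (rfl : x = x')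
    have e : Set.range (φ ∘ y) = Set.range (φ ∘ y') := by
      rw [Set.range_comp, Set.range_comp, hrange _ hp, hrange _ hp']
    have := (hp.2.range_inj hp'.2).1 e
    have : y = y' := funext fun j => hφ.injective (congrFun this j)
    rw [this]
  have hex : ∀ x, ∃ y : Fin k → X, (x, y) ∈ W := by
    intro x
    let s : Finset ℝ := (hfin x).toFinset.image φ
    have hs : s.card = k := by
      rw [Finset.card_image_of_injective _ hφ.injective, ← Set.ncard_eq_toFinset_card _ (hfin x), hnc]
    have hmem : ∀ j, ∃ y, Q.Adj x y ∧ φ y = s.orderEmbOfFin hs j := by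
      intro j
      have := s.orderEmbOfFin_mem hs j
      obtain ⟨y, hy, hy'⟩ := Finset.mem_image.1 this
      exact ⟨y, (hfin x).mem_toFinset.1 hy, hy'⟩
    choose y hy1 hy2 using hmem
    refine ⟨y, hy1, ?_⟩
    have : φ ∘ y = s.orderEmbOfFin hs := funext hy2
    show StrictMono (φ ∘ y)
    rw [this]
    exact (s.orderEmbOfFin hs).strictMono
  choose f hf using hex
  refine ⟨f, ?_, fun x => hinj _ (hf x), ?_⟩
  · intro B hB
    have : f ⁻¹' B = Prod.fst '' (W ∩ Prod.snd ⁻¹' B) := by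
      ext x
      constructor
      · intro hx
        exact ⟨(x, f x), ⟨hf x, hx⟩, rfl⟩
      · rintro ⟨⟨x', y⟩, ⟨h1, h2⟩, rfl⟩
        have := hfst h1 (hf x') rfl
        have e : y = f x' := congrArg Prod.snd this
        show f x' ∈ B
        rw [← e]; exact h2
    rw [this]
    exact (mW.inter (measurable_snd hB)).image_of_measurable_injOn measurable_fst
      (hfst.mono Set.inter_subset_left)
  · intro x y
    have := hrange _ (hf x)
    have h2 : y ∈ Set.range (f x) ↔ y ∈ {y | Q.Adj x y} := by
      have : Set.range (f x) = {y | Q.Adj x y} := this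
      rw [this]
    exact h2.symm

open Classical in
lemma orientation (n : ℕ) (ν : Measure X) [IsFiniteMeasure ν] (ι : X × Fin (2*n) → X × Fin (2*n))
    (hι : Function.Involutive ι) (mι : Measurable ι) (hfree : ∀ h, ι h ≠ h) (δ : ℝ≥0∞) (hδ : 0 < δ) :
    ∃ D : Set (X × Fin (2*n)), MeasurableSet D ∧
      ν {x | ¬ ((Finset.univ.filter (fun j => (x, j) ∈ D)).card = n ∧
        (Finset.univ.filter (fun j => ι (x, j) ∈ D)).card = n ∧
        ∀ j, (x, j) ∈ D ∨ ι (x, j) ∈ D)} ≤ δ := by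
  have hδ2 : 0 < δ / 2 := ENNReal.half_pos hδ.ne'
  let P : X × Fin (2*n) → X × Fin (2*n) := fun p => (p.1, pairing Finset.univ p.2)
  have hP : Function.Involutive P := fun p => by simp only [P, pairing_inv _ _]
  have mP : Measurable P := measurable_fst.prodMk ((measurable_of_finite _).comp measurable_snd)
  obtain ⟨O, mO, h1, h2⟩ := alternate (hm ν ι) P ι hP hι mP mι (δ/2) hδ2
  obtain ⟨D, hD⟩ : ∃ D, D = O ∩ ι ⁻¹' Oᶜ := ⟨_, rfl⟩
  have hDm : ∀ h, h ∈ D ↔ h ∈ O ∧ ι h ∉ O := by intro h; rw [hD]; rfl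
  refine ⟨D, hD ▸ mO.inter (mι mO.compl), ?_⟩
  rw [← ENNReal.add_halves δ]
  refine le_trans (measure_mono ?_) ((measure_union_le _ _).trans
    (add_le_add ((hm_bound1 ν ι _).trans h1) ((hm_bound1 ν ι _).trans h2)))
  intro x hx
  by_contra hcon
  simp only [Set.mem_union, not_or, Set.mem_ofPred_eq, not_and, not_exists] at hcon
  obtain ⟨c1, c2⟩ := hcon
  apply hx
  have c1' : ∀ j, ¬ ((x, j) ∈ O ↔ ι (x, j) ∈ O) := fun j => c1 j (hfree _)
  have hev : Even (Finset.univ : Finset (Fin (2*n))).card := by simp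
  have hc := half_card Finset.univ hev (fun j => (x, j) ∈ O) (fun j hj =>
    c2 j (fun h => hj (congrArg Prod.snd h)))
  have hc' := Finset.card_filter_add_card_filter_not (s := (Finset.univ : Finset (Fin (2*n)))) (fun j => (x, j) ∈ O)
  simp only [Finset.card_univ, Fintype.card_fin] at hc hc'
  refine ⟨?_, ?_, ?_⟩
  · rw [show (Finset.univ.filter (fun j => (x, j) ∈ D)) = Finset.univ.filter (fun j => (x, j) ∈ O) from ?_]
    · omega
    · refine Finset.filter_congr fun j _ => ?_
      have := c1' j
      simp only [hDm]
      tauto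
  · rw [show (Finset.univ.filter (fun j => ι (x, j) ∈ D)) = Finset.univ.filter (fun j => ¬ (x, j) ∈ O) from ?_]
    · omega
    · refine Finset.filter_congr fun j _ => ?_
      have := c1' j
      simp only [hDm, hι _]
      tauto
  · intro j
    have := c1' j
    simp only [hDm, hι _]
    tauto

end
end SchreierAux

open SchreierAux in
/-- Grebík. Every `2n`-regular Borel graph on a standard Borel
probability space admits a partial Schreier decoration whose set of fully decorated
vertices has measure at least `1 − ε`. -/
theorem exists_partial_schreier_decoration
    (n : ℕ) (hn : 1 ≤ n)
    {X : Type*} [MeasurableSpace X] [StandardBorelSpace X]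
    (Q : SimpleGraph X)
    (hQBorel : MeasurableSet {p : X × X | Q.Adj p.1 p.2})
    (hQreg : ∀ x : X, Nat.card {y : X // Q.Adj x y} = 2 * n)
    (μ : Measure X) [IsProbabilityMeasure μ]
    (ε : ℝ) (hε : 0 < ε) :
    ∃ (A : Fin n → Set X) (p : Fin n → X → X),
      (∀ i, MeasurableSet (A i)) ∧
      (∀ i, Measurable (p i)) ∧
      (∀ i, Set.InjOn (p i) (A i)) ∧
      (∀ i, ∀ x ∈ A i, Q.Adj x (p i x)) ∧
      1 - ε ≤ (μ {x : X |
          (∀ i, x ∈ A i ∧ x ∈ p i '' A i) ∧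
          {y : X | Q.Adj x y} =
            {y : X | ∃ i, y = p i x} ∪ {y : X | ∃ i, y ∈ A i ∧ p i y = x}}).toReal := by
  classical
  obtain ⟨f, mf, fi, fadj⟩ := enumeration (2 * n) (by omega) Q hQBorel hQreg
  have mfj : ∀ j, Measurable (fun x => f x j) := fun j => (measurable_pi_apply j).comp mf
  have hg : ∀ h : X × Fin (2 * n), ∃ i, f (f h.1 h.2) i = h.1 := by
    intro h
    exact (fadj _ _).1 (((fadj h.1 (f h.1 h.2)).2 ⟨h.2, rfl⟩).symm)
  choose g hg using hg
  let ι : X × Fin (2 * n) → X × Fin (2 * n) := fun h => (f h.1 h.2, g h)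
  have mF : Measurable (fun h : X × Fin (2 * n) => f h.1 h.2) :=
    measurable_from_prod_countable_left fun j => mfj j
  have mg : Measurable g := by
    refine measurable_from_prod_countable_left fun j => ?_
    refine measurable_to_countable' fun i => ?_
    have : (fun x => g (x, j)) ⁻¹' {i} = {x | f (f x j) i = x} := by
      ext x
      constructor
      · intro h
        have h' : g (x, j) = i := h
        have := hg (x, j)
        rw [h'] at this
        exact this
      · intro h
        exact fi _ ((hg (x, j)).trans (Eq.symm h))
    rw [this]
    exact measurableSet_eq_fun ((mfj i).comp (mfj j)) measurable_id
  have mι : Measurable ι := mF.prodMk mg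
  have ι1 : ∀ h, (ι h).1 = f h.1 h.2 := fun h => rfl
  have hι1 : ∀ h, (ι (ι h)).1 = h.1 := fun h => hg h
  have hι : Function.Involutive ι := by
    intro h
    refine Prod.ext (hι1 h) ?_
    have h2 := hg (ι h)
    have e : f (ι h).1 (ι h).2 = h.1 := hg h
    rw [e] at h2
    exact fi _ h2
  have hfree : ∀ h, ι h ≠ h := by
    intro h hh
    have h1 : Q.Adj h.1 (f h.1 h.2) := (fadj _ _).2 ⟨h.2, rfl⟩
    have h2 : f h.1 h.2 = h.1 := congrArg Prod.fst hh
    rw [h2] at h1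
    exact Q.loopless.irrefl _ h1
  let ν : Measure X := μ + (μ.prod Measure.count).map (fun h : X × Fin (2 * n) => f h.1 h.2)
  have hν : ∀ B : Set X, μ {x | x ∈ B ∨ ∃ j, f x j ∈ B} ≤ ν B := by
    intro B
    have h1 := proj_bound μ ((fun h : X × Fin (2 * n) => f h.1 h.2) ⁻¹' B)
    have h2 := h1.trans (Measure.le_map_apply mF.aemeasurable B)
    calc μ {x | x ∈ B ∨ ∃ j, f x j ∈ B} ≤ μ (B ∪ {x | ∃ j, f x j ∈ B}) := measure_mono fun x hx => hx
      _ ≤ μ B + μ {x | ∃ j, f x j ∈ B} := measure_union_le _ _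
      _ ≤ ν B := by
        simp only [ν, Measure.add_apply]
        exact add_le_add le_rfl h2
  set δ : ENNReal := ENNReal.ofReal ε with hδdef
  have hδ : 0 < δ := ENNReal.ofReal_pos.2 hε
  have hδ2 : 0 < δ / 2 := ENNReal.half_pos hδ.ne'
  obtain ⟨D, mD, hD⟩ := orientation n ν ι hι mι hfree (δ/2) hδ2
  obtain ⟨M, mM, hMD, hM⟩ := colors ν ι hι mι n D mD (δ/2) hδ2
  let G : Set X := {x | (∀ j, (x, j) ∈ D ∨ ι (x, j) ∈ D) ∧
    (∀ i, ∃! j, (x, j) ∈ M i) ∧ (∀ i, ∃! j, ι (x, j) ∈ M i) ∧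
    (∀ j, (x, j) ∈ D → ∃ i, (x, j) ∈ M i) ∧ (∀ j, ι (x, j) ∈ D → ∃ i, ι (x, j) ∈ M i)}
  have hG : ν Gᶜ ≤ δ := by
    rw [← ENNReal.add_halves δ]
    refine le_trans (measure_mono ?_) ((measure_union_le _ _).trans (add_le_add hD hM))
    intro x hx
    by_contra hcon
    rw [Set.mem_union, not_or] at hcon
    obtain ⟨c1, c2⟩ := hcon
    have c1 := not_not.1 c1
    have c2 := not_not.1 (fun h => c2 ⟨c1.1, c1.2.1, h⟩)
    exact hx ⟨c1.2.2, c2⟩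
  let j0 : Fin (2 * n) := ⟨0, by omega⟩
  let ch : Finset (Fin (2 * n)) → Fin (2 * n) := fun F => if h : F.Nonempty then h.choose else j0
  let _ : MeasurableSpace (Finset (Fin (2 * n))) := ⊤
  have mS : ∀ D : Set (X × Fin (2 * n)), MeasurableSet D →
      Measurable (fun x => Finset.univ.filter (fun j => (x, j) ∈ D)) := fun D hD =>
    measurable_to_countable' (fun F => measurable_section D hD F)
  have mU : ∀ D : Set (X × Fin (2 * n)), MeasurableSet D → MeasurableSet {x | ∃! j, (x, j) ∈ D} := by
    intro D hD
    have : {x | ∃! j, (x, j) ∈ D} =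
        (fun x => Finset.univ.filter (fun j => (x, j) ∈ D)) ⁻¹' {F | ∃! j, j ∈ F} := by
      ext x; simp
    rw [this]
    exact mS D hD trivial
  let p : Fin n → X → X := fun i x => f x (ch (Finset.univ.filter (fun j => (x, j) ∈ M i)))
  have mp : ∀ i, Measurable (p i) := by
    intro i
    have h1 : Measurable (fun x => ch (Finset.univ.filter (fun j => (x, j) ∈ M i))) :=
      (measurable_from_top (f := ch)).comp (mS _ (mM i))
    exact mF.comp (measurable_id.prodMk h1)
  have hp : ∀ i x j, (∃! j, (x, j) ∈ M i) → (x, j) ∈ M i → p i x = f x j := by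
    intro i x j hu hj
    have hne : (Finset.univ.filter (fun j => (x, j) ∈ M i)).Nonempty := ⟨j, by simpa using hj⟩
    have h1 : ch (Finset.univ.filter (fun j => (x, j) ∈ M i)) ∈ Finset.univ.filter (fun j => (x, j) ∈ M i) := by
      simp only [ch, dif_pos hne]
      exact hne.choose_spec
    have h2 := (Finset.mem_filter.1 h1).2
    show f x _ = f x j
    rw [hu.unique h2 hj]
  let A : Fin n → Set X := fun i => {x | ∃! j, (x, j) ∈ M i} ∩ p i ⁻¹' {x | ∃! j, ι (x, j) ∈ M i}
  refine ⟨A, p, ?_, mp, ?_, ?_, ?_⟩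
  · intro i
    exact (mU _ (mM i)).inter (mp i (mU _ (mι (mM i))))
  · intro i x hx y hy hxy
    obtain ⟨j, hj, _⟩ := hx.1
    obtain ⟨l, hl, _⟩ := hy.1
    have ex := hp i x j hx.1 hj
    have ey := hp i y l hy.1 hl
    have e1 : ι (x, j) = (p i x, g (x, j)) := by rw [ex]
    have e2 : ι (y, l) = (p i x, g (y, l)) := by rw [hxy, ey]
    have e1' : ι (p i x, g (x, j)) = (x, j) := by rw [← e1, hι]
    have e2' : ι (p i x, g (y, l)) = (y, l) := by rw [← e2, hι]
    have hu : ∃! j, ι (p i x, j) ∈ M i := hx.2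
    have := hu.unique (y₁ := g (x, j)) (y₂ := g (y, l)) (by rw [e1']; exact hj) (by rw [e2']; exact hl)
    rw [this, e2'] at e1'
    exact (congrArg Prod.fst e1').symm
  · intro i x _
    exact (fadj _ _).2 ⟨_, rfl⟩
  · set C : Set X := {x : X |
          (∀ i, x ∈ A i ∧ x ∈ p i '' A i) ∧
          {y : X | Q.Adj x y} =
            {y : X | ∃ i, y = p i x} ∪ {y : X | ∃ i, y ∈ A i ∧ p i y = x}} with hC
    have hsub : ∀ x, x ∈ G → (∀ j, f x j ∈ G) → x ∈ C := by
      intro x hx hxn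
      obtain ⟨g1, g2, g3, g4, g5⟩ := hx
      have hA : ∀ i, x ∈ A i := by
        intro i
        exact ⟨g2 i, (hxn _).2.2.1 i⟩
      -- incoming edges
      have hin : ∀ i j, ι (x, j) ∈ M i → f x j ∈ A i ∧ p i (f x j) = x := by
        intro i j hj
        have hy := (hxn j).2.1 i
        have e : p i (f x j) = x := by
          rw [hp i (f x j) (g (x, j)) hy hj]
          exact hg (x, j)
        refine ⟨⟨hy, ?_⟩, e⟩
        show ∃! l, ι (p i (f x j), l) ∈ M i
        rw [e]
        exact g3 i
      refine ⟨fun i => ⟨hA i, ?_⟩, ?_⟩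
      · obtain ⟨j, hj, _⟩ := g3 i
        obtain ⟨h1, h2⟩ := hin i j hj
        exact ⟨_, h1, h2⟩
      · ext y
        constructor
        · intro hy
          obtain ⟨j, rfl⟩ := (fadj x y).1 hy
          rcases g1 j with h | h
          · obtain ⟨i, hi⟩ := g4 j h
            exact Or.inl ⟨i, (hp i x j (g2 i) hi).symm⟩
          · obtain ⟨i, hi⟩ := g5 j h
            exact Or.inr ⟨i, hin i j hi⟩
        · rintro (⟨i, rfl⟩ | ⟨i, h1, h2⟩)
          · exact (fadj _ _).2 ⟨_, rfl⟩
          · have : Q.Adj y (p i y) := (fadj _ _).2 ⟨_, rfl⟩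
            rw [h2] at this
            exact this.symm
    have hCc : μ Cᶜ ≤ δ := by
      refine le_trans (measure_mono ?_) ((hν Gᶜ).trans hG)
      intro x hx
      by_contra hcon
      rw [Set.mem_ofPred_eq, not_or, not_exists] at hcon
      exact hx (hsub x (not_not.1 hcon.1) (fun j => not_not.1 (hcon.2 j)))
    have h1 : (1 : ENNReal) ≤ μ C + μ Cᶜ := by
      rw [← measure_univ (μ := μ), ← Set.union_compl_self C]
      exact measure_union_le _ _
    have h2 : (1 : ENNReal) ≤ μ C + ENNReal.ofReal ε := h1.trans (by gcongr)
    have h3 := ENNReal.toReal_mono (by finiteness) h2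
    rw [ENNReal.toReal_add (by finiteness) (by finiteness), ENNReal.toReal_ofReal hε.le] at h3
    simp only [ENNReal.toReal_one] at h3
    linarith
end
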